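/- Let F be a labelled graph with m = |F| vertices, let p ∈ [0,1], and let α_1,…,α_m ∈ (0,1) with Σ_{i=1}^m α_i ≤ 1. Then the property P(F;α_1,…,α_m) of graph sequences is p-quasi-random if and only if every graphon W satisfying P^W(F;α_1,…,α_m) is a.e. equal to the constant p. Similarly, the property P̃(F;α_1,…,α_m) of graph sequences is p-quasi-random if and only if every graphon W satisfying P̃^W(F;α_1,…,α_m) is a.e. equal to p. -/

import Mathlib

open Filter Finset Asymptotics MeasureTheory

/-- `labCount F G U` is the number of injective graph homomorphisms `φ : F → G`
with `φ i ∈ U i` for every vertex `i` of `F` (the quantity `N(F,G;U₁,…,U_m)`). -/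
noncomputable def labCount {m : ℕ} {β : Type} [Fintype β]
    (F : SimpleGraph (Fin m)) (G : SimpleGraph β) (U : Fin m → Finset β) : ℕ :=
  Nat.card {φ : Fin m → β //
    Function.Injective φ ∧ (∀ i j, F.Adj i j → G.Adj (φ i) (φ j)) ∧ ∀ i, φ i ∈ U i}

/-- `totalCount F G` is the total number of injective graph homomorphisms `F → G`,
the quantity `N(F,G)`. -/
noncomputable def totalCount {m : ℕ} {β : Type} [Fintype β]
    (F : SimpleGraph (Fin m)) (G : SimpleGraph β) : ℕ :=
  Nat.card {φ : Fin m → β //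
    Function.Injective φ ∧ ∀ i j, F.Adj i j → G.Adj (φ i) (φ j)}

/-- `symCount F G U` is `Ñ(F,G;U₁,…,U_m) = (1/m!) ∑_σ N(F,G;U_{σ(1)},…,U_{σ(m)})`. -/
noncomputable def symCount {m : ℕ} {β : Type} [Fintype β]
    (F : SimpleGraph (Fin m)) (G : SimpleGraph β) (U : Fin m → Finset β) : ℝ :=
  ((m.factorial : ℝ))⁻¹ * ∑ σ : Equiv.Perm (Fin m), (labCount F G (fun i => U (σ i)) : ℝ)

/-- `numEdges F` is `e(F)`, the number of edges of `F`. -/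
noncomputable def numEdges {m : ℕ} (F : SimpleGraph (Fin m)) : ℕ := Nat.card F.edgeSet

/-- A sequence of graphs `G n` on vertex sets `Fin (V n)` is `p`-quasi-random if, for every
finite simple graph `F`, `N(F,G_n) = p^(e F) |G_n|^(|F|) + o(|G_n|^(|F|))`. -/
def IsQuasirandom (p : ℝ) (V : ℕ → ℕ) (G : ∀ n, SimpleGraph (Fin (V n))) : Prop :=
  ∀ (m : ℕ) (F : SimpleGraph (Fin m)),
    (fun n => (totalCount F (G n) : ℝ) - p ^ numEdges F * (V n : ℝ) ^ m)
      =o[atTop] (fun n => (V n : ℝ) ^ m)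

/-- The property `P(F;α₁,…,α_m)`: `N(F,G_n;U₁,…,U_m) = p^(e F) ∏ |U_i| + o(|G_n|^m)`,
uniformly over all pairwise disjoint `U₁,…,U_m ⊆ V(G_n)` with `|U_i| = ⌊α_i |G_n|⌋`. -/
def SatisfiesP {m : ℕ} (F : SimpleGraph (Fin m)) (p : ℝ) (α : Fin m → ℝ)
    (V : ℕ → ℕ) (G : ∀ n, SimpleGraph (Fin (V n))) : Prop :=
  ∃ ε : ℕ → ℝ, Tendsto ε atTop (nhds 0) ∧
    ∀ (n : ℕ) (U : Fin m → Finset (Fin (V n))),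
      Pairwise (fun i j => Disjoint (U i) (U j)) →
      (∀ i, (U i).card = ⌊α i * (V n : ℝ)⌋₊) →
      |(labCount F (G n) U : ℝ) - p ^ numEdges F * ∏ i, ((U i).card : ℝ)|
        ≤ ε n * (V n : ℝ) ^ m

/-- The property `P̃(F;α₁,…,α_m)`: as `SatisfiesP` but with the symmetrized count `Ñ`. -/
def SatisfiesPt {m : ℕ} (F : SimpleGraph (Fin m)) (p : ℝ) (α : Fin m → ℝ)
    (V : ℕ → ℕ) (G : ∀ n, SimpleGraph (Fin (V n))) : Prop :=
  ∃ ε : ℕ → ℝ, Tendsto ε atTop (nhds 0) ∧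
    ∀ (n : ℕ) (U : Fin m → Finset (Fin (V n))),
      Pairwise (fun i j => Disjoint (U i) (U j)) →
      (∀ i, (U i).card = ⌊α i * (V n : ℝ)⌋₊) →
      |symCount F (G n) U - p ^ numEdges F * ∏ i, ((U i).card : ℝ)|
        ≤ ε n * (V n : ℝ) ^ m

/-- The property `Pᵘ(F;α₁,…,α_m)`: `P` holds for every labelling of `F`. -/
def SatisfiesPu {m : ℕ} (F : SimpleGraph (Fin m)) (p : ℝ) (α : Fin m → ℝ)
    (V : ℕ → ℕ) (G : ∀ n, SimpleGraph (Fin (V n))) : Prop :=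
  ∀ σ : Equiv.Perm (Fin m), SatisfiesP (SimpleGraph.map σ.toEmbedding F) p α V G

/-- A graphon: a symmetric measurable function `[0,1]² → [0,1]`
(encoded as a function on all of `ℝ × ℝ`). -/
def IsGraphon (W : ℝ → ℝ → ℝ) : Prop :=
  Measurable (Function.uncurry W) ∧ (∀ x y, W x y = W y x) ∧
    ∀ x y, W x y ∈ Set.Icc (0 : ℝ) 1

open Classical in
/-- `Ψ_{F,W}(x₁,…,x_m) = ∏_{ij ∈ E(F)} W(x_i,x_j)`. -/
noncomputable def psi {m : ℕ} (F : SimpleGraph (Fin m)) (W : ℝ → ℝ → ℝ)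
    (x : Fin m → ℝ) : ℝ :=
  ∏ i : Fin m, ∏ j : Fin m, if i < j ∧ F.Adj i j then W (x i) (x j) else 1

/-- `Ψ̃_{F,W}`, the symmetrization of `Ψ_{F,W}` over the `m` coordinates. -/
noncomputable def psiSym {m : ℕ} (F : SimpleGraph (Fin m)) (W : ℝ → ℝ → ℝ)
    (x : Fin m → ℝ) : ℝ :=
  ((m.factorial : ℝ))⁻¹ * ∑ σ : Equiv.Perm (Fin m), psi F W (fun i => x (σ i))

/-- The unit cube `[0,1]^m`. -/
def unitBox (m : ℕ) : Set (Fin m → ℝ) := Set.univ.pi fun _ => Set.Icc (0 : ℝ) 1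

/-- The unit square `[0,1]²`. -/
def unitSquare : Set (ℝ × ℝ) := Set.Icc (0 : ℝ) 1 ×ˢ Set.Icc (0 : ℝ) 1

/-- The graphon property `P^W(F;α₁,…,α_m)`:
`∫_{A₁×⋯×A_m} Ψ_{F,W} = p^(e F) ∏ λ(A_i)` for all pairwise disjoint measurable
`A₁,…,A_m ⊆ [0,1]` with `λ(A_i) = α_i`. -/
def GraphonP {m : ℕ} (F : SimpleGraph (Fin m)) (W : ℝ → ℝ → ℝ) (p : ℝ)
    (α : Fin m → ℝ) : Prop :=
  ∀ A : Fin m → Set ℝ, (∀ i, MeasurableSet (A i)) → (∀ i, A i ⊆ Set.Icc 0 1) →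
    Pairwise (fun i j => Disjoint (A i) (A j)) →
    (∀ i, volume (A i) = ENNReal.ofReal (α i)) →
    ∫ x in Set.univ.pi A, psi F W x = p ^ numEdges F * ∏ i, α i

/-- The graphon property `P̃^W(F;α₁,…,α_m)`: as `GraphonP` but with `Ψ̃_{F,W}`. -/
def GraphonPt {m : ℕ} (F : SimpleGraph (Fin m)) (W : ℝ → ℝ → ℝ) (p : ℝ)
    (α : Fin m → ℝ) : Prop :=
  ∀ A : Fin m → Set ℝ, (∀ i, MeasurableSet (A i)) → (∀ i, A i ⊆ Set.Icc 0 1) →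
    Pairwise (fun i j => Disjoint (A i) (A j)) →
    (∀ i, volume (A i) = ENNReal.ofReal (α i)) →
    ∫ x in Set.univ.pi A, psiSym F W x = p ^ numEdges F * ∏ i, α i

section Counting

variable {Ω : Type*} [MeasurableSpace Ω]

/-- The bilinear form of `D` on `[0,1]`-valued measurable functions is bounded by `c`;
this is the bound `c` on the cut norm of `D`. -/
def CutLe (μ : Measure Ω) (D : Ω → Ω → ℝ) (c : ℝ) : Prop :=
  ∀ f g : Ω → ℝ, Measurable f → Measurable g → (∀ x, f x ∈ Set.Icc (0 : ℝ) 1) →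
    (∀ x, g x ∈ Set.Icc (0 : ℝ) 1) →
    |∫ z, D z.1 z.2 * f z.1 * g z.2 ∂(μ.prod μ)| ≤ c

/-- A measurable kernel with values in `[0,1]`. -/
def IsKer (W : Ω → Ω → ℝ) : Prop :=
  Measurable (Function.uncurry W) ∧ ∀ x y, W x y ∈ Set.Icc (0 : ℝ) 1

/-- `R` is, as a function of the coordinates `i` and `j` alone, a product of two
`[0,1]`-valued measurable functions of one variable. -/
def SplitAt {m : ℕ} (i j : Fin m) (R : (Fin m → Ω) → ℝ) : Prop :=
  ∀ x, ∃ f g : Ω → ℝ, Measurable f ∧ Measurable g ∧ (∀ a, f a ∈ Set.Icc (0 : ℝ) 1) ∧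
    (∀ a, g a ∈ Set.Icc (0 : ℝ) 1) ∧
    ∀ a b, R (Function.update (Function.update x i a) j b) = f a * g b

lemma measurable_uncurry_comp {X : Type*} [MeasurableSpace X] {D : Ω → Ω → ℝ}
    (hD : Measurable (Function.uncurry D)) {u v : X → Ω} (hu : Measurable u)
    (hv : Measurable v) : Measurable (fun x => D (u x) (v x)) :=
  (hD.comp (hu.prodMk hv) :)

lemma Icc_mul_mem {a b : ℝ} (ha : a ∈ Set.Icc (0 : ℝ) 1) (hb : b ∈ Set.Icc (0 : ℝ) 1) :
    a * b ∈ Set.Icc (0 : ℝ) 1 :=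
  ⟨mul_nonneg ha.1 hb.1, mul_le_one₀ ha.2 hb.1 hb.2⟩

lemma Icc_prod_mem {ι : Type*} (s : Finset ι) {f : ι → ℝ}
    (h : ∀ i ∈ s, f i ∈ Set.Icc (0 : ℝ) 1) : ∏ i ∈ s, f i ∈ Set.Icc (0 : ℝ) 1 :=
  ⟨Finset.prod_nonneg fun i hi => (h i hi).1, Finset.prod_le_one (fun i hi => (h i hi).1)
    fun i hi => (h i hi).2⟩

lemma SplitAt.mul {m : ℕ} {i j : Fin m} {R S : (Fin m → Ω) → ℝ}
    (hR : SplitAt i j R) (hS : SplitAt i j S) : SplitAt i j (fun x => R x * S x) := by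
  intro x
  obtain ⟨f, g, hf, hg, hf', hg', h⟩ := hR x
  obtain ⟨f₂, g₂, hf₂, hg₂, hf₂', hg₂', h₂⟩ := hS x
  refine ⟨fun a => f a * f₂ a, fun a => g a * g₂ a, hf.mul hf₂, hg.mul hg₂,
    fun a => Icc_mul_mem (hf' a) (hf₂' a), fun a => Icc_mul_mem (hg' a) (hg₂' a), ?_⟩
  intro a b
  simp only [h, h₂]
  ring

lemma SplitAt.one {m : ℕ} (i j : Fin m) : SplitAt i j (fun _ : Fin m → Ω => (1 : ℝ)) :=
  fun _ => ⟨fun _ => 1, fun _ => 1, measurable_const, measurable_const, by simp, by simp, by simp⟩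

lemma SplitAt.prod {m : ℕ} {i j : Fin m} {ι : Type*} (s : Finset ι)
    {R : ι → (Fin m → Ω) → ℝ} (h : ∀ k ∈ s, SplitAt i j (R k)) :
    SplitAt i j (fun x => ∏ k ∈ s, R k x) := by
  classical
  induction s using Finset.induction_on with
  | empty => simpa using SplitAt.one i j
  | insert k s hk ih =>
    simp only [Finset.prod_insert hk]
    exact (h k (by simp)).mul (ih fun l hl => h l (by simp [hl]))

lemma SplitAt.apply {m : ℕ} {i j : Fin m} (hij : i ≠ j) (k : Fin m) {h : Ω → ℝ}
    (hm : Measurable h) (hI : ∀ a, h a ∈ Set.Icc (0 : ℝ) 1) :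
    SplitAt i j (fun x => h (x k)) := by
  intro x
  by_cases hj : k = j
  · subst hj
    exact ⟨fun _ => 1, h, measurable_const, hm, by simp, hI, by simp⟩
  by_cases hi : k = i
  · subst hi
    exact ⟨h, fun _ => 1, hm, measurable_const, hI, by simp, by simp [Function.update_of_ne hij]⟩
  · exact ⟨fun _ => h (x k), fun _ => 1, measurable_const, measurable_const, fun _ => hI _,
      by simp, by simp [Function.update_of_ne hi, Function.update_of_ne hj]⟩

lemma IsKer.measurable_left {W : Ω → Ω → ℝ} (hW : IsKer W) (y : Ω) :
    Measurable (fun x => W x y) :=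
  hW.1.comp (measurable_id.prodMk measurable_const)

lemma IsKer.measurable_right {W : Ω → Ω → ℝ} (hW : IsKer W) (x : Ω) :
    Measurable (fun y => W x y) :=
  hW.1.comp (measurable_const.prodMk measurable_id)

lemma SplitAt.ker {m : ℕ} {i j k l : Fin m} (hij : i < j) (hkl : k < l)
    (hne : (k, l) ≠ (i, j)) {W : Ω → Ω → ℝ} (hW : IsKer W) :
    SplitAt i j (fun x => W (x k) (x l)) := by
  intro x
  by_cases hki : k = i
  · subst hki
    have hlj : l ≠ j := fun h => hne (by rw [h])
    refine ⟨fun a => W a (x l), fun _ => 1, hW.measurable_left _, measurable_const,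
      fun _ => hW.2 _ _, by simp, ?_⟩
    intro a b
    simp [Function.update_of_ne hij.ne, Function.update_of_ne hlj, Function.update_of_ne hkl.ne']
  by_cases hkj : k = j
  · subst hkj
    have hli : l ≠ i := (hij.trans hkl).ne'
    refine ⟨fun _ => 1, fun a => W a (x l), measurable_const, hW.measurable_left _, by simp,
      fun _ => hW.2 _ _, ?_⟩
    intro a b
    simp [Function.update_of_ne hkl.ne', Function.update_of_ne hli]
  by_cases hli : l = i
  · subst hli
    refine ⟨fun a => W (x k) a, fun _ => 1, hW.measurable_right _, measurable_const,
      fun _ => hW.2 _ _, by simp, ?_⟩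
    intro a b
    simp [Function.update_of_ne hij.ne, Function.update_of_ne hki, Function.update_of_ne hkj]
  by_cases hlj : l = j
  · subst hlj
    refine ⟨fun _ => 1, fun a => W (x k) a, measurable_const, hW.measurable_right _, by simp,
      fun _ => hW.2 _ _, ?_⟩
    intro a b
    simp [Function.update_of_ne hki, Function.update_of_ne hkj]
  · refine ⟨fun _ => W (x k) (x l), fun _ => 1, measurable_const, measurable_const,
      fun _ => hW.2 _ _, by simp, ?_⟩
    intro a b
    simp [Function.update_of_ne hki, Function.update_of_ne hkj, Function.update_of_ne hli,
      Function.update_of_ne hlj]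

variable (μ : Measure Ω) [IsProbabilityMeasure μ]

lemma measurePreserving_update {m : ℕ} (i : Fin m) :
    MeasurePreserving (fun z : (Fin m → Ω) × Ω => Function.update z.1 i z.2)
      ((Measure.pi fun _ : Fin m => μ).prod μ) (Measure.pi fun _ => μ) := by
  have hmeas : Measurable (fun z : (Fin m → Ω) × Ω => Function.update z.1 i z.2) := by
    rw [measurable_pi_iff]
    intro k
    by_cases hk : k = i
    · subst hk; simpa using measurable_snd
    · simp only [Function.update_of_ne hk]
      fun_prop
  refine ⟨hmeas, ?_⟩
  symm
  apply Measure.pi_eq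
  intro s hs
  rw [Measure.map_apply hmeas (MeasurableSet.univ_pi hs)]
  have : (fun z : (Fin m → Ω) × Ω => Function.update z.1 i z.2) ⁻¹' (Set.univ.pi s)
      = (Set.univ.pi (Function.update s i Set.univ)) ×ˢ (s i) := by
    ext ⟨x, a⟩
    simp only [Set.mem_preimage, Set.mem_univ_pi, Set.mem_prod]
    constructor
    · intro h
      refine ⟨fun k => ?_, by simpa using h i⟩
      by_cases hk : k = i
      · subst hk; simp
      · simpa [Function.update_of_ne hk] using h k
    · rintro ⟨h, h'⟩ k
      by_cases hk : k = i
      · subst hk; simpa using h'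
      · simpa [Function.update_of_ne hk] using h k
  rw [this, Measure.prod_prod, Measure.pi_pi]
  rw [← Finset.mul_prod_erase _ _ (Finset.mem_univ i),
    ← Finset.mul_prod_erase (a := i) _ (fun k => μ (s k)) (Finset.mem_univ i)]
  simp only [Function.update_self, measure_univ, one_mul]
  rw [mul_comm]
  congr 1
  refine Finset.prod_congr rfl fun k hk => ?_
  rw [Function.update_of_ne (Finset.ne_of_mem_erase hk)]

variable {μ}

lemma integrable_of_Icc {X : Type*} [MeasurableSpace X] {ν : Measure X} [IsFiniteMeasure ν]
    {f : X → ℝ} (hf : Measurable f) (C : ℝ) (h : ∀ x, |f x| ≤ C) : Integrable f ν :=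
  Integrable.of_bound hf.aestronglyMeasurable C (Eventually.of_forall fun x => h x)

lemma CutLe.abs_integral_split {m : ℕ} {i j : Fin m} (hij : i ≠ j) {D : Ω → Ω → ℝ} {c : ℝ}
    (hD : CutLe μ D c) (hDm : Measurable (Function.uncurry D)) (hDb : ∀ x y, |D x y| ≤ 1)
    {R : (Fin m → Ω) → ℝ} (hR : SplitAt i j R) (hRm : Measurable R)
    (hRb : ∀ x, R x ∈ Set.Icc (0 : ℝ) 1) :
    |∫ x, D (x i) (x j) * R x ∂(Measure.pi fun _ => μ)| ≤ c := by
  set π : Measure (Fin m → Ω) := Measure.pi fun _ => μ with hπ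
  have hΦm : Measurable (fun x : Fin m → Ω => D (x i) (x j) * R x) :=
    (measurable_uncurry_comp hDm (measurable_pi_apply i) (measurable_pi_apply j)).mul hRm
  have hΦb : ∀ x : Fin m → Ω, |D (x i) (x j) * R x| ≤ 1 := fun x => by
    rw [abs_mul]
    exact mul_le_one₀ (hDb _ _) (abs_nonneg _) (by rw [abs_of_nonneg (hRb x).1]; exact (hRb x).2)
  have hmp : MeasurePreserving
      (fun z : (Fin m → Ω) × (Ω × Ω) =>
        Function.update (Function.update z.1 i z.2.1) j z.2.2) (π.prod (μ.prod μ)) π := by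
    have h1 := measurePreserving_update μ i
    have h2 := measurePreserving_update μ j
    have h3 : MeasurePreserving (Prod.map
        (fun z : (Fin m → Ω) × Ω => Function.update z.1 i z.2) (id : Ω → Ω))
        ((π.prod μ).prod μ) (π.prod μ) := h1.prod (MeasurePreserving.id μ)
    have h4 : MeasurePreserving (MeasurableEquiv.prodAssoc.symm :
        (Fin m → Ω) × (Ω × Ω) → ((Fin m → Ω) × Ω) × Ω) (π.prod (μ.prod μ)) ((π.prod μ).prod μ) :=
      (measurePreserving_prodAssoc π μ μ).symm
    exact (h2.comp h3).comp h4
  have e1 : ∫ x, D (x i) (x j) * R x ∂π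
      = ∫ z : (Fin m → Ω) × (Ω × Ω),
        D z.2.1 z.2.2 * R (Function.update (Function.update z.1 i z.2.1) j z.2.2)
          ∂(π.prod (μ.prod μ)) := by
    conv_lhs => rw [← hmp.map_eq]
    rw [integral_map hmp.measurable.aemeasurable hΦm.aestronglyMeasurable]
    simp [Function.update_of_ne hij]
  have hInt : Integrable (fun z : (Fin m → Ω) × (Ω × Ω) =>
      D z.2.1 z.2.2 * R (Function.update (Function.update z.1 i z.2.1) j z.2.2))
      (π.prod (μ.prod μ)) := by
    have := hΦm.comp hmp.measurable
    refine integrable_of_Icc (C := 1) ?_ ?_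
    · convert this using 2 with z
      simp [Function.update_of_ne hij]
    · intro z
      have := hΦb (Function.update (Function.update z.1 i z.2.1) j z.2.2)
      simpa [Function.update_of_ne hij] using this
  rw [e1, integral_prod _ hInt]
  have := norm_integral_le_of_norm_le_const (μ := π) (C := c)
    (f := fun x => ∫ z : Ω × Ω, D z.1 z.2 *
      R (Function.update (Function.update x i z.1) j z.2) ∂(μ.prod μ)) (Eventually.of_forall ?_)
  · simpa using this
  · intro x
    obtain ⟨f, g, hf, hg, hf', hg', h⟩ := hR x
    have := hD f g hf hg hf' hg'
    simp only [h, Real.norm_eq_abs]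
    convert this using 4 with z
    ring

lemma cutLe_prod_aux {m : ℕ} {U W : Ω → Ω → ℝ} (hU : IsKer U) (hW : IsKer W) {c : ℝ}
    (hc : CutLe μ (fun x y => U x y - W x y) c) {f : Fin m → Ω → ℝ}
    (hf : ∀ i, Measurable (f i)) (hf' : ∀ i x, f i x ∈ Set.Icc (0 : ℝ) 1)
    (E : Finset (Fin m × Fin m)) : ∀ E' : Finset (Fin m × Fin m),
    (∀ e ∈ E ∪ E', e.1 < e.2) → Disjoint E E' →
    |∫ x, (∏ e ∈ E, U (x e.1) (x e.2) - ∏ e ∈ E, W (x e.1) (x e.2)) *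
      ((∏ e ∈ E', W (x e.1) (x e.2)) * ∏ i, f i (x i)) ∂(Measure.pi fun _ => μ)|
      ≤ E.card * c := by
  have mk : ∀ {K : Ω → Ω → ℝ} (_ : IsKer K) (k l : Fin m),
      Measurable (fun x : Fin m → Ω => K (x k) (x l)) := fun hK k l =>
    measurable_uncurry_comp hK.1 (measurable_pi_apply k) (measurable_pi_apply l)
  have mp : ∀ {K : Ω → Ω → ℝ} (_ : IsKer K) (E : Finset (Fin m × Fin m)),
      Measurable (fun x : Fin m → Ω => ∏ e ∈ E, K (x e.1) (x e.2)) := fun hK E =>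
    Finset.measurable_prod _ fun e _ => mk hK _ _
  have mf : Measurable (fun x : Fin m → Ω => ∏ i, f i (x i)) :=
    Finset.measurable_prod _ fun i _ => (hf i).comp (measurable_pi_apply i)
  induction E using Finset.induction_on with
  | empty => intro E' _ _; simp
  | insert e E he ih =>
    intro E' hlt hdis
    have hIH := ih (insert e E') (fun e' he' => hlt e' (by
      simp only [Finset.mem_union, Finset.mem_insert] at he' ⊢; tauto)) (by
        rw [Finset.disjoint_insert_right]
        exact ⟨he, (Finset.disjoint_insert_left.1 hdis).2⟩)
    have heE' : e ∉ E' := (Finset.disjoint_insert_left.1 hdis).1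
    have helt : e.1 < e.2 := hlt e (by simp)
    set R : (Fin m → Ω) → ℝ := fun x => (∏ e ∈ E, U (x e.1) (x e.2)) *
      ((∏ e ∈ E', W (x e.1) (x e.2)) * ∏ i, f i (x i)) with hR
    have hRm : Measurable R := (mp hU E).mul ((mp hW E').mul mf)
    have hRb : ∀ x, R x ∈ Set.Icc (0 : ℝ) 1 := fun x =>
      Icc_mul_mem (Icc_prod_mem _ fun e _ => hU.2 _ _) (Icc_mul_mem
        (Icc_prod_mem _ fun e _ => hW.2 _ _) (Icc_prod_mem _ fun i _ => hf' _ _))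
    have hRs : SplitAt e.1 e.2 R := by
      refine SplitAt.mul (SplitAt.prod _ fun e' he' => ?_)
        (SplitAt.mul (SplitAt.prod _ fun e' he' => ?_) (SplitAt.prod _ fun i _ => ?_))
      · refine SplitAt.ker helt (hlt e' (by simp [he'])) ?_ hU
        rintro h
        exact he (by rwa [show e = e' from h.symm])
      · refine SplitAt.ker helt (hlt e' (by simp [he'])) ?_ hW
        rintro h
        exact heE' (by rwa [show e = e' from h.symm])
      · exact SplitAt.apply helt.ne i (hf i) (hf' i)
    have h1 := hc.abs_integral_split helt.ne
      ((measurable_uncurry_comp hU.1 measurable_fst measurable_snd).sub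
        (measurable_uncurry_comp hW.1 measurable_fst measurable_snd))
      (fun x y => by
        rw [abs_le]
        constructor <;> linarith [(hU.2 x y).1, (hU.2 x y).2, (hW.2 x y).1, (hW.2 x y).2])
      hRs hRm hRb
    have hi1 : Integrable (fun x : Fin m → Ω => (U (x e.1) (x e.2) - W (x e.1) (x e.2)) * R x)
        (Measure.pi fun _ => μ) := by
      refine integrable_of_Icc (((mk hU _ _).sub (mk hW _ _)).mul hRm) 1 fun x => ?_
      rw [abs_mul]
      refine mul_le_one₀ ?_ (abs_nonneg _) (by rw [abs_of_nonneg (hRb x).1]; exact (hRb x).2)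
      have h1 := hU.2 (x e.1) (x e.2)
      have h2 := hW.2 (x e.1) (x e.2)
      rw [abs_le]
      constructor <;> linarith [h1.1, h1.2, h2.1, h2.2]
    have hi2 : Integrable (fun x : Fin m → Ω =>
        (∏ e ∈ E, U (x e.1) (x e.2) - ∏ e ∈ E, W (x e.1) (x e.2)) *
      ((∏ e ∈ insert e E', W (x e.1) (x e.2)) * ∏ i, f i (x i))) (Measure.pi fun _ => μ) := by
      refine integrable_of_Icc (((mp hU _).sub (mp hW _)).mul ((mp hW _).mul mf)) 1 fun x => ?_
      rw [abs_mul]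
      have h3 : (∏ e ∈ insert e E', W (x e.1) (x e.2)) * ∏ i, f i (x i) ∈ Set.Icc (0 : ℝ) 1 :=
        Icc_mul_mem (Icc_prod_mem _ fun e _ => hW.2 _ _) (Icc_prod_mem _ fun i _ => hf' _ _)
      refine mul_le_one₀ ?_ (abs_nonneg _) (by rw [abs_of_nonneg h3.1]; exact h3.2)
      have h1 : ∏ e ∈ E, U (x e.1) (x e.2) ∈ Set.Icc (0 : ℝ) 1 :=
        Icc_prod_mem _ fun e _ => hU.2 _ _
      have h2 : ∏ e ∈ E, W (x e.1) (x e.2) ∈ Set.Icc (0 : ℝ) 1 :=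
        Icc_prod_mem _ fun e _ => hW.2 _ _
      rw [abs_le]
      constructor <;> linarith [h1.1, h1.2, h2.1, h2.2]
    rw [Finset.card_insert_of_notMem he]
    have e0 : ∀ x : Fin m → Ω, (∏ e ∈ insert e E, U (x e.1) (x e.2)
        - ∏ e ∈ insert e E, W (x e.1) (x e.2)) *
      ((∏ e ∈ E', W (x e.1) (x e.2)) * ∏ i, f i (x i))
      = (U (x e.1) (x e.2) - W (x e.1) (x e.2)) * R x +
        (∏ e ∈ E, U (x e.1) (x e.2) - ∏ e ∈ E, W (x e.1) (x e.2)) *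
      ((∏ e ∈ insert e E', W (x e.1) (x e.2)) * ∏ i, f i (x i)) := by
      intro x
      rw [Finset.prod_insert he, Finset.prod_insert he, Finset.prod_insert heE', hR]
      ring
    simp only [e0]
    rw [integral_add hi1 hi2]
    refine (abs_add_le _ _).trans ?_
    push_cast
    linarith

end Counting

section Densities

open Classical in
/-- The edges of `F` as ordered pairs `(i, j)` with `i < j`. -/
noncomputable def orderedEdges {m : ℕ} (F : SimpleGraph (Fin m)) : Finset (Fin m × Fin m) :=
  Finset.univ.filter fun e => e.1 < e.2 ∧ F.Adj e.1 e.2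

lemma mem_orderedEdges {m : ℕ} {F : SimpleGraph (Fin m)} {e : Fin m × Fin m} :
    e ∈ orderedEdges F ↔ e.1 < e.2 ∧ F.Adj e.1 e.2 := by
  simp [orderedEdges]

lemma psi_eq_prod {m : ℕ} (F : SimpleGraph (Fin m)) (W : ℝ → ℝ → ℝ) (x : Fin m → ℝ) :
    psi F W x = ∏ e ∈ orderedEdges F, W (x e.1) (x e.2) := by
  classical
  rw [psi, orderedEdges, Finset.prod_filter, ← Finset.univ_product_univ, Finset.prod_product]

lemma card_orderedEdges {m : ℕ} (F : SimpleGraph (Fin m)) :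
    (orderedEdges F).card = numEdges F := by
  classical
  rw [numEdges, ← Nat.card_eq_finsetCard]
  refine Nat.card_congr (Equiv.ofBijective
    (fun e => ⟨s(e.1.1, e.1.2), (mem_orderedEdges.1 e.2).2⟩) ⟨?_, ?_⟩)
  · rintro ⟨⟨a, b⟩, h⟩ ⟨⟨a', b'⟩, h'⟩ he
    have h1 := (mem_orderedEdges.1 h).1
    have h2 := (mem_orderedEdges.1 h').1
    rcases Sym2.eq_iff.1 (Subtype.mk.inj he) with ⟨rfl, rfl⟩ | ⟨rfl, rfl⟩
    · rfl
    · exact absurd h1 h2.asymm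
  · rintro ⟨e, he⟩
    induction e using Sym2.ind with
    | _ a b =>
      rcases lt_trichotomy a b with h | h | h
      · exact ⟨⟨(a, b), mem_orderedEdges.2 ⟨h, he⟩⟩, rfl⟩
      · subst h
        exact absurd he (F.loopless.irrefl a)
      · exact ⟨⟨(b, a), mem_orderedEdges.2 ⟨h, F.adj_symm he⟩⟩, Subtype.ext Sym2.eq_swap⟩

variable {Ω : Type*} [MeasurableSpace Ω] (μ : Measure Ω)

/-- The homomorphism density of `F` in the kernel `W`, weighted by functions of the vertices. -/
noncomputable def wDens {m : ℕ} (F : SimpleGraph (Fin m)) (W : Ω → Ω → ℝ)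
    (f : Fin m → Ω → ℝ) : ℝ :=
  ∫ x, (∏ e ∈ orderedEdges F, W (x e.1) (x e.2)) * ∏ i, f i (x i) ∂(Measure.pi fun _ => μ)

variable {μ} [IsProbabilityMeasure μ]

lemma measurable_edgeProd {m : ℕ} {W : Ω → Ω → ℝ} (hW : IsKer W)
    (E : Finset (Fin m × Fin m)) :
    Measurable (fun x : Fin m → Ω => ∏ e ∈ E, W (x e.1) (x e.2)) :=
  Finset.measurable_prod _ fun e _ =>
    measurable_uncurry_comp hW.1 (measurable_pi_apply e.1) (measurable_pi_apply e.2)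

lemma measurable_vertexProd {m : ℕ} {f : Fin m → Ω → ℝ} (hf : ∀ i, Measurable (f i)) :
    Measurable (fun x : Fin m → Ω => ∏ i, f i (x i)) :=
  Finset.measurable_prod _ fun i _ => (hf i).comp (measurable_pi_apply i)

lemma integrable_wDens {m : ℕ} (F : SimpleGraph (Fin m)) {W : Ω → Ω → ℝ} (hW : IsKer W)
    {f : Fin m → Ω → ℝ} (hf : ∀ i, Measurable (f i))
    (hf' : ∀ i x, f i x ∈ Set.Icc (0 : ℝ) 1) :
    Integrable (fun x : Fin m → Ω =>
      (∏ e ∈ orderedEdges F, W (x e.1) (x e.2)) * ∏ i, f i (x i)) (Measure.pi fun _ => μ) := by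
  refine integrable_of_Icc ((measurable_edgeProd hW _).mul (measurable_vertexProd hf)) 1
    fun x => ?_
  have : (∏ e ∈ orderedEdges F, W (x e.1) (x e.2)) * ∏ i, f i (x i) ∈ Set.Icc (0 : ℝ) 1 :=
    Icc_mul_mem (Icc_prod_mem _ fun e _ => hW.2 _ _) (Icc_prod_mem _ fun i _ => hf' _ _)
  rw [abs_of_nonneg this.1]
  exact this.2

/-- The counting lemma. -/
lemma abs_wDens_sub_le_cut {m : ℕ} (F : SimpleGraph (Fin m)) {U W : Ω → Ω → ℝ}
    (hU : IsKer U) (hW : IsKer W) {c : ℝ} (hc : CutLe μ (fun x y => U x y - W x y) c)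
    {f : Fin m → Ω → ℝ} (hf : ∀ i, Measurable (f i))
    (hf' : ∀ i x, f i x ∈ Set.Icc (0 : ℝ) 1) :
    |wDens μ F U f - wDens μ F W f| ≤ numEdges F * c := by
  have := cutLe_prod_aux hU hW hc hf hf' (orderedEdges F) ∅
    (fun e he => (mem_orderedEdges.1 (by simpa using he)).1) (by simp)
  rw [card_orderedEdges] at this
  rw [wDens, wDens, ← integral_sub (integrable_wDens F hU hf hf') (integrable_wDens F hW hf hf')]
  convert this using 4 with x
  simp
  ring

lemma abs_prod_sub_prod_le_sum {ι : Type*} (s : Finset ι) {f g : ι → ℝ}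
    (hf : ∀ i ∈ s, f i ∈ Set.Icc (0 : ℝ) 1) (hg : ∀ i ∈ s, g i ∈ Set.Icc (0 : ℝ) 1) :
    |∏ i ∈ s, f i - ∏ i ∈ s, g i| ≤ ∑ i ∈ s, |f i - g i| := by
  classical
  induction s using Finset.induction_on with
  | empty => simp
  | insert k s hk ih =>
    have ih' := ih (fun i hi => hf i (by simp [hi])) (fun i hi => hg i (by simp [hi]))
    have h1 := Icc_prod_mem s (fun i hi => hf i (by simp [hi]))
    have h2 := hg k (by simp)
    rw [Finset.prod_insert hk, Finset.prod_insert hk, Finset.sum_insert hk]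
    have e : f k * ∏ i ∈ s, f i - g k * ∏ i ∈ s, g i
      = (f k - g k) * ∏ i ∈ s, f i + g k * (∏ i ∈ s, f i - ∏ i ∈ s, g i) := by ring
    rw [e]
    refine (abs_add_le _ _).trans ?_
    rw [abs_mul, abs_mul, abs_of_nonneg h1.1, abs_of_nonneg h2.1]
    have a1 := mul_le_of_le_one_right (abs_nonneg (f k - g k)) h1.2
    have a2 := mul_le_of_le_one_left (abs_nonneg (∏ i ∈ s, f i - ∏ i ∈ s, g i)) h2.2
    linarith

lemma abs_wDens_sub_le_weights {m : ℕ} (F : SimpleGraph (Fin m)) {W : Ω → Ω → ℝ}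
    (hW : IsKer W) {f g : Fin m → Ω → ℝ} (hf : ∀ i, Measurable (f i))
    (hf' : ∀ i x, f i x ∈ Set.Icc (0 : ℝ) 1) (hg : ∀ i, Measurable (g i))
    (hg' : ∀ i x, g i x ∈ Set.Icc (0 : ℝ) 1) :
    |wDens μ F W f - wDens μ F W g| ≤ ∑ i, ∫ x, |f i x - g i x| ∂μ := by
  have e : ∀ i, ∫ x, |f i x - g i x| ∂μ
      = ∫ x : Fin m → Ω, |f i (x i) - g i (x i)| ∂(Measure.pi fun _ => μ) := by
    intro i
    have h := measurePreserving_eval (fun _ : Fin m => μ) i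
    have hm : Measurable (fun x => |f i x - g i x|) := ((hf i).sub (hg i)).abs
    conv_lhs => rw [← h.map_eq]
    rw [integral_map h.measurable.aemeasurable hm.aestronglyMeasurable]
  have hi : ∀ i, Integrable (fun x : Fin m → Ω => |f i (x i) - g i (x i)|)
      (Measure.pi fun _ => μ) := fun i => by
    refine integrable_of_Icc ?_ 1 fun x => ?_
    · exact (((hf i).comp (measurable_pi_apply i)).sub ((hg i).comp (measurable_pi_apply i))).abs
    · rw [abs_abs, abs_le]
      have h1 := hf' i (x i)
      have h2 := hg' i (x i)
      constructor <;> linarith [h1.1, h1.2, h2.1, h2.2]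
  simp only [e]
  rw [← integral_finsetSum _ fun i _ => hi i, wDens, wDens,
    ← integral_sub (integrable_wDens F hW hf hf') (integrable_wDens F hW hg hg')]
  refine (abs_integral_le_integral_abs).trans (integral_mono ?_ ?_ fun x => ?_)
  · exact ((integrable_wDens F hW hf hf').sub (integrable_wDens F hW hg hg')).abs
  · exact integrable_finsetSum _ fun i _ => hi i
  · have h1 : ∏ e ∈ orderedEdges F, W (x e.1) (x e.2) ∈ Set.Icc (0 : ℝ) 1 :=
      Icc_prod_mem _ fun e _ => hW.2 _ _
    have h2 := abs_prod_sub_prod_le_sum Finset.univ (f := fun i => f i (x i))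
      (g := fun i => g i (x i)) (fun i _ => hf' i _) (fun i _ => hg' i _)
    simp only
    rw [← mul_sub, abs_mul, abs_of_nonneg h1.1]
    exact (mul_le_of_le_one_left (abs_nonneg _) h1.2).trans h2

lemma abs_wDens_sub_le {m : ℕ} (F : SimpleGraph (Fin m)) {U W : Ω → Ω → ℝ}
    (hU : IsKer U) (hW : IsKer W) {c : ℝ} (hc : CutLe μ (fun x y => U x y - W x y) c)
    {f g : Fin m → Ω → ℝ} (hf : ∀ i, Measurable (f i))
    (hf' : ∀ i x, f i x ∈ Set.Icc (0 : ℝ) 1) (hg : ∀ i, Measurable (g i))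
    (hg' : ∀ i x, g i x ∈ Set.Icc (0 : ℝ) 1) :
    |wDens μ F U f - wDens μ F W g| ≤ numEdges F * c + ∑ i, ∫ x, |f i x - g i x| ∂μ := by
  have h1 := abs_wDens_sub_le_cut F hU hW hc hf hf'
  have h2 := abs_wDens_sub_le_weights (μ := μ) F hW hf hf' hg hg'
  calc _ = |(wDens μ F U f - wDens μ F W f) + (wDens μ F W f - wDens μ F W g)| := by ring_nf
    _ ≤ _ := (abs_add_le _ _).trans (add_le_add h1 h2)

lemma wDens_const {m : ℕ} (F : SimpleGraph (Fin m)) (p : ℝ) (f : Fin m → Ω → ℝ) :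
    wDens μ F (fun _ _ => p) f = p ^ numEdges F * ∏ i, ∫ x, f i x ∂μ := by
  simp only [wDens, Finset.prod_const, card_orderedEdges]
  rw [integral_const_mul, integral_fintype_prod_eq_prod]

/-- Graphon densities on `[0,1]` are integrals over the sets `A i`. -/
lemma setIntegral_psi {m : ℕ} (F : SimpleGraph (Fin m)) (W : ℝ → ℝ → ℝ)
    {A : Fin m → Set ℝ} (hA : ∀ i, MeasurableSet (A i)) (hA' : ∀ i, A i ⊆ Set.Icc 0 1) :
    ∫ x in Set.univ.pi A, psi F W x
      = wDens (volume.restrict (Set.Icc (0 : ℝ) 1)) F W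
        (fun i => (A i).indicator (fun _ => 1)) := by
  have hpi : (Measure.pi fun _ : Fin m => (volume : Measure ℝ).restrict (Set.Icc (0 : ℝ) 1))
      = volume.restrict (Set.univ.pi fun _ => Set.Icc (0 : ℝ) 1) := by
    rw [volume_pi, Measure.restrict_pi_pi]
  rw [wDens, hpi]
  have hsub : Set.univ.pi A ⊆ Set.univ.pi fun _ : Fin m => Set.Icc (0 : ℝ) 1 :=
    Set.pi_mono fun i _ => hA' i
  have : ∀ x : Fin m → ℝ, (∏ e ∈ orderedEdges F, W (x e.1) (x e.2)) *
      ∏ i, (A i).indicator (fun _ => (1 : ℝ)) (x i) = (Set.univ.pi A).indicator (psi F W) x := by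
    intro x
    rw [← psi_eq_prod]
    by_cases hx : x ∈ Set.univ.pi A
    · rw [Set.indicator_of_mem hx, Finset.prod_eq_one, mul_one]
      intro i _
      rw [Set.indicator_of_mem (hx i (Set.mem_univ i))]
    · rw [Set.indicator_of_notMem hx]
      obtain ⟨i, hi⟩ : ∃ i, x i ∉ A i := by simpa using hx
      rw [Finset.prod_eq_zero (Finset.mem_univ i), mul_zero]
      rw [Set.indicator_of_notMem hi]
  simp only [this]
  rw [integral_indicator (MeasurableSet.univ_pi hA), Measure.restrict_restrict
    (MeasurableSet.univ_pi hA), Set.inter_eq_left.2 hsub]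

lemma setIntegral_psiSym {m : ℕ} (F : SimpleGraph (Fin m)) {W : ℝ → ℝ → ℝ}
    (hW : IsKer W) {A : Fin m → Set ℝ} (hA : ∀ i, MeasurableSet (A i))
    (hA' : ∀ i, A i ⊆ Set.Icc 0 1) :
    ∫ x in Set.univ.pi A, psiSym F W x
      = ∑ σ : Equiv.Perm (Fin m), ((m.factorial : ℝ))⁻¹ *
        wDens (volume.restrict (Set.Icc (0 : ℝ) 1)) F W
        (fun i => (A (σ i)).indicator (fun _ => 1)) := by
  have hfin : volume (Set.univ.pi A) ≠ ⊤ := by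
    refine ne_top_of_le_ne_top ?_ (measure_mono (Set.pi_mono fun i _ => hA' i))
    rw [volume_pi, Measure.pi_pi]
    simp
  have : IsFiniteMeasure (volume.restrict (Set.univ.pi A)) := ⟨by simpa using hfin.lt_top⟩
  have hpm : Measurable (psi F W) := by
    have : psi F W = fun x => ∏ e ∈ orderedEdges F, W (x e.1) (x e.2) :=
      funext fun x => psi_eq_prod F W x
    rw [this]
    exact measurable_edgeProd hW _
  have hpb : ∀ x, |psi F W x| ≤ 1 := fun x => by
    rw [psi_eq_prod]
    have : ∏ e ∈ orderedEdges F, W (x e.1) (x e.2) ∈ Set.Icc (0 : ℝ) 1 :=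
      Icc_prod_mem _ fun e _ => hW.2 _ _
    rw [abs_of_nonneg this.1]
    exact this.2
  have hperm : ∀ σ : Equiv.Perm (Fin m), Measurable (fun x : Fin m → ℝ => fun i => x (σ i)) :=
    fun σ => by fun_prop
  simp only [psiSym]
  rw [integral_const_mul, integral_finsetSum, Finset.mul_sum]
  · refine Finset.sum_congr rfl fun σ _ => ?_
    rw [← setIntegral_psi F W (fun i => hA (σ i)) (fun i => hA' (σ i))]
    congr 1
    have h : MeasurePreserving (fun x : Fin m → ℝ => fun i => x (σ i)) volume volume := by
      have := (volume_measurePreserving_piCongrLeft (fun _ : Fin m => ℝ) σ.symm)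
      convert this using 1
      ext x i
      rw [MeasurableEquiv.coe_piCongrLeft]
      simpa using (Equiv.piCongrLeft_apply_apply (P := fun _ : Fin m => ℝ) σ.symm x (σ i)).symm
    have hpre : (fun x : Fin m → ℝ => fun i => x (σ i)) ⁻¹' (Set.univ.pi fun i => A (σ i))
        = Set.univ.pi A := by
      ext x
      simp only [Set.mem_preimage, Set.mem_univ_pi]
      exact ⟨fun h i => by simpa using h (σ.symm i), fun h i => h (σ i)⟩
    have hms : MeasurableSet (Set.univ.pi fun i => A (σ i)) :=
      MeasurableSet.univ_pi fun i => hA (σ i)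
    conv_rhs => rw [← h.map_eq]
    rw [setIntegral_map hms hpm.aestronglyMeasurable (hperm σ).aemeasurable, hpre]
  · intro σ _
    exact integrable_of_Icc (hpm.comp (hperm σ)) 1 fun x => hpb _

end Densities

section Cells

/-- Lebesgue measure on `[0,1]`, as a measure on `ℝ`. -/
noncomputable abbrev unitMeasure : Measure ℝ := volume.restrict (Set.Icc (0 : ℝ) 1)

instance instIsProbabilityMeasureUnit : IsProbabilityMeasure unitMeasure :=
  ⟨by simp [unitMeasure]⟩

/-- The index of the interval `[a/N,(a+1)/N)` containing `x`. -/
noncomputable def cell (N : ℕ) [NeZero N] (x : ℝ) : Fin N := Fin.ofNat N ⌊(N : ℝ) * x⌋₊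

/-- The step kernel on `[0,1]²` associated with a matrix. -/
noncomputable def stepKer {N : ℕ} [NeZero N] (B : Fin N → Fin N → ℝ) (x y : ℝ) : ℝ :=
  B (cell N x) (cell N y)

open Classical in
/-- The adjacency matrix of `G`, with real entries. -/
noncomputable def adjR {β : Type*} (G : SimpleGraph β) (a b : β) : ℝ := if G.Adj a b then 1 else 0

lemma adjR_mem {β : Type*} (G : SimpleGraph β) (a b : β) : adjR G a b ∈ Set.Icc (0 : ℝ) 1 := by
  rw [adjR]; split_ifs <;> simp

lemma adjR_comm {β : Type*} (G : SimpleGraph β) (a b : β) : adjR G a b = adjR G b a := by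
  rw [adjR, adjR]; split_ifs with h1 h2 h2 <;> first | rfl | exact absurd h1.symm h2 | exact absurd h2.symm h1

/-- The uniform probability measure on `Fin N`. -/
noncomputable def unifFin (N : ℕ) : Measure (Fin N) := (N : ENNReal)⁻¹ • Measure.count

lemma measureReal_unifFin {N : ℕ} (a : Fin N) : (unifFin N).real {a} = (N : ℝ)⁻¹ := by
  simp [unifFin, measureReal_def]

variable {N : ℕ} [NeZero N]

lemma cast_pos_of_neZero (N : ℕ) [NeZero N] : (0 : ℝ) < N :=
  Nat.cast_pos.2 (Nat.pos_of_ne_zero (NeZero.ne N))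

lemma measurable_cell : Measurable (cell N) := by
  have : Measurable (fun x : ℝ => ⌊(N : ℝ) * x⌋₊) :=
    Nat.measurable_floor.comp (measurable_const.mul measurable_id)
  exact (measurable_from_top (f := fun n : ℕ => Fin.ofNat N n)).comp this

lemma floor_lt_of_mem {x : ℝ} (hx : x ∈ Set.Ico (0 : ℝ) 1) : ⌊(N : ℝ) * x⌋₊ < N := by
  have hN := cast_pos_of_neZero N
  rw [Nat.floor_lt (mul_nonneg hN.le hx.1)]
  nlinarith [hx.2]

lemma cell_val {x : ℝ} (hx : x ∈ Set.Ico (0 : ℝ) 1) : (cell N x : ℕ) = ⌊(N : ℝ) * x⌋₊ := by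
  simp [cell, Nat.mod_eq_of_lt (floor_lt_of_mem hx)]

lemma cell_val_lt_iff {x : ℝ} (hx : x ∈ Set.Ico (0 : ℝ) 1) (q : ℕ) :
    (cell N x : ℕ) < q ↔ x < (q : ℝ) / N := by
  have hN := cast_pos_of_neZero N
  rw [cell_val hx, Nat.floor_lt (mul_nonneg hN.le hx.1), lt_div_iff₀ hN, mul_comm]

lemma cell_eq_iff {x : ℝ} (hx : x ∈ Set.Ico (0 : ℝ) 1) (a : Fin N) :
    cell N x = a ↔ x ∈ Set.Ico ((a : ℝ) / N) (((a : ℝ) + 1) / N) := by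
  have h1 := cell_val_lt_iff (N := N) hx a
  have h2 := cell_val_lt_iff (N := N) hx (a + 1)
  push_cast at h2
  rw [Set.mem_Ico, ← h2, ← not_lt, ← h1, Fin.ext_iff]
  omega

lemma ae_mem_Ico : ∀ᵐ x ∂unitMeasure, x ∈ Set.Ico (0 : ℝ) 1 := by
  rw [ae_restrict_iff' measurableSet_Icc]
  have : ∀ᵐ x : ℝ, x ≠ 1 := by simp [ae_iff]
  filter_upwards [this] with x hx h
  exact ⟨h.1, lt_of_le_of_ne h.2 hx⟩

lemma measure_cell (a : Fin N) :
    unitMeasure (cell N ⁻¹' {a}) = (N : ENNReal)⁻¹ := by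
  have hN := cast_pos_of_neZero N
  have ha : ((a : ℕ) : ℝ) + 1 ≤ N := by exact_mod_cast a.2
  have : unitMeasure (cell N ⁻¹' {a})
      = unitMeasure (Set.Ico ((a : ℝ) / N) (((a : ℝ) + 1) / N)) := by
    refine measure_congr ?_
    filter_upwards [ae_mem_Ico] with x hx
    exact propext (cell_eq_iff hx a)
  rw [this, Measure.restrict_apply measurableSet_Ico, Set.inter_eq_left.2, Real.volume_Ico]
  · rw [← sub_div, add_sub_cancel_left, one_div, ENNReal.ofReal_inv_of_pos hN,
      ENNReal.ofReal_natCast]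
  · intro x hx
    refine ⟨le_trans (by positivity) hx.1, hx.2.le.trans ?_⟩
    rwa [div_le_one hN]

lemma measurePreserving_cell : MeasurePreserving (cell N) unitMeasure (unifFin N) := by
  refine ⟨measurable_cell, ?_⟩
  apply Measure.ext_of_singleton
  intro a
  rw [Measure.map_apply measurable_cell (measurableSet_singleton a), measure_cell]
  simp [unifFin]

instance instIsProbabilityMeasureUnifFin : IsProbabilityMeasure (unifFin N) := by
  rw [← (measurePreserving_cell (N := N)).map_eq]
  exact Measure.isProbabilityMeasure_map measurable_cell.aemeasurable

lemma integral_cell (Φ : Fin N → ℝ) :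
    ∫ x, Φ (cell N x) ∂unitMeasure = (∑ a, Φ a) / N := by
  have h := measurePreserving_cell (N := N)
  have := integral_map (μ := unitMeasure) (φ := cell N) (f := Φ) h.measurable.aemeasurable
    (measurable_of_finite Φ).aestronglyMeasurable
  rw [← this, h.map_eq, integral_fintype (Integrable.of_finite)]
  simp only [measureReal_unifFin, smul_eq_mul, ← Finset.mul_sum]
  rw [div_eq_inv_mul]

lemma integral_cell_prod (Φ : Fin N → Fin N → ℝ) :
    ∫ z, Φ (cell N z.1) (cell N z.2) ∂(unitMeasure.prod unitMeasure)
      = (∑ a, ∑ b, Φ a b) / (N : ℝ) ^ 2 := by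
  have h := (measurePreserving_cell (N := N)).prod (measurePreserving_cell (N := N))
  have := integral_map (μ := unitMeasure.prod unitMeasure)
    (f := fun z : Fin N × Fin N => Φ z.1 z.2) h.measurable.aemeasurable
    (measurable_of_finite _).aestronglyMeasurable
  simp only [Prod.map_fst, Prod.map_snd] at this
  rw [← this, h.map_eq, integral_fintype (Integrable.of_finite)]
  have e : ∀ z : Fin N × Fin N, ((unifFin N).prod (unifFin N)).real {z} = ((N : ℝ) ^ 2)⁻¹ := by
    rintro ⟨a, b⟩
    rw [← Set.singleton_prod_singleton, measureReal_prod_prod, measureReal_unifFin,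
      measureReal_unifFin]
    ring
  simp only [e, smul_eq_mul, ← Finset.mul_sum]
  rw [div_eq_inv_mul, Fintype.sum_prod_type]

lemma integral_cell_pi {m : ℕ} (Φ : (Fin m → Fin N) → ℝ) :
    ∫ x, Φ (fun i => cell N (x i)) ∂(Measure.pi fun _ : Fin m => unitMeasure)
      = (∑ v, Φ v) / (N : ℝ) ^ m := by
  have h := measurePreserving_pi (fun _ : Fin m => unitMeasure) (fun _ : Fin m => unifFin N)
    (f := fun _ => cell N) (fun _ => measurePreserving_cell (N := N))
  have := integral_map (μ := Measure.pi fun _ : Fin m => unitMeasure)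
    (f := Φ) h.measurable.aemeasurable
    (measurable_of_finite _).aestronglyMeasurable
  rw [← this, h.map_eq, integral_fintype (Integrable.of_finite)]
  have e : ∀ v : Fin m → Fin N, (Measure.pi fun _ : Fin m => unifFin N).real {v}
      = ((N : ℝ) ^ m)⁻¹ := by
    intro v
    rw [← Set.univ_pi_singleton, measureReal_def, Measure.pi_pi, ENNReal.toReal_prod]
    simp only [← measureReal_def, measureReal_unifFin]
    simp
  simp only [e, smul_eq_mul, ← Finset.mul_sum]
  rw [div_eq_inv_mul]

lemma measurable_stepKer (B : Fin N → Fin N → ℝ) : Measurable (Function.uncurry (stepKer B)) := by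
  have h := (measurePreserving_cell (N := N)).prod (measurePreserving_cell (N := N))
  exact (measurable_of_finite (fun z : Fin N × Fin N => B z.1 z.2)).comp h.measurable

lemma isKer_stepKer {B : Fin N → Fin N → ℝ} (hB : ∀ a b, B a b ∈ Set.Icc (0 : ℝ) 1) :
    IsKer (stepKer B) :=
  ⟨measurable_stepKer B, fun _ _ => hB _ _⟩

/-- The weighted homomorphism density of a matrix with respect to vertex weights. -/
lemma wDens_stepKer {m : ℕ} (F : SimpleGraph (Fin m)) (B : Fin N → Fin N → ℝ)
    (f : Fin m → Fin N → ℝ) :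
    wDens unitMeasure F (stepKer B) (fun i x => f i (cell N x))
      = (∑ v : Fin m → Fin N, (∏ e ∈ orderedEdges F, B (v e.1) (v e.2)) * ∏ i, f i (v i))
        / (N : ℝ) ^ m :=
  integral_cell_pi (fun v : Fin m → Fin N =>
    (∏ e ∈ orderedEdges F, B (v e.1) (v e.2)) * ∏ i, f i (v i))

lemma cutLe_stepKer {B : Fin N → Fin N → ℝ} {c : ℝ}
    (h : ∀ f g : Fin N → ℝ, (∀ a, f a ∈ Set.Icc (0 : ℝ) 1) → (∀ a, g a ∈ Set.Icc (0 : ℝ) 1) →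
      |∑ a, ∑ b, B a b * f a * g b| ≤ c * (N : ℝ) ^ 2) :
    CutLe unitMeasure (stepKer B) c := by
  classical
  intro f g hf hg hf' hg'
  have hN := cast_pos_of_neZero N
  set I : (ℝ → ℝ) → Fin N → ℝ := fun f a =>
    ∫ x, (if cell N x = a then (1 : ℝ) else 0) * f x ∂unitMeasure with hI
  have hind : ∀ a : Fin N, Measurable (fun x => if cell N x = a then (1 : ℝ) else 0) := fun a =>
    (measurable_of_finite (fun b : Fin N => if b = a then (1 : ℝ) else 0)).comp measurable_cell
  have hInt : ∀ f : ℝ → ℝ, Measurable f → (∀ x, f x ∈ Set.Icc (0 : ℝ) 1) → ∀ a : Fin N,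
      Integrable (fun x => (if cell N x = a then (1 : ℝ) else 0) * f x) unitMeasure := by
    intro f hf hf' a
    refine integrable_of_Icc ((hind a).mul hf) 1 fun x => ?_
    rw [abs_of_nonneg (mul_nonneg (by positivity) (hf' x).1)]
    split_ifs
    · simpa using (hf' x).2
    · simp
  have hImem : ∀ f : ℝ → ℝ, Measurable f → (∀ x, f x ∈ Set.Icc (0 : ℝ) 1) → ∀ a : Fin N,
      (N : ℝ) * I f a ∈ Set.Icc (0 : ℝ) 1 := by
    intro f hf hf' a
    have h0 : 0 ≤ I f a := integral_nonneg fun x => mul_nonneg (by positivity) (hf' x).1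
    refine ⟨mul_nonneg hN.le h0, ?_⟩
    have h1 : I f a ≤ ∫ x, (if cell N x = a then (1 : ℝ) else 0) ∂unitMeasure := by
      refine integral_mono (hInt f hf hf' a) ?_ fun x => ?_
      · have := hInt (fun _ => 1) measurable_const (by simp) a
        simpa using this
      · exact mul_le_of_le_one_right (by positivity) (hf' x).2
    rw [integral_cell (fun b : Fin N => if b = a then (1 : ℝ) else 0)] at h1
    simp only [Finset.sum_ite_eq', Finset.mem_univ, if_true] at h1
    rw [le_div_iff₀ hN] at h1
    linarith
  have key : ∫ z, stepKer B z.1 z.2 * f z.1 * g z.2 ∂(unitMeasure.prod unitMeasure)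
      = ∑ a, ∑ b, B a b * I f a * I g b := by
    have e : ∀ z : ℝ × ℝ, stepKer B z.1 z.2 * f z.1 * g z.2
        = ∑ a, ∑ b, B a b * (((if cell N z.1 = a then (1 : ℝ) else 0) * f z.1) *
          ((if cell N z.2 = b then (1 : ℝ) else 0) * g z.2)) := by
      intro z
      rw [Finset.sum_eq_single (cell N z.1), Finset.sum_eq_single (cell N z.2)]
      · simp [stepKer]; ring
      · intro b _ hb; simp [hb.symm]
      · simp
      · intro a _ ha; simp [ha.symm]
      · simp
    simp only [e]
    rw [integral_finsetSum]
    · refine Finset.sum_congr rfl fun a _ => ?_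
      rw [integral_finsetSum]
      · refine Finset.sum_congr rfl fun b _ => ?_
        rw [integral_const_mul, integral_prod_mul
          (fun x => (if cell N x = a then (1 : ℝ) else 0) * f x)
          (fun x => (if cell N x = b then (1 : ℝ) else 0) * g x)]
        ring
      · intro b _
        exact ((hInt f hf hf' a).mul_prod (hInt g hg hg' b)).const_mul _
    · intro a _
      exact integrable_finsetSum _ fun b _ =>
        ((hInt f hf hf' a).mul_prod (hInt g hg hg' b)).const_mul _
  have h2 := h (fun a => N * I f a) (fun a => N * I g a) (hImem f hf hf') (hImem g hg hg')
  have e2 : ∑ a, ∑ b, B a b * (N * I f a) * (N * I g b)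
      = (∑ a, ∑ b, B a b * I f a * I g b) * (N : ℝ) ^ 2 := by
    rw [Finset.sum_mul]
    refine Finset.sum_congr rfl fun a _ => ?_
    rw [Finset.sum_mul]
    exact Finset.sum_congr rfl fun b _ => by ring
  rw [e2, abs_mul, abs_of_pos (pow_pos hN 2)] at h2
  rw [key]
  exact le_of_mul_le_mul_right h2 (pow_pos hN 2)

end Cells

section Counts

open Classical in
lemma prod_adjR {m : ℕ} {β : Type*} (F : SimpleGraph (Fin m)) (G : SimpleGraph β)
    (v : Fin m → β) :
    ∏ e ∈ orderedEdges F, adjR G (v e.1) (v e.2)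
      = if ∀ i j, F.Adj i j → G.Adj (v i) (v j) then 1 else 0 := by
  split_ifs with h
  · refine Finset.prod_eq_one fun e he => ?_
    rw [adjR, if_pos (h _ _ (mem_orderedEdges.1 he).2)]
  · push Not at h
    obtain ⟨i, j, hF, hG⟩ := h
    rcases lt_or_gt_of_ne hF.ne with hij | hij
    · refine Finset.prod_eq_zero (i := (i, j)) (mem_orderedEdges.2 ⟨hij, hF⟩) ?_
      rw [adjR, if_neg hG]
    · refine Finset.prod_eq_zero (i := (j, i)) (mem_orderedEdges.2 ⟨hij, hF.symm⟩) ?_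
      rw [adjR, if_neg fun h => hG h.symm]

open Classical in
lemma labCount_eq_sum {m N : ℕ} (F : SimpleGraph (Fin m)) (G : SimpleGraph (Fin N))
    {U : Fin m → Finset (Fin N)} (hU : Pairwise fun i j => Disjoint (U i) (U j)) :
    (labCount F G U : ℝ) = ∑ v : Fin m → Fin N,
      (∏ e ∈ orderedEdges F, adjR G (v e.1) (v e.2)) * ∏ i, if v i ∈ U i then 1 else 0 := by
  rw [labCount, Nat.card_eq_fintype_card, Fintype.card_subtype, Finset.card_filter]
  push_cast
  refine Finset.sum_congr rfl fun v _ => ?_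
  rw [prod_adjR, Finset.prod_boole, ite_zero_mul_ite_zero]
  simp only [mul_one, Finset.mem_univ, true_imp_iff]
  refine if_congr ⟨fun h => h.2, fun h => ⟨fun i j hij => ?_, h⟩⟩ rfl rfl
  by_contra hne
  exact Finset.disjoint_left.1 (hU hne) (h.2 i) (hij ▸ h.2 j)

open Classical in
lemma totalCount_eq_sum {m N : ℕ} (F : SimpleGraph (Fin m)) (G : SimpleGraph (Fin N)) :
    (totalCount F G : ℝ) = ∑ v : Fin m → Fin N,
      (∏ e ∈ orderedEdges F, adjR G (v e.1) (v e.2)) *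
        if Function.Injective v then 1 else 0 := by
  rw [totalCount, Nat.card_eq_fintype_card, Fintype.card_subtype, Finset.card_filter]
  push_cast
  refine Finset.sum_congr rfl fun v _ => ?_
  rw [prod_adjR, ite_zero_mul_ite_zero]
  simp only [mul_one]
  exact if_congr and_comm rfl rfl

/-- The homomorphism density of `F` in `G`. -/
noncomputable def homDens {m N : ℕ} (F : SimpleGraph (Fin m)) (G : SimpleGraph (Fin N)) : ℝ :=
  (∑ v : Fin m → Fin N, ∏ e ∈ orderedEdges F, adjR G (v e.1) (v e.2)) / (N : ℝ) ^ m

open Classical in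
/-- The normalized count of homomorphisms mapping each vertex `i` into `U i`. -/
noncomputable def partDens {m N : ℕ} (F : SimpleGraph (Fin m)) (G : SimpleGraph (Fin N))
    (U : Fin m → Finset (Fin N)) : ℝ :=
  (∑ v : Fin m → Fin N, (∏ e ∈ orderedEdges F, adjR G (v e.1) (v e.2)) *
    ∏ i, if v i ∈ U i then 1 else 0) / (N : ℝ) ^ m

open Classical in
lemma partDens_eq_wDens {m N : ℕ} [NeZero N] (F : SimpleGraph (Fin m))
    (G : SimpleGraph (Fin N)) (U : Fin m → Finset (Fin N)) :
    partDens F G U = wDens unitMeasure F (stepKer (adjR G))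
      (fun i x => if cell N x ∈ U i then 1 else 0) :=
  (wDens_stepKer F (adjR G) (fun i a => if a ∈ U i then 1 else 0)).symm

lemma homDens_eq_wDens {m N : ℕ} [NeZero N] (F : SimpleGraph (Fin m))
    (G : SimpleGraph (Fin N)) :
    homDens F G = wDens unitMeasure F (stepKer (adjR G)) (fun _ _ => 1) := by
  rw [wDens_stepKer F (adjR G) (fun _ _ => 1)]
  simp [homDens]

lemma labCount_div {m N : ℕ} (F : SimpleGraph (Fin m)) (G : SimpleGraph (Fin N))
    {U : Fin m → Finset (Fin N)} (hU : Pairwise fun i j => Disjoint (U i) (U j)) :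
    (labCount F G U : ℝ) / (N : ℝ) ^ m = partDens F G U := by
  rw [labCount_eq_sum F G hU, partDens]

open Classical in
lemma card_not_injective_mul_le (m N : ℕ) :
    (Finset.univ.filter fun v : Fin m → Fin N => ¬ Function.Injective v).card * N
      ≤ m ^ 2 * N ^ m := by
  have hsub : (Finset.univ.filter fun v : Fin m → Fin N => ¬ Function.Injective v)
      ⊆ (Finset.univ.filter fun q : Fin m × Fin m => q.1 ≠ q.2).biUnion fun q =>
        Finset.univ.filter fun v : Fin m → Fin N => v q.1 = v q.2 := by
    intro v hv
    obtain ⟨i, j, h, hne⟩ := Function.not_injective_iff.1 (Finset.mem_filter.1 hv).2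
    simp only [Finset.mem_biUnion, Finset.mem_filter, Finset.mem_univ, true_and]
    exact ⟨(i, j), hne, h⟩
  have hone : ∀ q : Fin m × Fin m, q.1 ≠ q.2 →
      (Finset.univ.filter fun v : Fin m → Fin N => v q.1 = v q.2).card * N ≤ N ^ m := by
    rintro ⟨i, j⟩ hij
    have : ((Finset.univ.filter fun v : Fin m → Fin N => v i = v j) ×ˢ
        (Finset.univ : Finset (Fin N))).card ≤ (Finset.univ : Finset (Fin m → Fin N)).card := by
      refine Finset.card_le_card_of_injOn (fun z => Function.update z.1 j z.2)
        (fun _ _ => by simp) ?_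
      rintro ⟨v, a⟩ hv ⟨v', a'⟩ hv' h
      simp only [Finset.coe_product, Finset.coe_filter, Finset.mem_univ, true_and, Set.mem_prod,
        Set.mem_ofPred_eq] at hv hv'
      have hk : ∀ k, k ≠ j → v k = v' k := fun k hk => by
        simpa [Function.update_of_ne hk] using congrFun h k
      have ha : a = a' := by simpa using congrFun h j
      refine Prod.ext (funext fun k => ?_) ha
      by_cases hkj : k = j
      · rw [hkj]
        exact hv.1.symm.trans ((hk i hij).trans hv'.1)
      · exact hk k hkj
    simpa [Finset.card_product] using this
  calc _ ≤ (∑ q ∈ Finset.univ.filter fun q : Fin m × Fin m => q.1 ≠ q.2,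
        (Finset.univ.filter fun v : Fin m → Fin N => v q.1 = v q.2).card) * N :=
        Nat.mul_le_mul_right _ ((Finset.card_le_card hsub).trans Finset.card_biUnion_le)
    _ ≤ ∑ q ∈ Finset.univ.filter fun q : Fin m × Fin m => q.1 ≠ q.2, N ^ m := by
        rw [Finset.sum_mul]
        exact Finset.sum_le_sum fun q hq => hone q (by simpa using hq)
    _ ≤ m ^ 2 * N ^ m := by
        rw [Finset.sum_const, smul_eq_mul]
        refine Nat.mul_le_mul_right _ ((Finset.card_filter_le _ _).trans ?_)
        simp [sq]

open Classical in
lemma card_not_injective_div_le (m : ℕ) {N : ℕ} (hN : 0 < N) :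
    ((Finset.univ.filter fun v : Fin m → Fin N => ¬ Function.Injective v).card : ℝ) / (N : ℝ) ^ m
      ≤ (m : ℝ) ^ 2 / N := by
  have hN' : (0 : ℝ) < N := Nat.cast_pos.2 hN
  rw [div_le_div_iff₀ (by positivity) hN']
  exact_mod_cast card_not_injective_mul_le m N

lemma abs_totalCount_sub_homDens_le {m N : ℕ} (hN : 0 < N) (F : SimpleGraph (Fin m))
    (G : SimpleGraph (Fin N)) :
    |(totalCount F G : ℝ) / (N : ℝ) ^ m - homDens F G| ≤ (m : ℝ) ^ 2 / N := by
  classical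
  refine le_trans ?_ (card_not_injective_div_le m hN)
  rw [homDens, ← sub_div, abs_div, abs_of_nonneg (by positivity : (0 : ℝ) ≤ (N : ℝ) ^ m)]
  gcongr
  rw [totalCount_eq_sum, ← Finset.sum_sub_distrib, Finset.card_filter]
  push_cast
  refine (Finset.abs_sum_le_sum_abs _ _).trans (Finset.sum_le_sum fun v _ => ?_)
  have := Icc_prod_mem (orderedEdges F) (f := fun e => adjR G (v e.1) (v e.2))
    fun e _ => adjR_mem _ _ _
  by_cases h : Function.Injective v
  · simp [h]
  · simp only [h, if_false, mul_zero, zero_sub, abs_neg, not_false_eq_true, if_true]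
    rw [abs_of_nonneg this.1]
    exact this.2

lemma isQuasirandom_iff {p : ℝ} {V : ℕ → ℕ} {G : ∀ n, SimpleGraph (Fin (V n))}
    (hV : Tendsto V atTop atTop) :
    IsQuasirandom p V G ↔ ∀ (m : ℕ) (F : SimpleGraph (Fin m)),
      Tendsto (fun n => homDens F (G n)) atTop (nhds (p ^ numEdges F)) := by
  refine forall_congr' fun m => forall_congr' fun F => ?_
  have hpos : ∀ᶠ n in atTop, 0 < V n := hV.eventually_gt_atTop 0
  have hVr : Tendsto (fun n => (V n : ℝ)) atTop atTop := tendsto_natCast_atTop_atTop.comp hV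
  rw [isLittleO_iff_tendsto' (by
    filter_upwards [hpos] with n hn h
    have : (0 : ℝ) < V n := Nat.cast_pos.2 hn
    exact absurd h (by positivity))]
  have hlim : Tendsto (fun n => (totalCount F (G n) : ℝ) / (V n : ℝ) ^ m - homDens F (G n))
      atTop (nhds 0) := by
    refine squeeze_zero_norm' ?_ ((tendsto_const_nhds (x := (m : ℝ) ^ 2)).div_atTop hVr)
    filter_upwards [hpos] with n hn
    exact abs_totalCount_sub_homDens_le hn F (G n)
  have e : (fun n => ((totalCount F (G n) : ℝ) - p ^ numEdges F * (V n : ℝ) ^ m) / (V n : ℝ) ^ m)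
      =ᶠ[atTop] fun n => (totalCount F (G n) : ℝ) / (V n : ℝ) ^ m - homDens F (G n)
        + (homDens F (G n) - p ^ numEdges F) := by
    filter_upwards [hpos] with n hn
    have : (0 : ℝ) < V n := Nat.cast_pos.2 hn
    field_simp
    ring
  rw [tendsto_congr' e, ← tendsto_sub_nhds_zero_iff (u := fun n => homDens F (G n))]
  constructor
  · intro h
    simpa using h.sub hlim
  · intro h
    simpa using hlim.add h

end Counts

section FourCycle

/-- The edges of the four-cycle with parts `{0, 1}` and `{2, 3}`. -/
def cycleEdges : Finset (Fin 4 × Fin 4) := {(0, 2), (1, 2), (0, 3), (1, 3)}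

/-- The sum over all `4`-tuples of the products of entries of `B` around a four-cycle. -/
noncomputable def cycleSum {N : ℕ} (B : Fin N → Fin N → ℝ) : ℝ :=
  ∑ v : Fin 4 → Fin N, ∏ e ∈ cycleEdges, B (v e.1) (v e.2)

lemma cycleSum_eq {N : ℕ} (B : Fin N → Fin N → ℝ) :
    cycleSum B = ∑ b, ∑ b', (∑ a, B a b * B a b') ^ 2 := by
  have h1 : cycleSum B = ∑ z : Fin N × Fin N × Fin N × Fin N,
      B z.2.2.1 z.1 * B z.2.2.2 z.1 * (B z.2.2.1 z.2.1 * B z.2.2.2 z.2.1) := by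
    refine Fintype.sum_equiv
      { toFun := fun v : Fin 4 → Fin N => (v 2, v 3, v 0, v 1)
        invFun := fun z => ![z.2.2.1, z.2.2.2, z.1, z.2.1]
        left_inv := fun v => by funext i; fin_cases i <;> rfl
        right_inv := fun _ => rfl } _ _ fun v => ?_
    have : ∏ e ∈ cycleEdges, B (v e.1) (v e.2)
        = B (v 0) (v 2) * (B (v 1) (v 2) * (B (v 0) (v 3) * B (v 1) (v 3))) := by
      simp [cycleEdges, Finset.prod_insert]
    rw [this]
    change _ = B (v 0) (v 2) * B (v 1) (v 2) * (B (v 0) (v 3) * B (v 1) (v 3))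
    ring
  rw [h1, Fintype.sum_prod_type]
  refine Finset.sum_congr rfl fun b _ => ?_
  rw [Fintype.sum_prod_type]
  refine Finset.sum_congr rfl fun b' _ => ?_
  rw [Fintype.sum_prod_type, sq, Finset.sum_mul_sum]
  exact Finset.sum_congr rfl fun a _ => Finset.sum_congr rfl fun a' _ => by ring

lemma bilin_pow_four_le {N : ℕ} (B : Fin N → Fin N → ℝ) {f g : Fin N → ℝ}
    (hf : ∀ a, f a ∈ Set.Icc (0 : ℝ) 1) (hg : ∀ a, g a ∈ Set.Icc (0 : ℝ) 1) :
    (∑ a, ∑ b, B a b * f a * g b) ^ 4 ≤ (N : ℝ) ^ 4 * cycleSum B := by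
  have sq_le : ∀ {x : ℝ}, x ∈ Set.Icc (0 : ℝ) 1 → x ^ 2 ≤ 1 := fun h => pow_le_one₀ h.1 h.2
  have h1 : (∑ a, ∑ b, B a b * f a * g b) ^ 2 ≤ N * ∑ a, (∑ b, B a b * g b) ^ 2 := by
    have e : ∑ a, ∑ b, B a b * f a * g b = ∑ a, f a * ∑ b, B a b * g b := by
      refine Finset.sum_congr rfl fun a _ => ?_
      rw [Finset.mul_sum]
      exact Finset.sum_congr rfl fun b _ => by ring
    rw [e]
    refine (Finset.sum_mul_sq_le_sq_mul_sq _ _ _).trans ?_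
    refine mul_le_mul_of_nonneg_right ?_ (Finset.sum_nonneg fun _ _ => sq_nonneg _)
    calc ∑ a, f a ^ 2 ≤ ∑ _a : Fin N, (1 : ℝ) := Finset.sum_le_sum fun a _ => sq_le (hf a)
      _ = N := by simp
  have h2 : ∑ a, (∑ b, B a b * g b) ^ 2
      = ∑ z : Fin N × Fin N, (g z.1 * g z.2) * ∑ a, B a z.1 * B a z.2 := by
    rw [Fintype.sum_prod_type]
    simp only [Finset.mul_sum]
    have e : ∀ a, (∑ b, B a b * g b) ^ 2
        = ∑ b, ∑ b', g b * g b' * (B a b * B a b') := fun a => by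
      rw [sq, Finset.sum_mul_sum]
      exact Finset.sum_congr rfl fun b _ => Finset.sum_congr rfl fun b' _ => by ring
    simp only [e]
    rw [Finset.sum_comm]
    exact Finset.sum_congr rfl fun b _ => Finset.sum_comm
  have h3 : (∑ a, (∑ b, B a b * g b) ^ 2) ^ 2 ≤ (N : ℝ) ^ 2 * cycleSum B := by
    rw [h2, cycleSum_eq, ← Fintype.sum_prod_type'
      (f := fun b b' => (∑ a, B a b * B a b') ^ 2)]
    refine (Finset.sum_mul_sq_le_sq_mul_sq _ _ _).trans ?_
    refine mul_le_mul_of_nonneg_right ?_ (Finset.sum_nonneg fun _ _ => sq_nonneg _)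
    calc ∑ z : Fin N × Fin N, (g z.1 * g z.2) ^ 2 ≤ ∑ _z : Fin N × Fin N, (1 : ℝ) :=
          Finset.sum_le_sum fun z _ => sq_le (Icc_mul_mem (hg _) (hg _))
      _ = (N : ℝ) ^ 2 := by simp [sq]
  calc (∑ a, ∑ b, B a b * f a * g b) ^ 4 = ((∑ a, ∑ b, B a b * f a * g b) ^ 2) ^ 2 := by ring
    _ ≤ (N * ∑ a, (∑ b, B a b * g b) ^ 2) ^ 2 := pow_le_pow_left₀ (sq_nonneg _) h1 2
    _ = (N : ℝ) ^ 2 * (∑ a, (∑ b, B a b * g b) ^ 2) ^ 2 := by ring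
    _ ≤ (N : ℝ) ^ 2 * ((N : ℝ) ^ 2 * cycleSum B) := mul_le_mul_of_nonneg_left h3 (sq_nonneg _)
    _ = (N : ℝ) ^ 4 * cycleSum B := by ring

lemma cutLe_of_cycleSum_le {N : ℕ} [NeZero N] {B : Fin N → Fin N → ℝ} {c : ℝ} (hc : 0 ≤ c)
    (h : cycleSum B / (N : ℝ) ^ 4 ≤ c ^ 4) : CutLe unitMeasure (stepKer B) c := by
  have hN := cast_pos_of_neZero N
  refine cutLe_stepKer fun f g hf hg => ?_
  rw [div_le_iff₀ (by positivity)] at h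
  refine le_of_pow_le_pow_left₀ (n := 4) (by norm_num) (by positivity) ?_
  rw [Even.pow_abs (by decide)]
  calc _ ≤ (N : ℝ) ^ 4 * cycleSum B := bilin_pow_four_le B hf hg
    _ ≤ (N : ℝ) ^ 4 * (c ^ 4 * (N : ℝ) ^ 4) := mul_le_mul_of_nonneg_left h (by positivity)
    _ = (c * (N : ℝ) ^ 2) ^ 4 := by ring

lemma exists_orderedEdges_eq {m : ℕ} {t : Finset (Fin m × Fin m)} (ht : ∀ e ∈ t, e.1 < e.2) :
    ∃ F : SimpleGraph (Fin m), orderedEdges F = t := by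
  refine ⟨SimpleGraph.fromRel fun i j => (i, j) ∈ t, ?_⟩
  ext ⟨i, j⟩
  simp only [mem_orderedEdges, SimpleGraph.fromRel_adj]
  constructor
  · rintro ⟨hij, -, h | h⟩
    · exact h
    · exact absurd (ht _ h) (not_lt.2 hij.le)
  · intro h
    exact ⟨ht _ h, (ht _ h).ne, Or.inl h⟩

lemma cycleEdges_lt : ∀ e ∈ cycleEdges, e.1 < e.2 := by decide

lemma tendsto_cycleSum {p : ℝ} {V : ℕ → ℕ} {G : ∀ n, SimpleGraph (Fin (V n))}
    (h : ∀ (m : ℕ) (F : SimpleGraph (Fin m)),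
      Tendsto (fun n => homDens F (G n)) atTop (nhds (p ^ numEdges F))) :
    Tendsto (fun n => cycleSum (fun a b => adjR (G n) a b - p) / (V n : ℝ) ^ 4) atTop
      (nhds 0) := by
  classical
  have e : ∀ n, cycleSum (fun a b => adjR (G n) a b - p) / (V n : ℝ) ^ 4
      = ∑ t ∈ cycleEdges.powerset, ((∑ v : Fin 4 → Fin (V n), ∏ e ∈ t, adjR (G n) (v e.1) (v e.2))
        / (V n : ℝ) ^ 4) * ∏ e ∈ cycleEdges \ t, (-p) := by
    intro n
    simp only [cycleSum, sub_eq_add_neg, Finset.prod_add]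
    rw [Finset.sum_comm, Finset.sum_div]
    refine Finset.sum_congr rfl fun t _ => ?_
    rw [← Finset.sum_mul]
    ring
  have hz : (0 : ℝ) = ∑ t ∈ cycleEdges.powerset, (∏ e ∈ t, p) * ∏ e ∈ cycleEdges \ t, (-p) := by
    rw [← Finset.prod_add]
    simp [cycleEdges]
  simp only [e]
  rw [hz]
  refine tendsto_finsetSum _ fun t ht => Tendsto.mul_const _ ?_
  obtain ⟨F, hF⟩ := exists_orderedEdges_eq (t := t)
    fun e he => cycleEdges_lt e (Finset.mem_powerset.1 ht he)
  have := h 4 F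
  rw [← card_orderedEdges, hF] at this
  simpa [homDens, hF] using this

/-- Quasi-random sequences converge in cut norm to the constant `p`. -/
lemma eventually_cutLe_const {p : ℝ} {V : ℕ → ℕ} {G : ∀ n, SimpleGraph (Fin (V n))}
    [∀ n, NeZero (V n)]
    (h : ∀ (m : ℕ) (F : SimpleGraph (Fin m)),
      Tendsto (fun n => homDens F (G n)) atTop (nhds (p ^ numEdges F))) {c : ℝ} (hc : 0 < c) :
    ∀ᶠ n in atTop, CutLe unitMeasure (fun x y => stepKer (adjR (G n)) x y - p) c := by
  filter_upwards [(tendsto_cycleSum h).eventually_le_const (by positivity : 0 < c ^ 4)] with n hn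
  exact cutLe_of_cycleSum_le (B := fun a b => adjR (G n) a b - p) hc.le hn

/-- Convergence in cut norm to the constant `p` implies quasi-randomness. -/
lemma tendsto_homDens_of_cutLe {p : ℝ} (hp : p ∈ Set.Icc (0 : ℝ) 1) {V : ℕ → ℕ}
    {G : ∀ n, SimpleGraph (Fin (V n))} [∀ n, NeZero (V n)]
    (h : ∀ c : ℝ, 0 < c →
      ∀ᶠ n in atTop, CutLe unitMeasure (fun x y => stepKer (adjR (G n)) x y - p) c)
    {m : ℕ} (F : SimpleGraph (Fin m)) :
    Tendsto (fun n => homDens F (G n)) atTop (nhds (p ^ numEdges F)) := by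
  rw [Metric.tendsto_atTop']
  intro ε hε
  have hc : 0 < ε / (numEdges F + 1) := by positivity
  obtain ⟨n₀, hn₀⟩ := eventually_atTop.1 (h _ hc)
  refine ⟨n₀, fun n hn => ?_⟩
  have hk : IsKer (fun _ _ : ℝ => p) := ⟨measurable_const, fun _ _ => hp⟩
  have := abs_wDens_sub_le_cut F (isKer_stepKer (adjR_mem (G n))) hk (hn₀ n hn.le)
    (f := fun _ _ => 1) (fun _ => measurable_const) (by simp)
  rw [wDens_const, ← homDens_eq_wDens] at this
  simp only [integral_const, probReal_univ, smul_eq_mul, mul_one, Finset.prod_const_one] at this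
  rw [Real.dist_eq]
  refine this.trans_lt ?_
  rw [mul_div_assoc', div_lt_iff₀ (by positivity)]
  nlinarith

end FourCycle

section Extension

lemma unitMeasure_real_eq {A : Set ℝ} (hA : A ⊆ Set.Icc 0 1) :
    unitMeasure.real A = volume.real A := by
  rw [measureReal_def, measureReal_def, Measure.restrict_eq_self _ hA]

lemma volume_eq_ofReal_iff {A : Set ℝ} (hA : A ⊆ Set.Icc 0 1) {t : ℝ} (ht : 0 ≤ t) :
    volume A = ENNReal.ofReal t ↔ unitMeasure.real A = t := by
  have hfin : volume A ≠ ⊤ := ne_top_of_le_ne_top (by simp) (measure_mono hA)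
  rw [unitMeasure_real_eq hA, measureReal_def, ← ENNReal.toReal_eq_toReal_iff' hfin (by simp),
    ENNReal.toReal_ofReal ht]

lemma exists_subset_unitMeasure_eq {R : Set ℝ} (hR : MeasurableSet R) {t : ℝ} (h0 : 0 ≤ t)
    (ht : t ≤ unitMeasure.real R) : ∃ B ⊆ R, MeasurableSet B ∧ unitMeasure.real B = t := by
  set g : ℝ → ℝ := fun s => unitMeasure.real (R ∩ Set.Iic s) with hg
  have hmono : ∀ s s', s ≤ s' → g s' - g s ≤ s' - s := by
    intro s s' hs
    have h1 : R ∩ Set.Iic s' ⊆ (R ∩ Set.Iic s) ∪ Set.Ioc s s' := by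
      rintro x ⟨hx, hx'⟩
      by_cases h : x ≤ s
      · exact Or.inl ⟨hx, h⟩
      · exact Or.inr ⟨not_le.1 h, hx'⟩
    have h2 : g s' ≤ g s + unitMeasure.real (Set.Ioc s s') :=
      (measureReal_mono h1).trans (measureReal_union_le _ _)
    have h3 : unitMeasure.real (Set.Ioc s s') ≤ s' - s := by
      have : unitMeasure.real (Set.Ioc s s') ≤ volume.real (Set.Ioc s s') :=
        ENNReal.toReal_mono (by simp) (Measure.restrict_apply_le _ _)
      refine this.trans ?_
      rw [Real.volume_real_Ioc_of_le hs]
    linarith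
  have hmono' : Monotone g := fun s s' hs =>
    measureReal_mono (Set.inter_subset_inter_right _ (Set.Iic_subset_Iic.2 hs))
  have hcont : Continuous g := by
    refine (LipschitzWith.of_dist_le_mul (K := 1) fun s s' => ?_).continuous
    rw [NNReal.coe_one, one_mul, Real.dist_eq, Real.dist_eq]
    rcases le_total s s' with h | h
    · rw [abs_sub_comm, abs_of_nonneg (sub_nonneg.2 (hmono' h)), abs_sub_comm,
        abs_of_nonneg (sub_nonneg.2 h)]
      exact hmono _ _ h
    · rw [abs_of_nonneg (sub_nonneg.2 (hmono' h)), abs_of_nonneg (sub_nonneg.2 h)]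
      exact hmono _ _ h
  have hg0 : g (-1) = 0 := by
    have : unitMeasure (R ∩ Set.Iic (-1)) = 0 := by
      rw [Measure.restrict_apply (hR.inter measurableSet_Iic)]
      convert measure_empty (μ := volume) using 2
      ext x
      simp only [Set.mem_inter_iff, Set.mem_Iic, Set.mem_Icc, Set.mem_empty_iff_false, iff_false]
      rintro ⟨⟨-, h1⟩, h2, -⟩
      linarith
    rw [hg]; simp only [measureReal_def, this, ENNReal.toReal_zero]
  have hg1 : g 1 = unitMeasure.real R := by
    refine measureReal_congr ?_
    filter_upwards [ae_mem_Ico] with x hx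
    exact propext ⟨fun h => h.1, fun h => ⟨h, hx.2.le⟩⟩
  obtain ⟨s, -, hs⟩ := intermediate_value_Icc (by norm_num : (-1 : ℝ) ≤ 1) hcont.continuousOn
    (show t ∈ Set.Icc (g (-1)) (g 1) by rw [hg0, hg1]; exact ⟨h0, ht⟩)
  exact ⟨R ∩ Set.Iic s, Set.inter_subset_left, hR.inter measurableSet_Iic, hs⟩

/-- Disjoint measurable sets can be enlarged to disjoint sets of prescribed measures. -/
lemma exists_disjoint_extension {m : ℕ} {α : Fin m → ℝ}
    (hsum : ∑ i, α i ≤ 1)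
    {C : Fin m → Set ℝ} (hC : ∀ i, MeasurableSet (C i)) (hC' : ∀ i, C i ⊆ Set.Icc 0 1)
    (hd : Pairwise fun i j => Disjoint (C i) (C j)) (hle : ∀ i, unitMeasure.real (C i) ≤ α i) :
    ∃ A : Fin m → Set ℝ, (∀ i, MeasurableSet (A i)) ∧ (∀ i, A i ⊆ Set.Icc 0 1) ∧
      (Pairwise fun i j => Disjoint (A i) (A j)) ∧ (∀ i, C i ⊆ A i) ∧
      ∀ i, unitMeasure.real (A i) = α i := by
  classical
  suffices h : ∀ s : Finset (Fin m), ∃ A : Fin m → Set ℝ, (∀ i, MeasurableSet (A i)) ∧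
      (∀ i, A i ⊆ Set.Icc 0 1) ∧ (Pairwise fun i j => Disjoint (A i) (A j)) ∧
      (∀ i, C i ⊆ A i) ∧ (∀ i ∈ s, unitMeasure.real (A i) = α i) ∧ ∀ i ∉ s, A i = C i by
    obtain ⟨A, h1, h2, h3, h4, h5, -⟩ := h Finset.univ
    exact ⟨A, h1, h2, h3, h4, fun i => h5 i (Finset.mem_univ i)⟩
  intro s
  induction s using Finset.induction_on with
  | empty => exact ⟨C, hC, hC', hd, fun _ => subset_rfl, by simp, by simp⟩
  | insert k s hk ih =>
    obtain ⟨A, hA, hA', hdA, hCA, hs, hns⟩ := ih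
    set R : Set ℝ := Set.Icc 0 1 \ ⋃ i, A i with hRdef
    have hRm : MeasurableSet R := measurableSet_Icc.diff (MeasurableSet.iUnion hA)
    have hRmeas : unitMeasure.real R = 1 - ∑ i, unitMeasure.real (A i) := by
      have h1 : unitMeasure.real (Set.Icc (0 : ℝ) 1) = 1 := by
        rw [unitMeasure_real_eq subset_rfl]; simp
      rw [hRdef, measureReal_sdiff (Set.iUnion_subset hA') (MeasurableSet.iUnion hA), h1,
        measureReal_iUnion_fintype hdA hA]
    have hbound : ∑ i, unitMeasure.real (A i) + (α k - unitMeasure.real (C k)) ≤ 1 := by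
      refine le_trans ?_ hsum
      rw [← Finset.add_sum_erase _ _ (Finset.mem_univ k),
        ← Finset.add_sum_erase _ α (Finset.mem_univ k), hns k hk]
      have : ∑ i ∈ Finset.univ.erase k, unitMeasure.real (A i) ≤ ∑ i ∈ Finset.univ.erase k, α i := by
        refine Finset.sum_le_sum fun i _ => ?_
        by_cases his : i ∈ s
        · exact (hs i his).le
        · rw [hns i his]; exact hle i
      linarith
    obtain ⟨B, hBR, hBm, hB⟩ := exists_subset_unitMeasure_eq hRm
      (sub_nonneg.2 (hle k)) (by rw [hRmeas]; linarith)
    have hBA : ∀ i, Disjoint B (A i) := fun i =>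
      Set.disjoint_left.2 fun x hx hxA => (hBR hx).2 (Set.mem_iUnion.2 ⟨i, hxA⟩)
    refine ⟨Function.update A k (C k ∪ B), ?_, ?_, ?_, ?_, ?_, ?_⟩
    · intro i
      by_cases hik : i = k
      · subst hik; simpa using (hC i).union hBm
      · simpa [hik] using hA i
    · intro i
      by_cases hik : i = k
      · subst hik; simpa using ⟨hC' i, hBR.trans Set.sdiff_subset⟩
      · simpa [hik] using hA' i
    · intro i j hij
      by_cases hik : i = k
      · subst hik
        rw [Function.update_self, Function.update_of_ne hij.symm, Set.disjoint_union_left,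
          ← hns i hk]
        exact ⟨hdA hij, hBA j⟩
      · by_cases hjk : j = k
        · subst hjk
          rw [Function.update_self, Function.update_of_ne hij, Set.disjoint_union_right,
            ← hns j hk]
          exact ⟨hdA hij, (hBA i).symm⟩
        · rw [Function.update_of_ne hik, Function.update_of_ne hjk]
          exact hdA hij
    · intro i
      by_cases hik : i = k
      · subst hik; simp
      · simpa [hik] using hCA i
    · intro i hi
      by_cases hik : i = k
      · subst hik
        rw [Function.update_self, measureReal_union (Disjoint.symm (hns i hk ▸ hBA i)) hBm, hB]
        ring
      · rw [Function.update_of_ne hik]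
        exact hs i (Finset.mem_of_mem_insert_of_ne hi hik)
    · intro i hi
      simp only [Finset.mem_insert, not_or] at hi
      rw [Function.update_of_ne hi.1]
      exact hns i hi.2

/-- Disjoint finite sets can be adjusted to disjoint sets of prescribed sizes. -/
lemma exists_disjoint_resize {m : ℕ} {β : Type*} [Fintype β] {k : Fin m → ℕ}
    (hsum : ∑ i, k i ≤ Fintype.card β) {U : Fin m → Finset β}
    (hd : Pairwise fun i j => Disjoint (U i) (U j)) :
    ∃ T : Fin m → Finset β, (Pairwise fun i j => Disjoint (T i) (T j)) ∧
      (∀ i, (T i).card = k i) ∧ ∀ i, T i ⊆ U i ∨ U i ⊆ T i := by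
  classical
  have hshrink : ∀ i, ∃ C ⊆ U i, C.card = min (U i).card (k i) := fun i =>
    Finset.exists_subset_card_eq (min_le_left _ _)
  choose C hCU hCc using hshrink
  have hdC : Pairwise fun i j => Disjoint (C i) (C j) := fun i j hij =>
    Finset.disjoint_of_subset_left (hCU i) (Finset.disjoint_of_subset_right (hCU j) (hd hij))
  suffices h : ∀ s : Finset (Fin m), ∃ A : Fin m → Finset β,
      (Pairwise fun i j => Disjoint (A i) (A j)) ∧
      (∀ i, C i ⊆ A i) ∧ (∀ i ∈ s, (A i).card = k i) ∧ ∀ i ∉ s, A i = C i by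
    obtain ⟨A, h3, h4, h5, -⟩ := h Finset.univ
    have hcard : ∀ i, (A i).card = k i := fun i => h5 i (Finset.mem_univ i)
    refine ⟨A, h3, hcard, fun i => ?_⟩
    rcases le_total (U i).card (k i) with h | h
    · right
      rw [← Finset.eq_of_subset_of_card_le (hCU i) (by rw [hCc, min_eq_left h])]
      exact h4 i
    · left
      rw [← Finset.eq_of_subset_of_card_le (h4 i) (by rw [hCc, hcard, min_eq_right h])]
      exact hCU i
  intro s
  induction s using Finset.induction_on with
  | empty => exact ⟨C, hdC, fun _ => subset_rfl, by simp, by simp⟩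
  | insert l s hl ih =>
    obtain ⟨A, hdA, hCA, hs, hns⟩ := ih
    have hle : ∀ i, (C i).card ≤ k i := fun i => by rw [hCc]; exact min_le_right _ _
    have hbound : ∑ i, (A i).card + (k l - (C l).card) ≤ Fintype.card β := by
      refine le_trans ?_ hsum
      rw [← Finset.add_sum_erase _ _ (Finset.mem_univ l),
        ← Finset.add_sum_erase _ k (Finset.mem_univ l), hns l hl]
      have : ∑ i ∈ Finset.univ.erase l, (A i).card ≤ ∑ i ∈ Finset.univ.erase l, k i := by
        refine Finset.sum_le_sum fun i _ => ?_
        by_cases his : i ∈ s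
        · exact (hs i his).le
        · rw [hns i his]; exact hle i
      have := hle l
      omega
    have hun : (Finset.univ.biUnion A).card = ∑ i, (A i).card :=
      Finset.card_biUnion fun i _ j _ hij => hdA hij
    obtain ⟨B, hBR, hB⟩ := Finset.exists_subset_card_eq
      (s := (Finset.univ.biUnion A)ᶜ) (n := k l - (C l).card)
      (by rw [Finset.card_compl, hun]; omega)
    have hBA : ∀ i, Disjoint B (A i) := fun i =>
      Finset.disjoint_left.2 fun x hx hxA => Finset.mem_compl.1 (hBR hx)
        (Finset.mem_biUnion.2 ⟨i, Finset.mem_univ i, hxA⟩)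
    refine ⟨Function.update A l (C l ∪ B), ?_, ?_, ?_, ?_⟩
    · intro i j hij
      by_cases hik : i = l
      · subst hik
        rw [Function.update_self, Function.update_of_ne hij.symm, Finset.disjoint_union_left,
          ← hns i hl]
        exact ⟨hdA hij, hBA j⟩
      · by_cases hjk : j = l
        · subst hjk
          rw [Function.update_self, Function.update_of_ne hij, Finset.disjoint_union_right,
            ← hns j hl]
          exact ⟨hdA hij, (hBA i).symm⟩
        · rw [Function.update_of_ne hik, Function.update_of_ne hjk]
          exact hdA hij
    · intro i
      by_cases hik : i = l
      · subst hik; simp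
      · simpa [hik] using hCA i
    · intro i hi
      by_cases hik : i = l
      · subst hik
        rw [Function.update_self, Finset.card_union_of_disjoint
          (Disjoint.symm (hns i hl ▸ hBA i)), hB]
        have := hle i
        omega
      · rw [Function.update_of_ne hik]
        exact hs i (Finset.mem_of_mem_insert_of_ne hi hik)
    · intro i hi
      simp only [Finset.mem_insert, not_or] at hi
      rw [Function.update_of_ne hi.1]
      exact hns i hi.2

end Extension

section Weighted

variable {m : ℕ}

/-- The weighted graphon property, a common form of `GraphonP` and `GraphonPt`. -/
def WGraphon (F : SimpleGraph (Fin m)) (w : Equiv.Perm (Fin m) → ℝ) (p : ℝ) (α : Fin m → ℝ)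
    (W : ℝ → ℝ → ℝ) : Prop :=
  ∀ A : Fin m → Set ℝ, (∀ i, MeasurableSet (A i)) → (∀ i, A i ⊆ Set.Icc 0 1) →
    Pairwise (fun i j => Disjoint (A i) (A j)) → (∀ i, unitMeasure.real (A i) = α i) →
    ∑ σ, w σ * wDens unitMeasure F W (fun i => (A (σ i)).indicator (fun _ => 1))
      = p ^ numEdges F * ∏ i, α i

/-- The weighted property of graph sequences, a common form of `SatisfiesP` and `SatisfiesPt`. -/
def WSeq (F : SimpleGraph (Fin m)) (w : Equiv.Perm (Fin m) → ℝ) (p : ℝ) (α : Fin m → ℝ)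
    (V : ℕ → ℕ) (G : ∀ n, SimpleGraph (Fin (V n))) : Prop :=
  ∀ δ : ℝ, 0 < δ → ∀ᶠ n in atTop, ∀ U : Fin m → Finset (Fin (V n)),
    Pairwise (fun i j => Disjoint (U i) (U j)) →
    (∀ i, (U i).card = ⌊α i * (V n : ℝ)⌋₊) →
    |∑ σ, w σ * partDens F (G n) (fun i => U (σ i))
      - p ^ numEdges F * ∏ i, ((U i).card : ℝ) / V n| ≤ δ

lemma exists_uniform_error_iff {ι : ℕ → Type} [∀ n, Finite (ι n)] [∀ n, Nonempty (ι n)]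
    (D : ∀ n, ι n → Prop) (Φ : ∀ n, ι n → ℝ) (s : ℕ → ℝ) (hs : ∀ n, 0 ≤ s n)
    (hz : ∀ n i, D n i → s n = 0 → Φ n i = 0) :
    (∃ ε : ℕ → ℝ, Tendsto ε atTop (nhds 0) ∧ ∀ n i, D n i → |Φ n i| ≤ ε n * s n) ↔
      ∀ δ : ℝ, 0 < δ → ∀ᶠ n in atTop, ∀ i, D n i → |Φ n i| ≤ δ * s n := by
  classical
  constructor
  · rintro ⟨ε, hε, h⟩ δ hδ
    filter_upwards [hε.eventually_le_const hδ] with n hn i hi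
    exact (h n i hi).trans (mul_le_mul_of_nonneg_right hn (hs n))
  · intro h
    set q : ∀ n, ι n → ℝ := fun n i => if D n i then |Φ n i| / s n else 0 with hq
    have hq0 : ∀ n i, 0 ≤ q n i := fun n i => by
      rw [hq]; dsimp only; split_ifs
      · exact div_nonneg (abs_nonneg _) (hs n)
      · exact le_rfl
    refine ⟨fun n => ⨆ i, q n i, ?_, ?_⟩
    · rw [Metric.tendsto_atTop']
      intro δ hδ
      obtain ⟨n₀, hn₀⟩ := eventually_atTop.1 (h (δ / 2) (by positivity))
      refine ⟨n₀, fun n hn => ?_⟩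
      rw [Real.dist_eq, sub_zero, abs_of_nonneg (Real.iSup_nonneg (hq0 n))]
      refine lt_of_le_of_lt (ciSup_le fun i => ?_) (half_lt_self hδ)
      rw [hq]; dsimp only; split_ifs with hD
      · rcases (hs n).eq_or_lt with h0 | h0
        · rw [← h0, div_zero]; positivity
        · rw [div_le_iff₀ h0]; exact hn₀ n hn.le i hD
      · positivity
    · intro n i hD
      rcases (hs n).eq_or_lt with h0 | h0
      · rw [hz n i hD h0.symm, ← h0]; simp
      · rw [← div_le_iff₀ h0]
        have : q n i ≤ ⨆ i, q n i := le_ciSup (Set.finite_range _).bddAbove i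
        simpa [hq, hD] using this

lemma wseq_iff {F : SimpleGraph (Fin m)} {w : Equiv.Perm (Fin m) → ℝ} {p : ℝ} {α : Fin m → ℝ}
    {V : ℕ → ℕ} {G : ∀ n, SimpleGraph (Fin (V n))} (hV : Tendsto V atTop atTop) :
    (∃ ε : ℕ → ℝ, Tendsto ε atTop (nhds 0) ∧
      ∀ (n : ℕ) (U : Fin m → Finset (Fin (V n))),
        Pairwise (fun i j => Disjoint (U i) (U j)) →
        (∀ i, (U i).card = ⌊α i * (V n : ℝ)⌋₊) →
        |∑ σ, w σ * (labCount F (G n) (fun i => U (σ i)) : ℝ)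
          - p ^ numEdges F * ∏ i, ((U i).card : ℝ)| ≤ ε n * (V n : ℝ) ^ m)
      ↔ WSeq F w p α V G := by
  have h := exists_uniform_error_iff (ι := fun n => Fin m → Finset (Fin (V n)))
    (fun n U => Pairwise (fun i j => Disjoint (U i) (U j)) ∧
      ∀ i, (U i).card = ⌊α i * (V n : ℝ)⌋₊)
    (fun n U => ∑ σ, w σ * (labCount F (G n) (fun i => U (σ i)) : ℝ)
          - p ^ numEdges F * ∏ i, ((U i).card : ℝ)) (fun n => (V n : ℝ) ^ m)
    (fun n => by positivity) ?_
  · simp only [and_imp] at h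
    rw [h, WSeq]
    refine forall_congr' fun δ => imp_congr_right fun hδ => ?_
    refine eventually_congr ?_
    filter_upwards [hV.eventually_gt_atTop 0] with n hn
    refine forall_congr' fun U => imp_congr_right fun hd => imp_congr_right fun _ => ?_
    have hn' : (0 : ℝ) < (V n : ℝ) ^ m := by
      have : (0 : ℝ) < V n := Nat.cast_pos.2 hn
      positivity
    rw [← div_le_iff₀ hn', ← abs_of_pos hn', ← abs_div, sub_div, Finset.sum_div,
      mul_div_assoc, Finset.prod_div_distrib]
    simp only [Finset.prod_const, Finset.card_univ, Fintype.card_fin]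
    have e : ∀ σ : Equiv.Perm (Fin m), w σ * (labCount F (G n) (fun i => U (σ i)) : ℝ)
        / (V n : ℝ) ^ m = w σ * partDens F (G n) (fun i => U (σ i)) := fun σ => by
      rw [← labCount_div F (G n) (U := fun i => U (σ i)) fun i j hij => hd (σ.injective.ne hij),
        mul_div_assoc]
    simp only [e]
  · rintro n U - hn
    have hVn : V n = 0 := by
      have := eq_zero_of_pow_eq_zero hn
      exact_mod_cast this
    have hm : m ≠ 0 := by
      rintro rfl
      simp at hn
    have : IsEmpty (Fin (V n)) := by rw [hVn]; infer_instance
    obtain ⟨k, rfl⟩ := Nat.exists_eq_succ_of_ne_zero hm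
    have h0 : ∀ U : Fin (k + 1) → Finset (Fin (V n)), labCount F (G n) U = 0 := fun U => by
      rw [labCount, Nat.card_eq_zero]
      exact Or.inl ⟨fun φ => isEmptyElim (φ.1 0)⟩
    have h1 : (U 0).card = 0 := by simp [Finset.eq_empty_of_isEmpty]
    simp only [h0]
    rw [Finset.prod_eq_zero (Finset.mem_univ 0) (by rw [h1]; simp)]
    simp

lemma satisfiesP_iff {F : SimpleGraph (Fin m)} {p : ℝ} {α : Fin m → ℝ} {V : ℕ → ℕ}
    {G : ∀ n, SimpleGraph (Fin (V n))} (hV : Tendsto V atTop atTop) :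
    SatisfiesP F p α V G ↔ WSeq F (Pi.single 1 1) p α V G := by
  rw [← wseq_iff hV, SatisfiesP]
  have e : ∀ (n : ℕ) (U : Fin m → Finset (Fin (V n))),
      ∑ σ, (Pi.single 1 1 : Equiv.Perm (Fin m) → ℝ) σ *
        (labCount F (G n) (fun i => U (σ i)) : ℝ) = labCount F (G n) U := by
    intro n U
    rw [Finset.sum_eq_single 1 (fun σ _ h => by simp [h]) (by simp)]
    simp
  simp only [e]

lemma satisfiesPt_iff {F : SimpleGraph (Fin m)} {p : ℝ} {α : Fin m → ℝ} {V : ℕ → ℕ}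
    {G : ∀ n, SimpleGraph (Fin (V n))} (hV : Tendsto V atTop atTop) :
    SatisfiesPt F p α V G ↔ WSeq F (fun _ => (m.factorial : ℝ)⁻¹) p α V G := by
  rw [← wseq_iff hV, SatisfiesPt]
  simp only [symCount, Finset.mul_sum]

lemma graphonP_iff {F : SimpleGraph (Fin m)} {p : ℝ} {α : Fin m → ℝ} (hα : ∀ i, 0 ≤ α i)
    (W : ℝ → ℝ → ℝ) : GraphonP F W p α ↔ WGraphon F (Pi.single 1 1) p α W := by
  rw [GraphonP, WGraphon]
  refine forall_congr' fun A => imp_congr_right fun hA => imp_congr_right fun hA' =>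
    imp_congr_right fun _ => imp_congr (forall_congr' fun i =>
      volume_eq_ofReal_iff (hA' i) (hα i)) ?_
  rw [setIntegral_psi F W hA hA', Finset.sum_eq_single 1 (fun σ _ h => by simp [h]) (by simp)]
  simp

lemma graphonPt_iff {F : SimpleGraph (Fin m)} {p : ℝ} {α : Fin m → ℝ} (hα : ∀ i, 0 ≤ α i)
    {W : ℝ → ℝ → ℝ} (hW : IsKer W) :
    GraphonPt F W p α ↔ WGraphon F (fun _ => (m.factorial : ℝ)⁻¹) p α W := by
  rw [GraphonPt, WGraphon]
  refine forall_congr' fun A => imp_congr_right fun hA => imp_congr_right fun hA' =>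
    imp_congr_right fun _ => imp_congr (forall_congr' fun i =>
      volume_eq_ofReal_iff (hA' i) (hα i)) ?_
  rw [setIntegral_psiSym F hW hA hA']

lemma abs_weighted_sub_le {ι : Type*} [Fintype ι] {w x y : ι → ℝ} (hw : ∀ i, 0 ≤ w i)
    (hw1 : ∑ i, w i = 1) {K : ℝ} (h : ∀ i, |x i - y i| ≤ K) :
    |∑ i, w i * x i - ∑ i, w i * y i| ≤ K := by
  rw [← Finset.sum_sub_distrib]
  calc _ ≤ ∑ i, |w i * x i - w i * y i| := Finset.abs_sum_le_sum_abs _ _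
    _ ≤ ∑ i, w i * K := Finset.sum_le_sum fun i _ => by
        rw [← mul_sub, abs_mul, abs_of_nonneg (hw i)]
        exact mul_le_mul_of_nonneg_left (h i) (hw i)
    _ = K := by rw [← Finset.sum_mul, hw1, one_mul]

open Classical in
lemma abs_weighted_partDens_sub_le {N : ℕ} [NeZero N] (F : SimpleGraph (Fin m))
    {w : Equiv.Perm (Fin m) → ℝ} (hw : ∀ σ, 0 ≤ w σ) (hw1 : ∑ σ, w σ = 1)
    (G : SimpleGraph (Fin N)) {W : ℝ → ℝ → ℝ} (hW : IsKer W) {c : ℝ}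
    (hc : CutLe unitMeasure (fun x y => stepKer (adjR G) x y - W x y) c)
    (U : Fin m → Finset (Fin N)) {A : Fin m → Set ℝ} (hA : ∀ i, MeasurableSet (A i)) :
    |∑ σ, w σ * partDens F G (fun i => U (σ i))
      - ∑ σ, w σ * wDens unitMeasure F W (fun i => (A (σ i)).indicator (fun _ => 1))|
      ≤ numEdges F * c + ∑ i, ∫ x, |(if cell N x ∈ U i then (1 : ℝ) else 0)
          - (A i).indicator (fun _ => 1) x| ∂unitMeasure := by
  refine abs_weighted_sub_le hw hw1 fun σ => ?_
  rw [partDens_eq_wDens]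
  have := abs_wDens_sub_le F (isKer_stepKer (adjR_mem G)) hW hc
    (f := fun i x => if cell N x ∈ U (σ i) then (1 : ℝ) else 0)
    (g := fun i => (A (σ i)).indicator (fun _ => 1))
    (fun i => (measurable_of_finite fun a : Fin N => if a ∈ U (σ i) then (1 : ℝ) else 0).comp
      measurable_cell)
    (fun i x => by split_ifs <;> simp)
    (fun i => measurable_const.indicator (hA _))
    (fun i x => by
      by_cases h : x ∈ A (σ i) <;> simp [h])
  refine this.trans (le_of_eq ?_)
  congr 1
  exact Equiv.sum_comp σ (fun i => ∫ x, |(if cell N x ∈ U i then (1 : ℝ) else 0)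
    - (A i).indicator (fun _ => 1) x| ∂unitMeasure)

open Classical in
lemma integral_ite_cell {N : ℕ} [NeZero N] (U : Finset (Fin N)) :
    ∫ x, (if cell N x ∈ U then (1 : ℝ) else 0) ∂unitMeasure = (U.card : ℝ) / N := by
  rw [integral_cell (fun a : Fin N => if a ∈ U then (1 : ℝ) else 0)]
  simp

lemma abs_floor_div_sub_le {a : ℝ} (ha : 0 ≤ a) {N : ℕ} (hN : 0 < N) :
    |(⌊a * N⌋₊ : ℝ) / N - a| ≤ 1 / N := by
  have hN' : (0 : ℝ) < N := Nat.cast_pos.2 hN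
  have h1 := Nat.floor_le (mul_nonneg ha hN'.le)
  have h2 := Nat.lt_floor_add_one (a * N)
  rw [abs_sub_comm, abs_le]
  constructor
  · have : (⌊a * N⌋₊ : ℝ) / N ≤ a := (div_le_iff₀ hN').2 h1
    have : 0 ≤ 1 / (N : ℝ) := by positivity
    linarith
  · rw [sub_le_iff_le_add, ← add_div, le_div_iff₀ hN']
    linarith

lemma abs_prod_card_sub_le {p : ℝ} (hp : p ∈ Set.Icc (0 : ℝ) 1) (k : ℕ) {α : Fin m → ℝ}
    (hα : ∀ i, α i ∈ Set.Icc (0 : ℝ) 1) {N : ℕ} (hN : 0 < N) :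
    |p ^ k * ∏ i, (⌊α i * N⌋₊ : ℝ) / N - p ^ k * ∏ i, α i| ≤ m * (1 / N) := by
  have hN' : (0 : ℝ) < N := Nat.cast_pos.2 hN
  have hpk : |p ^ k| ≤ 1 := by
    rw [abs_of_nonneg (pow_nonneg hp.1 _)]; exact pow_le_one₀ hp.1 hp.2
  rw [← mul_sub, abs_mul]
  refine (mul_le_of_le_one_left (abs_nonneg _) hpk).trans ?_
  refine (abs_prod_sub_prod_le_sum Finset.univ (fun i _ => ⟨by positivity, ?_⟩)
    fun i _ => hα i).trans ?_
  · rw [div_le_one hN']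
    refine (Nat.floor_le (mul_nonneg (hα i).1 hN'.le)).trans ?_
    exact mul_le_of_le_one_left hN'.le (hα i).2
  · calc _ ≤ ∑ _i : Fin m, 1 / (N : ℝ) :=
        Finset.sum_le_sum fun i _ => abs_floor_div_sub_le (hα i).1 hN
      _ = m * (1 / N) := by simp

/-- A graph close in cut norm to a graphon with the weighted property almost satisfies the
corresponding property of graphs. -/
lemma WGraphon.abs_partDens_sub_le {F : SimpleGraph (Fin m)}
    {w : Equiv.Perm (Fin m) → ℝ} (hw : ∀ σ, 0 ≤ w σ) (hw1 : ∑ σ, w σ = 1) {p : ℝ}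
    (hp : p ∈ Set.Icc (0 : ℝ) 1) {α : Fin m → ℝ} (hα : ∀ i, α i ∈ Set.Icc (0 : ℝ) 1)
    (hsum : ∑ i, α i ≤ 1) {W : ℝ → ℝ → ℝ} (hW : IsKer W) (h : WGraphon F w p α W)
    {N : ℕ} [NeZero N] {G : SimpleGraph (Fin N)} {c : ℝ}
    (hc : CutLe unitMeasure (fun x y => stepKer (adjR G) x y - W x y) c)
    {U : Fin m → Finset (Fin N)} (hd : Pairwise fun i j => Disjoint (U i) (U j))
    (hU : ∀ i, (U i).card = ⌊α i * (N : ℝ)⌋₊) :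
    |∑ σ, w σ * partDens F G (fun i => U (σ i)) - p ^ numEdges F * ∏ i, ((U i).card : ℝ) / N|
      ≤ numEdges F * c + 2 * m * (1 / N) := by
  classical
  have hN : 0 < N := Nat.pos_of_ne_zero (NeZero.ne N)
  have hN' : (0 : ℝ) < N := Nat.cast_pos.2 hN
  set C : Fin m → Set ℝ := fun i => cell N ⁻¹' (U i) ∩ Set.Icc 0 1 with hC
  have hcellm : ∀ i, MeasurableSet (cell N ⁻¹' (U i : Set (Fin N))) := fun i =>
    measurable_cell (U i).measurableSet
  have hCm : ∀ i, MeasurableSet (C i) := fun i => (hcellm i).inter measurableSet_Icc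
  have hCreal : ∀ i, unitMeasure.real (C i) = (⌊α i * (N : ℝ)⌋₊ : ℝ) / N := fun i => by
    have h1 : unitMeasure.real (C i) = unitMeasure.real (cell N ⁻¹' (U i)) := by
      refine measureReal_congr ?_
      filter_upwards [ae_mem_Ico] with x hx
      exact propext ⟨fun h => h.1, fun h => ⟨h, hx.1, hx.2.le⟩⟩
    rw [h1, ← hU, ← integral_ite_cell, ← integral_indicator_one (hcellm i)]
    refine integral_congr_ae (Eventually.of_forall fun x => ?_)
    simp [Set.indicator_apply]
  have hCle : ∀ i, unitMeasure.real (C i) ≤ α i := fun i => by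
    rw [hCreal, div_le_iff₀ hN']
    exact Nat.floor_le (mul_nonneg (hα i).1 hN'.le)
  obtain ⟨A, hA, hA', hdA, hCA, hAα⟩ := exists_disjoint_extension hsum hCm
    (fun i => Set.inter_subset_right) (fun i j hij => by
      refine Disjoint.mono Set.inter_subset_left Set.inter_subset_left ?_
      exact Disjoint.preimage _ (Finset.disjoint_coe.2 (hd hij))) hCle
  have hL1 : ∀ i, ∫ x, |(if cell N x ∈ U i then (1 : ℝ) else 0)
          - (A i).indicator (fun _ => 1) x| ∂unitMeasure ≤ 1 / N := fun i => by
    have e : ∫ x, |(if cell N x ∈ U i then (1 : ℝ) else 0)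
          - (A i).indicator (fun _ => 1) x| ∂unitMeasure = unitMeasure.real (A i \ C i) := by
      rw [← integral_indicator_one ((hA i).diff (hCm i))]
      refine integral_congr_ae ?_
      filter_upwards [ae_mem_Ico] with x hx
      have hxC : x ∈ C i ↔ cell N x ∈ U i := ⟨fun h => h.1, fun h => ⟨h, hx.1, hx.2.le⟩⟩
      by_cases h1 : cell N x ∈ U i
      · have : x ∈ A i := hCA i (hxC.2 h1)
        simp [h1, this, hxC]
      · by_cases h2 : x ∈ A i <;> simp [h1, h2, hxC]
    rw [e, measureReal_sdiff (hCA i) (hCm i), hAα, hCreal]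
    refine (le_abs_self _).trans ?_
    rw [abs_sub_comm]
    exact abs_floor_div_sub_le (hα i).1 hN
  have h1 := abs_weighted_partDens_sub_le F hw hw1 G hW hc U hA
  rw [h A hA hA' hdA hAα] at h1
  have h2 := abs_prod_card_sub_le hp (numEdges F) hα hN
  simp only [hU]
  have h3 : ∑ i, ∫ x, |(if cell N x ∈ U i then (1 : ℝ) else 0)
          - (A i).indicator (fun _ => 1) x| ∂unitMeasure ≤ m * (1 / N) := by
    refine (Finset.sum_le_sum fun i _ => hL1 i).trans ?_
    simp
  rw [abs_sub_comm] at h2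
  have h4 := abs_sub_le (∑ σ, w σ * partDens F G (fun i => U (σ i)))
    (p ^ numEdges F * ∏ i, α i) (p ^ numEdges F * ∏ i, (⌊α i * N⌋₊ : ℝ) / N)
  linarith

lemma WGraphon.wSeq {F : SimpleGraph (Fin m)}
    {w : Equiv.Perm (Fin m) → ℝ} (hw : ∀ σ, 0 ≤ w σ) (hw1 : ∑ σ, w σ = 1) {p : ℝ}
    (hp : p ∈ Set.Icc (0 : ℝ) 1) {α : Fin m → ℝ} (hα : ∀ i, α i ∈ Set.Icc (0 : ℝ) 1)
    (hsum : ∑ i, α i ≤ 1) {W : ℝ → ℝ → ℝ} (hW : IsKer W) (h : WGraphon F w p α W)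
    {V : ℕ → ℕ} [∀ n, NeZero (V n)] (hV : Tendsto V atTop atTop)
    {G : ∀ n, SimpleGraph (Fin (V n))}
    (hcut : ∀ c : ℝ, 0 < c →
      ∀ᶠ n in atTop, CutLe unitMeasure (fun x y => stepKer (adjR (G n)) x y - W x y) c) :
    WSeq F w p α V G := by
  intro δ hδ
  have hVr : Tendsto (fun n => (V n : ℝ)) atTop atTop := tendsto_natCast_atTop_atTop.comp hV
  have hlim : Tendsto (fun n => 2 * m * (1 / (V n : ℝ))) atTop (nhds 0) := by
    simpa using (tendsto_const_nhds (x := (1 : ℝ)).div_atTop hVr).const_mul (2 * m : ℝ)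
  have hc : 0 < δ / 2 / (numEdges F + 1) := by positivity
  filter_upwards [hcut _ hc, hlim.eventually_le_const (half_pos hδ)] with n hn hn' U hd hU
  refine (h.abs_partDens_sub_le hw hw1 hp hα hsum hW hn hd hU).trans ?_
  have : numEdges F * (δ / 2 / (numEdges F + 1)) ≤ δ / 2 := by
    rw [mul_div_assoc', div_le_iff₀ (by positivity)]
    nlinarith
  linarith

lemma wGraphon_const (F : SimpleGraph (Fin m)) {w : Equiv.Perm (Fin m) → ℝ}
    (hw1 : ∑ σ, w σ = 1) (p : ℝ) (α : Fin m → ℝ) : WGraphon F w p α (fun _ _ => p) := by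
  intro A hA hA' _ hAα
  have e : ∀ i, ∫ x, (A i).indicator (fun _ => (1 : ℝ)) x ∂unitMeasure = α i := fun i => by
    rw [← hAα i, ← integral_indicator_one (hA i)]; rfl
  simp only [wDens_const, e]
  have e' : ∀ σ : Equiv.Perm (Fin m), ∏ i, α (σ i) = ∏ i, α i := fun σ => Equiv.prod_comp σ α
  simp only [e', ← Finset.sum_mul, hw1, one_mul]

end Weighted

section Averages

/-- The centre of the `a`-th interval of length `1/N`. -/
noncomputable def cellCenter {N : ℕ} (a : Fin N) : ℝ := ((a : ℝ) + 1 / 2) / N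

lemma mem_closedBall_cellCenter {N : ℕ} [NeZero N] {x : ℝ} (hx : x ∈ Set.Ico (0 : ℝ) 1) :
    x ∈ Metric.closedBall (cellCenter (cell N x)) (1 / (2 * N)) := by
  have hN := cast_pos_of_neZero N
  obtain ⟨h1, h2⟩ := (cell_eq_iff hx (cell N x)).1 rfl
  rw [div_le_iff₀ hN] at h1
  rw [lt_div_iff₀ hN] at h2
  have e1 : 1 / (2 * (N : ℝ)) = (1 / 2) / N := by field_simp
  have e2 : x - cellCenter (cell N x) = (x * N - (((cell N x : ℕ) : ℝ) + 1 / 2)) / N := by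
    rw [cellCenter]; field_simp
  rw [Metric.mem_closedBall, Real.dist_eq, e1, e2, abs_div, abs_of_pos hN]
  gcongr
  rw [abs_le]
  constructor <;> linarith

lemma tendsto_cellRadius {V : ℕ → ℕ} [∀ n, NeZero (V n)] (hV : Tendsto V atTop atTop) :
    Tendsto (fun n => 1 / (2 * (V n : ℝ))) atTop (nhdsWithin 0 (Set.Ioi 0)) := by
  have hVr : Tendsto (fun n => (V n : ℝ)) atTop atTop := tendsto_natCast_atTop_atTop.comp hV
  refine tendsto_nhdsWithin_iff.2 ⟨?_, Eventually.of_forall fun n => ?_⟩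
  · exact tendsto_const_nhds.div_atTop (hVr.const_mul_atTop two_pos)
  · have := cast_pos_of_neZero (V n)
    exact Set.mem_Ioi.2 (by positivity)

/-- The averages of `f` over intervals of length `1/N` converge to `f` almost everywhere. -/
lemma ae_tendsto_cellAverage {V : ℕ → ℕ} [∀ n, NeZero (V n)] (hV : Tendsto V atTop atTop)
    {f : ℝ → ℝ} (hf : LocallyIntegrable f volume) :
    ∀ᵐ x ∂unitMeasure, Tendsto (fun n => ⨍ y in Metric.closedBall
      (cellCenter (cell (V n) x)) (1 / (2 * (V n : ℝ))), f y) atTop (nhds (f x)) := by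
  filter_upwards [ae_mem_Ico, ae_restrict_of_ae
    (IsUnifLocDoublingMeasure.ae_tendsto_average (μ := volume) hf 1)] with x hx h
  refine h _ _ (tendsto_cellRadius hV) (Eventually.of_forall fun n => ?_)
  rw [one_mul]
  exact mem_closedBall_cellCenter hx

/-- The averages of `f` over squares of side `1/N` converge to `f` almost everywhere. -/
lemma ae_tendsto_cellAverage_prod {V : ℕ → ℕ} [∀ n, NeZero (V n)] (hV : Tendsto V atTop atTop)
    {f : ℝ × ℝ → ℝ} (hf : LocallyIntegrable f (volume : Measure (ℝ × ℝ))) :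
    ∀ᵐ z ∂(unitMeasure.prod unitMeasure), Tendsto (fun n => ⨍ y in Metric.closedBall
      (cellCenter (cell (V n) z.1), cellCenter (cell (V n) z.2)) (1 / (2 * (V n : ℝ))), f y)
      atTop (nhds (f z)) := by
  have : (volume : Measure (ℝ × ℝ)).IsAddHaarMeasure :=
    inferInstanceAs ((volume : Measure ℝ).prod (volume : Measure ℝ)).IsAddHaarMeasure
  have h1 : ∀ᵐ z ∂(unitMeasure.prod unitMeasure), z.1 ∈ Set.Ico (0 : ℝ) 1 :=
    Measure.quasiMeasurePreserving_fst.ae ae_mem_Ico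
  have h2 : ∀ᵐ z ∂(unitMeasure.prod unitMeasure), z.2 ∈ Set.Ico (0 : ℝ) 1 :=
    Measure.quasiMeasurePreserving_snd.ae ae_mem_Ico
  have h3 : unitMeasure.prod unitMeasure
      = (volume : Measure (ℝ × ℝ)).restrict (Set.Icc 0 1 ×ˢ Set.Icc 0 1) := by
    rw [Measure.prod_restrict]; rfl
  have h4 := IsUnifLocDoublingMeasure.ae_tendsto_average (μ := (volume : Measure (ℝ × ℝ))) hf 1
  have h4' := ae_restrict_of_ae (s := Set.Icc (0 : ℝ) 1 ×ˢ Set.Icc (0 : ℝ) 1) h4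
  rw [← h3] at h4'
  filter_upwards [h1, h2, h4'] with z hz1 hz2 h
  refine h _ _ (tendsto_cellRadius hV) (Eventually.of_forall fun n => ?_)
  rw [one_mul, ← closedBall_prod_same]
  exact ⟨mem_closedBall_cellCenter hz1, mem_closedBall_cellCenter hz2⟩

end Averages

section Converse

variable {m : ℕ}

open Classical in
lemma integral_abs_ite_cell_sub {N : ℕ} [NeZero N] {T U : Finset (Fin N)}
    (h : T ⊆ U ∨ U ⊆ T) :
    ∫ x, |(if cell N x ∈ T then (1 : ℝ) else 0) - (if cell N x ∈ U then (1 : ℝ) else 0)|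
      ∂unitMeasure = |(T.card : ℝ) / N - (U.card : ℝ) / N| := by
  rw [← integral_ite_cell, ← integral_ite_cell, ← integral_sub]
  · rcases h with h | h
    · have e : ∀ x, (if cell N x ∈ T then (1 : ℝ) else 0) - (if cell N x ∈ U then (1 : ℝ) else 0)
          ≤ 0 := fun x => by
        by_cases hT : cell N x ∈ T
        · simp [hT, h hT]
        · simp only [hT, if_false]; split_ifs <;> norm_num
      rw [abs_of_nonpos (integral_nonpos e), ← integral_neg]
      exact integral_congr_ae (Eventually.of_forall fun x => abs_of_nonpos (e x))
    · have e : ∀ x, 0 ≤ (if cell N x ∈ T then (1 : ℝ) else 0)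
          - (if cell N x ∈ U then (1 : ℝ) else 0) := fun x => by
        by_cases hU : cell N x ∈ U
        · simp [hU, h hU]
        · simp only [hU, if_false]; split_ifs <;> norm_num
      rw [abs_of_nonneg (integral_nonneg e)]
      exact integral_congr_ae (Eventually.of_forall fun x => abs_of_nonneg (e x))
  all_goals
    refine integrable_of_Icc ?_ 1 fun x => by split_ifs <;> simp
  · exact (measurable_of_finite fun a : Fin N => if a ∈ T then (1 : ℝ) else 0).comp measurable_cell
  · exact (measurable_of_finite fun a : Fin N => if a ∈ U then (1 : ℝ) else 0).comp measurable_cell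

open Classical in
/-- Disjoint sets are approximated by disjoint unions of intervals of length `1/N`. -/
lemma exists_disjoint_cells {V : ℕ → ℕ} [∀ n, NeZero (V n)] (hV : Tendsto V atTop atTop)
    {A : Fin m → Set ℝ} (hA : ∀ i, MeasurableSet (A i))
    (hd : Pairwise fun i j => Disjoint (A i) (A j)) :
    ∃ U : ∀ n, Fin m → Finset (Fin (V n)),
      (∀ n, Pairwise fun i j => Disjoint (U n i) (U n j)) ∧
      ∀ i, Tendsto (fun n => ∫ x, |(if cell (V n) x ∈ U n i then (1 : ℝ) else 0)
        - (A i).indicator (fun _ => 1) x| ∂unitMeasure) atTop (nhds 0) := by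
  set f : Fin m → ℝ → ℝ := fun i => (A i).indicator fun _ => 1 with hf
  have hfloc : ∀ i, LocallyIntegrable (f i) volume := fun i =>
    (locallyIntegrable_const (1 : ℝ)).indicator (hA i)
  set av : ∀ n, Fin m → Fin (V n) → ℝ := fun n i a =>
    ⨍ y in Metric.closedBall (cellCenter a) (1 / (2 * (V n : ℝ))), f i y with hav
  have hdisj : ∀ n i j, i ≠ j → ∀ a, av n i a + av n j a ≤ 1 := by
    intro n i j hij a
    have hr : 0 < 1 / (2 * (V n : ℝ)) := by
      have := cast_pos_of_neZero (V n); positivity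
    have hI : ∀ i, IntegrableOn (f i) (Metric.closedBall (cellCenter a) (1 / (2 * (V n : ℝ)))) :=
      fun i => (hfloc i).integrableOn_isCompact (isCompact_closedBall _ _)
    have hpos : 0 < volume.real (Metric.closedBall (cellCenter a) (1 / (2 * (V n : ℝ)))) := by
      rw [Real.volume_real_closedBall hr.le]; positivity
    rw [hav]
    simp only [setAverage_eq, smul_eq_mul]
    rw [← mul_add, ← integral_add (hI i) (hI j), inv_mul_le_iff₀ hpos, mul_one]
    have : ∫ x in Metric.closedBall (cellCenter a) (1 / (2 * (V n : ℝ))), (f i x + f j x)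
        ≤ ∫ x in Metric.closedBall (cellCenter a) (1 / (2 * (V n : ℝ))), (1 : ℝ) := by
      refine integral_mono ((hI i).add (hI j)) ?_ fun x => ?_
      · exact integrableOn_const (isCompact_closedBall _ _).measure_lt_top.ne
      · have : x ∈ A i → x ∉ A j := fun h => Set.disjoint_left.1 (hd hij) h
        by_cases h1 : x ∈ A i
        · simp [hf, h1, this h1]
        · by_cases h2 : x ∈ A j <;> simp [hf, h1, h2]
    refine this.trans ?_
    simp
  refine ⟨fun n i => Finset.univ.filter fun a => 1 / 2 < av n i a, fun n i j hij => ?_,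
    fun i => ?_⟩
  · refine Finset.disjoint_left.2 fun a ha hb => ?_
    have h1 := (Finset.mem_filter.1 ha).2
    have h2 := (Finset.mem_filter.1 hb).2
    have := hdisj n i j hij a
    linarith
  · have hm : ∀ n, Measurable fun x => |(if cell (V n) x ∈ Finset.univ.filter
        (fun a => 1 / 2 < av n i a) then (1 : ℝ) else 0) - f i x| := fun n =>
      (((measurable_of_finite fun a : Fin (V n) => if a ∈ Finset.univ.filter
        (fun a => 1 / 2 < av n i a) then (1 : ℝ) else 0).comp measurable_cell).sub
          (measurable_const.indicator (hA i))).abs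
    have key := tendsto_integral_of_dominated_convergence (μ := unitMeasure)
      (F := fun n x => |(if cell (V n) x ∈ Finset.univ.filter
        (fun a => 1 / 2 < av n i a) then (1 : ℝ) else 0) - f i x|) (f := fun _ => 0)
      (fun _ => 1) (fun n => (hm n).aestronglyMeasurable) (integrable_const 1) ?_ ?_
    · simpa using key
    · intro n
      refine Eventually.of_forall fun x => ?_
      rw [Real.norm_eq_abs, abs_abs]
      by_cases h : x ∈ A i <;> simp only [hf, h, Set.indicator_of_mem, not_false_eq_true,
        Set.indicator_of_notMem] <;> split_ifs <;> norm_num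
    · filter_upwards [ae_tendsto_cellAverage hV (hfloc i)] with x hx
      refine tendsto_const_nhds.congr' ?_
      by_cases h : x ∈ A i
      · have h1 : f i x = 1 := by simp [hf, h]
        rw [h1] at hx
        filter_upwards [hx.eventually_const_lt (by norm_num : (1 / 2 : ℝ) < 1)] with n hn
        have hmem : cell (V n) x ∈ Finset.univ.filter (fun a => 1 / 2 < av n i a) :=
          Finset.mem_filter.2 ⟨Finset.mem_univ _, hn⟩
        rw [if_pos hmem, h1]; simp
      · have h1 : f i x = 0 := by simp [hf, h]
        rw [h1] at hx
        filter_upwards [hx.eventually_lt_const (by norm_num : (0 : ℝ) < 1 / 2)] with n hn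
        have hmem : cell (V n) x ∉ Finset.univ.filter (fun a => 1 / 2 < av n i a) :=
          fun h' => not_lt.2 hn.le (Finset.mem_filter.1 h').2
        rw [if_neg hmem, h1]; simp

lemma sum_floor_le {α : Fin m → ℝ} (hα : ∀ i, 0 ≤ α i) (hsum : ∑ i, α i ≤ 1) (N : ℕ) :
    ∑ i, ⌊α i * (N : ℝ)⌋₊ ≤ N := by
  have : ((∑ i, ⌊α i * (N : ℝ)⌋₊ : ℕ) : ℝ) ≤ N := by
    push_cast
    calc _ ≤ ∑ i, α i * (N : ℝ) := Finset.sum_le_sum fun i _ =>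
          Nat.floor_le (mul_nonneg (hα i) (Nat.cast_nonneg N))
      _ = (∑ i, α i) * N := (Finset.sum_mul ..).symm
      _ ≤ N := mul_le_of_le_one_left (Nat.cast_nonneg N) hsum
  exact_mod_cast this

open Classical in
/-- The weighted property passes from a graph sequence to its limit graphon. -/
lemma WSeq.wGraphon {F : SimpleGraph (Fin m)}
    {w : Equiv.Perm (Fin m) → ℝ} (hw : ∀ σ, 0 ≤ w σ) (hw1 : ∑ σ, w σ = 1) {p : ℝ}
    (hp : p ∈ Set.Icc (0 : ℝ) 1) {α : Fin m → ℝ} (hα : ∀ i, α i ∈ Set.Icc (0 : ℝ) 1)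
    (hsum : ∑ i, α i ≤ 1) {W : ℝ → ℝ → ℝ} (hW : IsKer W)
    {V : ℕ → ℕ} [∀ n, NeZero (V n)] (hV : Tendsto V atTop atTop)
    {G : ∀ n, SimpleGraph (Fin (V n))} (h : WSeq F w p α V G)
    (hcut : ∀ c : ℝ, 0 < c →
      ∀ᶠ n in atTop, CutLe unitMeasure (fun x y => stepKer (adjR (G n)) x y - W x y) c) :
    WGraphon F w p α W := by
  intro A hA hA' hdA hAα
  have hVr : Tendsto (fun n => (V n : ℝ)) atTop atTop := tendsto_natCast_atTop_atTop.comp hV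
  have hinv : Tendsto (fun n => 1 / (V n : ℝ)) atTop (nhds 0) :=
    tendsto_const_nhds.div_atTop hVr
  obtain ⟨U, hdU, hU⟩ := exists_disjoint_cells hV hA hdA
  have hres : ∀ n, ∃ T : Fin m → Finset (Fin (V n)), (Pairwise fun i j => Disjoint (T i) (T j)) ∧
      (∀ i, (T i).card = ⌊α i * (V n : ℝ)⌋₊) ∧ ∀ i, T i ⊆ U n i ∨ U n i ⊆ T i := fun n =>
    exists_disjoint_resize (by simpa using sum_floor_le (fun i => (hα i).1) hsum (V n)) (hdU n)
  choose T hdT hTc hTU using hres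
  have hmA : ∀ i, Measurable ((A i).indicator fun _ => (1 : ℝ)) := fun i =>
    measurable_const.indicator (hA i)
  have hmT : ∀ {N : ℕ} [NeZero N] (T : Finset (Fin N)),
      Measurable fun x => if cell N x ∈ T then (1 : ℝ) else 0 := fun T =>
    (measurable_of_finite fun a => if a ∈ T then (1 : ℝ) else 0).comp measurable_cell
  have hInt : ∀ (n : ℕ) (S : Finset (Fin (V n))) (i : Fin m),
      Integrable (fun x => (if cell (V n) x ∈ S then (1 : ℝ) else 0)
        - (A i).indicator (fun _ => 1) x) unitMeasure := fun n S i => by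
    refine integrable_of_Icc ((hmT S).sub (hmA i)) 1 fun x => ?_
    by_cases h : x ∈ A i <;> simp only [h, Set.indicator_of_mem, not_false_eq_true,
        Set.indicator_of_notMem] <;> split_ifs <;> norm_num
  have hAint : ∀ i, ∫ x, (A i).indicator (fun _ => (1 : ℝ)) x ∂unitMeasure = α i := fun i => by
    rw [← hAα i, ← integral_indicator_one (hA i)]; rfl
  -- the `L¹` distance between the resized cells and the original sets
  have hT1 : ∀ n i, ∫ x, |(if cell (V n) x ∈ T n i then (1 : ℝ) else 0)
        - (A i).indicator (fun _ => 1) x| ∂unitMeasure ≤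
      1 / (V n : ℝ) + 2 * ∫ x, |(if cell (V n) x ∈ U n i then (1 : ℝ) else 0)
        - (A i).indicator (fun _ => 1) x| ∂unitMeasure := by
    intro n i
    set I := ∫ x, |(if cell (V n) x ∈ U n i then (1 : ℝ) else 0)
        - (A i).indicator (fun _ => 1) x| ∂unitMeasure with hI
    have h1 : ∫ x, |(if cell (V n) x ∈ T n i then (1 : ℝ) else 0)
        - (A i).indicator (fun _ => 1) x| ∂unitMeasure ≤
        ∫ x, |(if cell (V n) x ∈ T n i then (1 : ℝ) else 0)
          - (if cell (V n) x ∈ U n i then (1 : ℝ) else 0)| ∂unitMeasure + I := by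
      rw [hI, ← integral_add]
      · refine integral_mono (hInt n (T n i) i).abs ?_ fun x => abs_sub_le _ _ _
        refine Integrable.add ?_ (hInt n (U n i) i).abs
        refine integrable_of_Icc ((hmT (T n i)).sub (hmT (U n i))).abs 1 fun x => ?_
        split_ifs <;> norm_num
      · refine integrable_of_Icc ((hmT (T n i)).sub (hmT (U n i))).abs 1 fun x => ?_
        split_ifs <;> norm_num
      · exact (hInt n (U n i) i).abs
    rw [integral_abs_ite_cell_sub (hTU n i), hTc] at h1
    have h2 := abs_floor_div_sub_le (hα i).1 (Nat.pos_of_ne_zero (NeZero.ne (V n)))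
    have h3 : |α i - ((U n i).card : ℝ) / V n| ≤ I := by
      rw [abs_sub_comm, ← integral_ite_cell, ← hAint i, ← integral_sub]
      · exact abs_integral_le_integral_abs
      · refine integrable_of_Icc (hmT _) 1 fun x => ?_
        split_ifs <;> norm_num
      · refine integrable_of_Icc (hmA i) 1 fun x => ?_
        by_cases h : x ∈ A i <;> simp [h]
    have h4 := abs_sub_le ((⌊α i * (V n : ℝ)⌋₊ : ℝ) / V n) (α i) (((U n i).card : ℝ) / V n)
    linarith
  have hTlim : Tendsto (fun n => ∑ i, ∫ x, |(if cell (V n) x ∈ T n i then (1 : ℝ) else 0)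
        - (A i).indicator (fun _ => 1) x| ∂unitMeasure) atTop (nhds 0) := by
    have : Tendsto (fun n => ∑ i, ∫ x, |(if cell (V n) x ∈ T n i then (1 : ℝ) else 0)
        - (A i).indicator (fun _ => 1) x| ∂unitMeasure) atTop (nhds (∑ _i : Fin m, (0 : ℝ))) := by
      refine tendsto_finsetSum _ fun i _ => ?_
      refine squeeze_zero (fun n => integral_nonneg fun x => abs_nonneg _) (fun n => hT1 n i) ?_
      simpa using hinv.add ((hU i).const_mul 2)
    simpa using this
  refine eq_of_abs_sub_le_all fun ε hε => ?_
  have hc : 0 < ε / 4 / (numEdges F + 1) := by positivity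
  have hlim : Tendsto (fun n => m * (1 / (V n : ℝ))) atTop (nhds 0) := by
    simpa using hinv.const_mul (m : ℝ)
  obtain ⟨n, hn1, hn2, hn3, hn4⟩ := ((hcut _ hc).and ((h (ε / 4) (by positivity)).and
    ((hTlim.eventually_le_const (by positivity : 0 < ε / 4)).and
      (hlim.eventually_le_const (by positivity : 0 < ε / 4))))).exists
  have h1 := abs_weighted_partDens_sub_le F hw hw1 (G n) hW hn1 (T n) hA
  have h2 := hn2 (T n) (hdT n) (hTc n)
  have h3 := abs_prod_card_sub_le hp (numEdges F) hα (Nat.pos_of_ne_zero (NeZero.ne (V n)))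
  simp only [hTc n] at h2
  have h5 : numEdges F * (ε / 4 / (numEdges F + 1)) ≤ ε / 4 := by
    rw [mul_div_assoc', div_le_iff₀ (by positivity)]
    nlinarith
  set X := ∑ σ, w σ * partDens F (G n) (fun i => T n (σ i))
  set Y := ∑ σ, w σ * wDens unitMeasure F W (fun i => (A (σ i)).indicator (fun _ => 1))
  set Z := p ^ numEdges F * ∏ i, (⌊α i * (V n : ℝ)⌋₊ : ℝ) / V n
  have h6 := abs_sub_le Y X Z
  have h7 := abs_sub_le Y Z (p ^ numEdges F * ∏ i, α i)
  rw [abs_sub_comm] at h1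
  linarith

end Converse

section Rounding

/-- `Φ` is affine in each coordinate. -/
def MultiAffine {ι : Type*} [DecidableEq ι] (Φ : (ι → ℝ) → ℝ) : Prop :=
  ∀ a i t, Φ (Function.update a i t)
    = (1 - t) * Φ (Function.update a i 0) + t * Φ (Function.update a i 1)

variable {ι : Type*} [DecidableEq ι]

lemma MultiAffine.sum {κ : Type*} {s : Finset κ} {Φ : κ → (ι → ℝ) → ℝ}
    (h : ∀ k ∈ s, MultiAffine (Φ k)) : MultiAffine fun a => ∑ k ∈ s, Φ k a := by
  intro a i t
  simp only [Finset.mul_sum, ← Finset.sum_add_distrib]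
  exact Finset.sum_congr rfl fun k hk => h k hk a i t

lemma multiAffine_prod {κ : Type*} [DecidableEq κ] {s : Finset κ} {k : κ → ι}
    (hk : Set.InjOn k s) (C : κ → ℝ) :
    MultiAffine fun a : ι → ℝ => ∏ e ∈ s, (a (k e) - C e) := by
  intro a i t
  by_cases h : ∃ e₀ ∈ s, k e₀ = i
  · obtain ⟨e₀, he₀, rfl⟩ := h
    have hrest : ∀ t, ∏ e ∈ s.erase e₀, (Function.update a (k e₀) t (k e) - C e)
        = ∏ e ∈ s.erase e₀, (a (k e) - C e) := fun t =>
      Finset.prod_congr rfl fun e he => by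
        rw [Function.update_of_ne fun hee => (Finset.ne_of_mem_erase he)
          (hk (Finset.mem_of_mem_erase he) he₀ hee)]
    simp only [← Finset.mul_prod_erase s _ he₀, hrest, Function.update_self]
    ring
  · push Not at h
    have hrest : ∀ t, ∏ e ∈ s, (Function.update a i t (k e) - C e)
        = ∏ e ∈ s, (a (k e) - C e) := fun t =>
      Finset.prod_congr rfl fun e he => by rw [Function.update_of_ne (h e he)]
    simp only [hrest]
    ring

/-- A multi-affine function on a cube is minimised at a vertex. -/
lemma MultiAffine.exists_le [Fintype ι] {Φ : (ι → ℝ) → ℝ} (hΦ : MultiAffine Φ) {p : ι → ℝ}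
    (hp : ∀ i, p i ∈ Set.Icc (0 : ℝ) 1) :
    ∃ a : ι → ℝ, (∀ i, a i = 0 ∨ a i = 1) ∧ Φ a ≤ Φ p := by
  have key : ∀ s : Finset ι, ∃ a : ι → ℝ, (∀ i ∈ s, a i = 0 ∨ a i = 1) ∧
      (∀ i ∉ s, a i = p i) ∧ Φ a ≤ Φ p := by
    intro s
    induction s using Finset.induction_on with
    | empty => exact ⟨p, by simp, fun _ _ => rfl, le_rfl⟩
    | insert i s hi ih =>
      obtain ⟨a, ha1, ha2, ha3⟩ := ih
      have hai : a i ∈ Set.Icc (0 : ℝ) 1 := ha2 i hi ▸ hp i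
      have haff := hΦ a i (a i)
      rw [Function.update_eq_self] at haff
      have hex : ∃ t : ℝ, (t = 0 ∨ t = 1) ∧ Φ (Function.update a i t) ≤ Φ a := by
        by_contra! hcon
        have h0 := hcon 0 (Or.inl rfl)
        have h1 := hcon 1 (Or.inr rfl)
        rcases eq_or_lt_of_le hai.1 with h | h
        · rw [← h] at haff; linarith
        · nlinarith [mul_lt_mul_of_pos_left h1 h,
            mul_le_mul_of_nonneg_left h0.le (sub_nonneg.2 hai.2)]
      obtain ⟨t, ht, htΦ⟩ := hex
      refine ⟨Function.update a i t, fun j hj => ?_, fun j hj => ?_, htΦ.trans ha3⟩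
      · by_cases hji : j = i
        · subst hji; rwa [Function.update_self]
        · rw [Function.update_of_ne hji]
          exact ha1 j ((Finset.mem_insert.1 hj).resolve_left hji)
      · rw [Finset.mem_insert, not_or] at hj
        rw [Function.update_of_ne hj.1]
        exact ha2 j hj.2
  obtain ⟨a, ha, -, h⟩ := key Finset.univ
  exact ⟨a, fun i => ha i (Finset.mem_univ i), h⟩

/-- A symmetric matrix with entries in `[0,1]` is close in cut norm to the adjacency matrix of a
graph. -/
lemma exists_graph_cutLe {N : ℕ} [NeZero N] {M : Fin N → Fin N → ℝ}
    (hsymm : ∀ a b, M a b = M b a) (hM : ∀ a b, M a b ∈ Set.Icc (0 : ℝ) 1) :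
    ∃ G : SimpleGraph (Fin N), ∀ c : ℝ, 0 ≤ c → 16 / (N : ℝ) ≤ c ^ 4 →
      CutLe unitMeasure (fun x y => stepKer (adjR G) x y - stepKer M x y) c := by
  classical
  have hN := cast_pos_of_neZero N
  set I := Finset.univ.filter fun v : Fin 4 → Fin N => Function.Injective v with hI
  set Φ : (Sym2 (Fin N) → ℝ) → ℝ := fun a =>
    ∑ v ∈ I, ∏ e ∈ cycleEdges, (a s(v e.1, v e.2) - M (v e.1) (v e.2)) with hΦ
  have haff : MultiAffine Φ := by
    refine MultiAffine.sum fun v hv => multiAffine_prod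
      (k := fun e : Fin 4 × Fin 4 => s(v e.1, v e.2)) ?_ _
    have hinj : Function.Injective v := (Finset.mem_filter.1 hv).2
    intro e he e' he' h
    have h1 := cycleEdges_lt e he
    have h2 := cycleEdges_lt e' he'
    simp only [Sym2.eq_iff] at h
    rcases h with h | h
    · exact Prod.ext (hinj h.1) (hinj h.2)
    · have h3 := hinj h.1
      have h4 := hinj h.2
      rw [h3, h4] at h1
      exact absurd h1 (not_lt.2 h2.le)
  obtain ⟨a, ha, hle⟩ := haff.exists_le (p := Sym2.lift ⟨M, hsymm⟩)
    (fun z => by induction z using Sym2.ind with | _ x y => exact hM x y)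
  have hzero : Φ (Sym2.lift ⟨M, hsymm⟩) = 0 := by
    refine Finset.sum_eq_zero fun v _ => Finset.prod_eq_zero (i := ((0 : Fin 4), (2 : Fin 4)))
      (by decide) ?_
    simp
  rw [hzero] at hle
  let G : SimpleGraph (Fin N) :=
    { Adj := fun x y => x ≠ y ∧ a s(x, y) = 1
      symm := ⟨fun x y h => ⟨h.1.symm, Sym2.eq_swap ▸ h.2⟩⟩
      loopless := ⟨fun x h => h.1 rfl⟩ }
  have hadj : ∀ x y, x ≠ y → adjR G x y = a s(x, y) := by
    intro x y hxy
    rcases ha s(x, y) with h | h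
    · rw [h]; exact if_neg fun h' => by have := h'.2; rw [h] at this; norm_num at this
    · rw [h]; exact if_pos ⟨hxy, h⟩
  refine ⟨G, fun c hc hNc => ?_⟩
  set B : Fin N → Fin N → ℝ := fun x y => adjR G x y - M x y with hB
  have hB1 : ∀ x y, |B x y| ≤ 1 := fun x y => by
    have h1 := adjR_mem G x y
    have h2 := hM x y
    exact abs_le.2 ⟨by linarith [h1.1, h2.2], by linarith [h1.2, h2.1]⟩
  have hsum : cycleSum B ≤ 16 * (N : ℝ) ^ 3 := by
    rw [cycleSum, ← Finset.sum_filter_add_sum_filter_not _ (fun v => Function.Injective v)]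
    have h1 : ∑ v ∈ I, ∏ e ∈ cycleEdges, B (v e.1) (v e.2) = Φ a := by
      refine Finset.sum_congr rfl fun v hv => Finset.prod_congr rfl fun e he => ?_
      have hinj : Function.Injective v := (Finset.mem_filter.1 hv).2
      rw [hB]
      simp only
      rw [hadj _ _ fun h => (cycleEdges_lt e he).ne (hinj h)]
    have h2 : ∑ v ∈ Finset.univ.filter (fun v : Fin 4 → Fin N => ¬ Function.Injective v),
        ∏ e ∈ cycleEdges, B (v e.1) (v e.2) ≤
        (Finset.univ.filter fun v : Fin 4 → Fin N => ¬ Function.Injective v).card := by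
      rw [Finset.card_eq_sum_ones]
      push_cast
      refine Finset.sum_le_sum fun v _ => (le_abs_self _).trans ?_
      rw [Finset.abs_prod]
      exact Finset.prod_le_one (fun _ _ => abs_nonneg _) fun _ _ => hB1 _ _
    have h3 : ((Finset.univ.filter fun v : Fin 4 → Fin N => ¬ Function.Injective v).card : ℝ) * N
        ≤ 16 * (N : ℝ) ^ 4 := by
      have := card_not_injective_mul_le 4 N
      exact_mod_cast this
    have h4 : ((Finset.univ.filter fun v : Fin 4 → Fin N => ¬ Function.Injective v).card : ℝ)
        ≤ 16 * (N : ℝ) ^ 3 := by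
      refine le_of_mul_le_mul_right ?_ hN
      calc _ ≤ _ := h3
        _ = _ := by ring
    rw [h1]
    linarith
  refine cutLe_of_cycleSum_le (B := B) hc (le_trans ?_ hNc)
  rw [div_le_div_iff₀ (by positivity) hN]
  calc cycleSum B * N ≤ 16 * (N : ℝ) ^ 3 * N := mul_le_mul_of_nonneg_right hsum hN.le
    _ = _ := by ring

end Rounding

section Sampling

lemma CutLe.mono {Ω : Type*} [MeasurableSpace Ω] {μ : Measure Ω} {D : Ω → Ω → ℝ} {c c' : ℝ}
    (h : CutLe μ D c) (hc : c ≤ c') : CutLe μ D c' :=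
  fun f g hf hg hf' hg' => (h f g hf hg hf' hg').trans hc

lemma CutLe.add {D E : ℝ → ℝ → ℝ} {c c' : ℝ}
    (hD : CutLe unitMeasure D c) (hE : CutLe unitMeasure E c')
    (hDm : Measurable (Function.uncurry D)) (hEm : Measurable (Function.uncurry E))
    (hDb : ∀ x y, |D x y| ≤ 1) (hEb : ∀ x y, |E x y| ≤ 1) :
    CutLe unitMeasure (fun x y => D x y + E x y) (c + c') := by
  intro f g hf hg hf' hg'
  have hb : ∀ {D : ℝ → ℝ → ℝ}, (∀ x y, |D x y| ≤ 1) → ∀ z : ℝ × ℝ,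
      |D z.1 z.2 * f z.1 * g z.2| ≤ 1 := fun h z => by
    rw [abs_mul, abs_mul, abs_of_nonneg (hf' _).1, abs_of_nonneg (hg' _).1]
    exact mul_le_one₀ (mul_le_one₀ (h _ _) (hf' _).1 (hf' _).2) (hg' _).1 (hg' _).2
  have hm : ∀ {D : ℝ → ℝ → ℝ}, Measurable (Function.uncurry D) →
      Measurable fun z : ℝ × ℝ => D z.1 z.2 * f z.1 * g z.2 := fun h =>
    ((h : Measurable fun z : ℝ × ℝ => _).mul (hf.comp measurable_fst)).mul
      (hg.comp measurable_snd)
  simp only [add_mul]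
  rw [integral_add (integrable_of_Icc (hm hDm) 1 (hb hDb)) (integrable_of_Icc (hm hEm) 1 (hb hEb))]
  exact (abs_add_le _ _).trans (add_le_add (hD f g hf hg hf' hg') (hE f g hf hg hf' hg'))

lemma cutLe_integral_abs {D : ℝ → ℝ → ℝ} (hDm : Measurable (Function.uncurry D))
    (hDb : ∀ x y, |D x y| ≤ 1) :
    CutLe unitMeasure D (∫ z, |D z.1 z.2| ∂(unitMeasure.prod unitMeasure)) := by
  intro f g hf hg hf' hg'
  have hm : Measurable fun z : ℝ × ℝ => D z.1 z.2 := hDm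
  refine abs_integral_le_integral_abs.trans (integral_mono_of_nonneg
    (Eventually.of_forall fun _ => abs_nonneg _)
    (integrable_of_Icc hm.abs 1 fun z => by rw [abs_abs]; exact hDb _ _)
    (Eventually.of_forall fun z => ?_))
  simp only
  rw [abs_mul, abs_mul, abs_of_nonneg (hf' _).1, abs_of_nonneg (hg' _).1, mul_assoc]
  exact mul_le_of_le_one_right (abs_nonneg _) (mul_le_one₀ (hf' _).2 (hg' _).1 (hg' _).2)

/-- Every graphon is the cut-norm limit of a graph sequence. -/
lemma exists_graph_tendsto {W : ℝ → ℝ → ℝ} (hW : IsGraphon W) {V : ℕ → ℕ}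
    [∀ n, NeZero (V n)] (hV : Tendsto V atTop atTop) :
    ∃ G : ∀ n, SimpleGraph (Fin (V n)), ∀ c : ℝ, 0 < c →
      ∀ᶠ n in atTop, CutLe unitMeasure (fun x y => stepKer (adjR (G n)) x y - W x y) c := by
  obtain ⟨hWm, hWs, hWb⟩ := hW
  have hVr : Tendsto (fun n => (V n : ℝ)) atTop atTop := tendsto_natCast_atTop_atTop.comp hV
  have hloc : LocallyIntegrable (Function.uncurry W) (volume : Measure (ℝ × ℝ)) := by
    refine (locallyIntegrable_const (1 : ℝ)).mono hWm.aestronglyMeasurable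
      (Eventually.of_forall fun z => ?_)
    rw [norm_one, Real.norm_eq_abs]
    exact abs_le.2 ⟨(by linarith [(hWb z.1 z.2).1] : -1 ≤ W z.1 z.2), (hWb z.1 z.2).2⟩
  set M : ∀ n, Fin (V n) → Fin (V n) → ℝ := fun n a b =>
    ⨍ z in Metric.closedBall (cellCenter a, cellCenter b) (1 / (2 * (V n : ℝ))),
      Function.uncurry W z with hMdef
  have hr : ∀ n, 0 < 1 / (2 * (V n : ℝ)) := fun n => by
    have := cast_pos_of_neZero (V n); positivity
  have hMs : ∀ n a b, M n a b = M n b a := by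
    intro n a b
    have hmp : MeasurePreserving (Prod.swap : ℝ × ℝ → ℝ × ℝ)
        (volume : Measure (ℝ × ℝ)) (volume : Measure (ℝ × ℝ)) := Measure.measurePreserving_swap
    have hemb : MeasurableEmbedding (Prod.swap : ℝ × ℝ → ℝ × ℝ) :=
      MeasurableEquiv.prodComm.measurableEmbedding
    have hpre : Prod.swap ⁻¹' Metric.closedBall ((cellCenter a, cellCenter b) : ℝ × ℝ)
        (1 / (2 * (V n : ℝ))) = Metric.closedBall ((cellCenter b, cellCenter a) : ℝ × ℝ)
        (1 / (2 * (V n : ℝ))) := by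
      ext z
      simp [Prod.dist_eq, max_comm, Metric.mem_closedBall]
    have h1 := hmp.setIntegral_preimage_emb hemb (Function.uncurry W)
      (Metric.closedBall (cellCenter a, cellCenter b) (1 / (2 * (V n : ℝ))))
    have h2 := hmp.measureReal_preimage
      (s := Metric.closedBall (cellCenter a, cellCenter b) (1 / (2 * (V n : ℝ))))
      Metric.isClosed_closedBall.measurableSet.nullMeasurableSet
    rw [hpre] at h1 h2
    simp only [hMdef, setAverage_eq]
    rw [← h1, ← h2]
    congr 2
    ext z
    exact hWs _ _
  have hMb : ∀ n a b, M n a b ∈ Set.Icc (0 : ℝ) 1 := by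
    intro n a b
    have hI : IntegrableOn (Function.uncurry W) (Metric.closedBall
        ((cellCenter a, cellCenter b) : ℝ × ℝ) (1 / (2 * (V n : ℝ)))) :=
      hloc.integrableOn_isCompact (isCompact_closedBall _ _)
    simp only [hMdef]
    have h0 : (volume : Measure (ℝ × ℝ)) (Metric.closedBall
        ((cellCenter a, cellCenter b) : ℝ × ℝ) (1 / (2 * (V n : ℝ)))) ≠ 0 :=
      (Metric.measure_closedBall_pos _ _ (hr n)).ne'
    exact (convex_Icc (0 : ℝ) 1).set_average_mem isClosed_Icc h0
      (isCompact_closedBall _ _).measure_lt_top.ne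
      (Eventually.of_forall fun z => hWb z.1 z.2) hI
  choose G hG using fun n => exists_graph_cutLe (hMs n) (hMb n)
  refine ⟨G, fun c hc => ?_⟩
  have hL1 : Tendsto (fun n => ∫ z, |stepKer (M n) z.1 z.2 - W z.1 z.2|
      ∂(unitMeasure.prod unitMeasure)) atTop (nhds 0) := by
    have key := tendsto_integral_of_dominated_convergence (μ := unitMeasure.prod unitMeasure)
      (F := fun n z => |stepKer (M n) z.1 z.2 - W z.1 z.2|) (f := fun _ => 0)
      (fun _ => 1) (fun n => ?_) (integrable_const 1) ?_ ?_
    · simpa using key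
    · exact (((measurable_stepKer (M n)).sub hWm).abs :
        Measurable fun z : ℝ × ℝ => |stepKer (M n) z.1 z.2 - W z.1 z.2|).aestronglyMeasurable
    · intro n
      refine Eventually.of_forall fun z => ?_
      rw [Real.norm_eq_abs, abs_abs]
      have h1 := hMb n (cell (V n) z.1) (cell (V n) z.2)
      have h2 := hWb z.1 z.2
      exact abs_le.2 ⟨by rw [stepKer]; linarith [h1.1, h2.2], by rw [stepKer]; linarith [h1.2, h2.1]⟩
    · filter_upwards [ae_tendsto_cellAverage_prod hV hloc] with z hz
      have := (hz.sub_const (Function.uncurry W z)).abs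
      rw [sub_self, abs_zero] at this
      exact this
  have h16 : Tendsto (fun n => 16 / (V n : ℝ)) atTop (nhds 0) := tendsto_const_nhds.div_atTop hVr
  filter_upwards [hL1.eventually_le_const (by positivity : 0 < c / 2),
    h16.eventually_le_const (by positivity : 0 < (c / 2) ^ 4)] with n hn1 hn2
  have h1 := hG n (c / 2) (by positivity) hn2
  have hab : ∀ {u v : ℝ}, u ∈ Set.Icc (0 : ℝ) 1 → v ∈ Set.Icc (0 : ℝ) 1 → |u - v| ≤ 1 :=
    fun hu hv => abs_le.2 ⟨by linarith [hu.1, hv.2], by linarith [hu.2, hv.1]⟩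
  have hm2 : Measurable (Function.uncurry fun x y => stepKer (M n) x y - W x y) :=
    (measurable_stepKer (M n)).sub hWm
  have hm1 : Measurable (Function.uncurry fun x y => stepKer (adjR (G n)) x y - stepKer (M n) x y) :=
    (measurable_stepKer _).sub (measurable_stepKer _)
  have hb2 : ∀ x y, |stepKer (M n) x y - W x y| ≤ 1 := fun x y => hab (hMb n _ _) (hWb x y)
  have h2 := (cutLe_integral_abs hm2 hb2).mono hn1
  have h3 := h1.add h2 hm1 hm2 (fun x y => hab (adjR_mem _ _ _) (hMb n _ _)) hb2
  simp only [sub_add_sub_cancel, add_halves] at h3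
  exact h3

end Sampling

section FiberAverage

variable {Ω L : Type*} [Fintype Ω] [DecidableEq L]

/-- The average of `A` over the fibre of `l` above `c`. -/
noncomputable def fiberAvg (l : Ω → L) (A : Ω → ℝ) (c : L) : ℝ :=
  (∑ z, if l z = c then A z else 0) / ((Finset.univ.filter fun z => l z = c).card : ℝ)

lemma fiberAvg_mem (l : Ω → L) {A : Ω → ℝ} (hA : ∀ z, A z ∈ Set.Icc (0 : ℝ) 1) (c : L) :
    fiberAvg l A c ∈ Set.Icc (0 : ℝ) 1 := by
  rw [fiberAvg]
  refine ⟨div_nonneg (Finset.sum_nonneg fun z _ => ?_) (Nat.cast_nonneg _),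
    div_le_one_of_le₀ ?_ (Nat.cast_nonneg _)⟩
  · split_ifs
    exacts [(hA z).1, le_rfl]
  · rw [Finset.card_filter]
    push_cast
    refine Finset.sum_le_sum fun z _ => ?_
    split_ifs
    exacts [(hA z).2, le_rfl]

lemma fiberAvg_comp_equiv (e : Ω ≃ Ω) (l : Ω → L) (A : Ω → ℝ) :
    fiberAvg (fun z => l (e z)) (fun z => A (e z)) = fiberAvg l A := by
  funext c
  simp only [fiberAvg, Finset.card_filter]
  push_cast
  rw [Equiv.sum_comp e fun z => if l z = c then A z else 0,
    Equiv.sum_comp e fun z => if l z = c then (1 : ℝ) else 0]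

lemma sum_fiberAvg_mul (l : Ω → L) (A : Ω → ℝ) (ψ : L → ℝ) :
    ∑ z, fiberAvg l A (l z) * ψ (l z) = ∑ z, A z * ψ (l z) := by
  have h1 : ∀ z, fiberAvg l A (l z) * ψ (l z) = ∑ z', if l z' = l z then
      A z' * (ψ (l z') / ((Finset.univ.filter fun y => l y = l z').card : ℝ)) else 0 := by
    intro z
    rw [fiberAvg, div_mul_eq_mul_div, mul_div_assoc, Finset.sum_mul]
    refine Finset.sum_congr rfl fun z' _ => ?_
    by_cases h : l z' = l z
    · simp [h]
    · simp [h]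
  simp only [h1]
  rw [Finset.sum_comm]
  refine Finset.sum_congr rfl fun z' _ => ?_
  rw [← Finset.sum_filter, Finset.sum_const, nsmul_eq_mul]
  have h2 : (Finset.univ.filter fun z => l z' = l z) = Finset.univ.filter fun y => l y = l z' := by
    ext; simp [eq_comm]
  have h3 : ((Finset.univ.filter fun y => l y = l z').card : ℝ) ≠ 0 := by
    have : 0 < (Finset.univ.filter fun y => l y = l z').card :=
      Finset.card_pos.2 ⟨z', Finset.mem_filter.2 ⟨Finset.mem_univ _, rfl⟩⟩
    positivity
  rw [h2]
  field_simp

variable {L' : Type*} [DecidableEq L']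

lemma sum_sq_fiberAvg_sub {l' : Ω → L'} {l : Ω → L} {π : L' → L} (h : ∀ z, l z = π (l' z))
    (A : Ω → ℝ) :
    ∑ z, (fiberAvg l' A (l' z) - fiberAvg l A (l z)) ^ 2
      = ∑ z, fiberAvg l' A (l' z) ^ 2 - ∑ z, fiberAvg l A (l z) ^ 2 := by
  have h1 := sum_fiberAvg_mul l' A fun c => fiberAvg l A (π c)
  have h2 := sum_fiberAvg_mul l A fun c => fiberAvg l A c
  simp only [← h] at h1
  have h3 : ∑ z, (fiberAvg l' A (l' z) - fiberAvg l A (l z)) ^ 2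
      = ∑ z, fiberAvg l' A (l' z) ^ 2 - 2 * ∑ z, fiberAvg l' A (l' z) * fiberAvg l A (l z)
        + ∑ z, fiberAvg l A (l z) * fiberAvg l A (l z) := by
    rw [Finset.mul_sum, ← Finset.sum_sub_distrib, ← Finset.sum_add_distrib]
    exact Finset.sum_congr rfl fun z _ => by ring
  have h4 : ∑ z, fiberAvg l A (l z) ^ 2 = ∑ z, fiberAvg l A (l z) * fiberAvg l A (l z) :=
    Finset.sum_congr rfl fun z _ => sq _
  rw [h3, h4, h1, h2]
  ring

lemma sq_sum_sub_fiberAvg_mul_le {l' : Ω → L'} {l : Ω → L} {π : L' → L}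
    (h : ∀ z, l z = π (l' z)) (A : Ω → ℝ) {ψ : L' → ℝ} (hψ : ∀ c, |ψ c| ≤ 1) :
    (∑ z, (A z - fiberAvg l A (l z)) * ψ (l' z)) ^ 2
      ≤ Fintype.card Ω *
        (∑ z, fiberAvg l' A (l' z) ^ 2 - ∑ z, fiberAvg l A (l z) ^ 2) := by
  have h1 : ∑ z, (A z - fiberAvg l A (l z)) * ψ (l' z)
      = ∑ z, (fiberAvg l' A (l' z) - fiberAvg l A (l z)) * ψ (l' z) := by
    simp only [sub_mul, Finset.sum_sub_distrib, sum_fiberAvg_mul]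
  rw [h1, ← sum_sq_fiberAvg_sub h]
  refine (Finset.sum_mul_sq_le_sq_mul_sq _ _ _).trans ?_
  rw [mul_comm]
  refine mul_le_mul_of_nonneg_right ?_ (Finset.sum_nonneg fun _ _ => sq_nonneg _)
  calc ∑ z, ψ (l' z) ^ 2 ≤ ∑ _z : Ω, (1 : ℝ) :=
        Finset.sum_le_sum fun z _ => (sq_le_one_iff_abs_le_one _).2 (hψ _)
    _ = _ := by simp

end FiberAverage

section Refinement

variable {N : ℕ}

/-- The average of the matrix `A` over the blocks of the labelling `κ` of its indices. -/
noncomputable def blockAvg (κ : Fin N → ℕ) (A : Fin N → Fin N → ℝ) (a b : ℕ) : ℝ :=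
  fiberAvg (fun z : Fin N × Fin N => (κ z.1, κ z.2)) (fun z => A z.1 z.2) (a, b)

/-- The energy of the matrix `A` with respect to the labelling `κ`. -/
noncomputable def blockEnergy (κ : Fin N → ℕ) (A : Fin N → Fin N → ℝ) : ℝ :=
  (∑ x, ∑ y, blockAvg κ A (κ x) (κ y) ^ 2) / (N : ℝ) ^ 2

lemma blockAvg_mem (κ : Fin N → ℕ) {A : Fin N → Fin N → ℝ}
    (hA : ∀ x y, A x y ∈ Set.Icc (0 : ℝ) 1) (a b : ℕ) : blockAvg κ A a b ∈ Set.Icc (0 : ℝ) 1 :=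
  fiberAvg_mem _ (fun _ => hA _ _) _

lemma blockAvg_comm (κ : Fin N → ℕ) {A : Fin N → Fin N → ℝ} (hA : ∀ x y, A x y = A y x)
    (a b : ℕ) : blockAvg κ A a b = blockAvg κ A b a := by
  simp only [blockAvg, fiberAvg, Finset.card_filter]
  push_cast
  rw [← Equiv.sum_comp (Equiv.prodComm (Fin N) (Fin N)),
    ← Equiv.sum_comp (Equiv.prodComm (Fin N) (Fin N))
      fun z => if (κ z.1, κ z.2) = (a, b) then (1 : ℝ) else 0]
  congr 1
  · refine Finset.sum_congr rfl fun z _ => ?_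
    simp only [Equiv.prodComm_apply, Prod.fst_swap, Prod.snd_swap, Prod.mk.injEq]
    rw [hA]
    exact if_congr and_comm rfl rfl
  · refine Finset.sum_congr rfl fun z _ => ?_
    simp only [Equiv.prodComm_apply, Prod.fst_swap, Prod.snd_swap, Prod.mk.injEq]
    exact if_congr and_comm rfl rfl

lemma blockAvg_comp_perm (σ : Equiv.Perm (Fin N)) (κ : Fin N → ℕ) (A : Fin N → Fin N → ℝ) :
    blockAvg (fun x => κ (σ x)) (fun x y => A (σ x) (σ y)) = blockAvg κ A := by
  funext a b
  exact congrFun (fiberAvg_comp_equiv (Equiv.prodCongr σ σ)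
    (fun z : Fin N × Fin N => (κ z.1, κ z.2)) (fun z => A z.1 z.2)) (a, b)

lemma sum_comp_perm₂ (σ : Equiv.Perm (Fin N)) (f : Fin N → Fin N → ℝ) :
    ∑ x, ∑ y, f (σ x) (σ y) = ∑ x, ∑ y, f x y := by
  rw [← Equiv.sum_comp σ fun x => ∑ y, f x y]
  exact Finset.sum_congr rfl fun x _ => Equiv.sum_comp σ fun y => f (σ x) y

lemma blockEnergy_comp_perm (σ : Equiv.Perm (Fin N)) (κ : Fin N → ℕ) (A : Fin N → Fin N → ℝ) :
    blockEnergy (fun x => κ (σ x)) (fun x y => A (σ x) (σ y)) = blockEnergy κ A := by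
  rw [blockEnergy, blockEnergy, blockAvg_comp_perm,
    sum_comp_perm₂ σ fun x y => blockAvg κ A (κ x) (κ y) ^ 2]

lemma sum_sq_blockAvg_sub {κ' κ : Fin N → ℕ} {π : ℕ → ℕ} (h : ∀ x, κ x = π (κ' x))
    (A : Fin N → Fin N → ℝ) :
    (∑ x, ∑ y, (blockAvg κ' A (κ' x) (κ' y) - blockAvg κ A (κ x) (κ y)) ^ 2) / (N : ℝ) ^ 2
      = blockEnergy κ' A - blockEnergy κ A := by
  have := sum_sq_fiberAvg_sub (l' := fun z : Fin N × Fin N => (κ' z.1, κ' z.2))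
    (l := fun z : Fin N × Fin N => (κ z.1, κ z.2)) (π := Prod.map π π)
    (fun z => by simp [h]) (fun z => A z.1 z.2)
  simp only [Fintype.sum_prod_type] at this
  rw [blockEnergy, blockEnergy, ← sub_div]
  exact congrArg (· / (N : ℝ) ^ 2) this

lemma blockEnergy_le {κ' κ : Fin N → ℕ} {π : ℕ → ℕ} (h : ∀ x, κ x = π (κ' x))
    (A : Fin N → Fin N → ℝ) : blockEnergy κ A ≤ blockEnergy κ' A := by
  rw [← sub_nonneg, ← sum_sq_blockAvg_sub h]
  positivity

lemma multiAffine_bilin (D : Fin N → Fin N → ℝ) :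
    MultiAffine fun a : Fin N ⊕ Fin N → ℝ =>
      ∑ x, ∑ y, D x y * a (Sum.inl x) * a (Sum.inr y) := by
  refine MultiAffine.sum fun x _ => MultiAffine.sum fun y _ => ?_
  intro a i t
  rcases i with i | i
  · by_cases h : x = i
    · subst h; simp; ring
    · simp [Function.update, h]; ring
  · by_cases h : y = i
    · subst h; simp; ring
    · simp [Function.update, h]; ring

/-- A bilinear form on `[0,1]`-valued vectors is bounded by its maximum on indicator vectors. -/
lemma abs_bilin_le_of_indicator {D : Fin N → Fin N → ℝ} {C : ℝ}
    (h : ∀ S T : Finset (Fin N), |∑ x, ∑ y, D x y * (if x ∈ S then 1 else 0)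
      * (if y ∈ T then 1 else 0)| ≤ C)
    {f g : Fin N → ℝ} (hf : ∀ x, f x ∈ Set.Icc (0 : ℝ) 1) (hg : ∀ x, g x ∈ Set.Icc (0 : ℝ) 1) :
    |∑ x, ∑ y, D x y * f x * g y| ≤ C := by
  classical
  have key : ∀ D : Fin N → Fin N → ℝ, (∀ S T : Finset (Fin N),
      |∑ x, ∑ y, D x y * (if x ∈ S then 1 else 0) * (if y ∈ T then 1 else 0)| ≤ C) →
      -C ≤ ∑ x, ∑ y, D x y * f x * g y := by
    intro D h
    obtain ⟨a, ha, hle⟩ := (multiAffine_bilin D).exists_le (p := Sum.elim f g) (by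
      rintro (x | x)
      exacts [hf x, hg x])
    simp only [Sum.elim_inl, Sum.elim_inr] at hle
    have h1 := h (Finset.univ.filter fun x => a (Sum.inl x) = 1)
      (Finset.univ.filter fun x => a (Sum.inr x) = 1)
    have h2 : ∀ i, a i = if a i = 1 then 1 else 0 := fun i => by
      rcases ha i with h | h <;> simp [h]
    simp only [Finset.mem_filter, Finset.mem_univ, true_and, ← h2] at h1
    exact (abs_le.1 h1).1.trans hle
  refine abs_le.2 ⟨key D h, ?_⟩
  have := key (fun x y => - D x y) fun S T => by
    simp only [neg_mul, Finset.sum_neg_distrib, abs_neg]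
    exact h S T
  simp only [neg_mul, Finset.sum_neg_distrib] at this
  linarith

/-- A labelling can be refined, splitting every block into four, so that the increase in energy
controls the cut distance from the matrix to its block averages. -/
lemma exists_refinement [NeZero N] (A : Fin N → Fin N → ℝ) (κ : Fin N → ℕ) :
    ∃ κ' : Fin N → ℕ, (∀ x, κ' x / 4 = κ x) ∧
      ∀ f g : Fin N → ℝ, (∀ x, f x ∈ Set.Icc (0 : ℝ) 1) → (∀ x, g x ∈ Set.Icc (0 : ℝ) 1) →
        |∑ x, ∑ y, (A x y - blockAvg κ A (κ x) (κ y)) * f x * g y|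
          ≤ Real.sqrt (blockEnergy κ' A - blockEnergy κ A) * (N : ℝ) ^ 2 := by
  classical
  have hN := cast_pos_of_neZero N
  obtain ⟨⟨S, T⟩, hmax⟩ := Finite.exists_max fun P : Finset (Fin N) × Finset (Fin N) =>
    |∑ x, ∑ y, (A x y - blockAvg κ A (κ x) (κ y)) * (if x ∈ P.1 then 1 else 0)
      * (if y ∈ P.2 then 1 else 0)|
  set κ' : Fin N → ℕ := fun x =>
    4 * κ x + (2 * (if x ∈ S then 1 else 0) + if x ∈ T then 1 else 0) with hκ'
  have hdiv : ∀ x, κ' x / 4 = κ x := fun x => by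
    simp only [hκ']; split_ifs <;> omega
  refine ⟨κ', hdiv, fun f g hf hg => ?_⟩
  refine (abs_bilin_le_of_indicator (fun S' T' => hmax (S', T')) hf hg).trans ?_
  have hS : ∀ x, (if κ' x / 2 % 2 = 1 then (1 : ℝ) else 0) = if x ∈ S then 1 else 0 := fun x => by
    have : κ' x / 2 % 2 = 1 ↔ x ∈ S := by
      by_cases h1 : x ∈ S <;> by_cases h2 : x ∈ T <;> simp only [hκ', h1, h2, if_true, if_false,
        iff_true, iff_false] <;> omega
    simp only [this]
  have hT : ∀ x, (if κ' x % 2 = 1 then (1 : ℝ) else 0) = if x ∈ T then 1 else 0 := fun x => by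
    have : κ' x % 2 = 1 ↔ x ∈ T := by
      by_cases h1 : x ∈ S <;> by_cases h2 : x ∈ T <;> simp only [hκ', h1, h2, if_true, if_false,
        iff_true, iff_false] <;> omega
    simp only [this]
  have key := sq_sum_sub_fiberAvg_mul_le (l' := fun z : Fin N × Fin N => (κ' z.1, κ' z.2))
    (l := fun z : Fin N × Fin N => (κ z.1, κ z.2)) (π := Prod.map (· / 4) (· / 4))
    (fun z => by simp [hdiv]) (fun z => A z.1 z.2)
    (ψ := fun c => (if c.1 / 2 % 2 = 1 then 1 else 0) * (if c.2 % 2 = 1 then 1 else 0))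
    (fun c => by split_ifs <;> simp)
  simp only [hS, hT, ← mul_assoc, Fintype.sum_prod_type, Fintype.card_prod, Fintype.card_fin,
    Nat.cast_mul] at key
  refine abs_le_of_sq_le_sq ?_ (by positivity)
  refine key.trans ?_
  have hnn : 0 ≤ blockEnergy κ' A - blockEnergy κ A :=
    sub_nonneg.2 (blockEnergy_le (π := (· / 4)) (fun x => (hdiv x).symm) A)
  rw [mul_pow, Real.sq_sqrt hnn, blockEnergy, blockEnergy, ← sub_div]
  refine le_of_eq ?_
  simp only [blockAvg]
  field_simp

/-- Nested labellings of a matrix along which the increase in energy controls the cut distance to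
the block averages, the first `K` of them monotone after a permutation of the indices. -/
lemma exists_sorted_refinements [NeZero N] (A : Fin N → Fin N → ℝ) (K : ℕ) :
    ∃ (σ : Equiv.Perm (Fin N)) (κ : ℕ → Fin N → ℕ),
      (∀ j x, κ j x < 4 ^ j) ∧ (∀ j k, j ≤ k → ∀ x, κ j x = κ k x / 4 ^ (k - j)) ∧
      (∀ j ≤ K, Monotone (κ j)) ∧
      ∀ j, ∀ f g : Fin N → ℝ, (∀ x, f x ∈ Set.Icc (0 : ℝ) 1) → (∀ x, g x ∈ Set.Icc (0 : ℝ) 1) →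
        |∑ x, ∑ y, (A (σ x) (σ y) - blockAvg (κ j) (fun x y => A (σ x) (σ y)) (κ j x) (κ j y))
            * f x * g y|
          ≤ Real.sqrt (blockEnergy (κ (j + 1)) (fun x y => A (σ x) (σ y))
            - blockEnergy (κ j) (fun x y => A (σ x) (σ y))) * (N : ℝ) ^ 2 := by
  choose R hR1 hR2 using exists_refinement A
  let κ : ℕ → Fin N → ℕ := fun j => Nat.rec (fun _ => 0) (fun _ k => R k) j
  have hκs : ∀ j, κ (j + 1) = R (κ j) := fun j => rfl
  have hlt : ∀ j x, κ j x < 4 ^ j := by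
    intro j
    induction j with
    | zero => intro x; exact Nat.one_pos
    | succ j ih =>
      intro x
      have h1 := hR1 (κ j) x
      have h2 := ih x
      rw [hκs, pow_succ]
      omega
  have hdiv : ∀ j k, j ≤ k → ∀ x, κ j x = κ k x / 4 ^ (k - j) := by
    intro j k hjk x
    induction k, hjk using Nat.le_induction with
    | base => simp
    | succ k hjk ih =>
      rw [ih, hκs, ← hR1 (κ k) x, Nat.div_div_eq_div_mul, Nat.succ_sub hjk, pow_succ']
  set σ := Tuple.sort (κ K)
  refine ⟨σ, fun j x => κ j (σ x), fun j x => hlt j _, fun j k hjk x => hdiv j k hjk _,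
    fun j hj x y hxy => ?_, fun j f g hf hg => ?_⟩
  · simp only
    rw [hdiv j K hj, hdiv j K hj]
    exact Nat.div_le_div_right (Tuple.monotone_sort (κ K) hxy)
  · rw [blockEnergy_comp_perm, blockEnergy_comp_perm, blockAvg_comp_perm]
    have := hR2 (κ j) (fun x => f (σ.symm x)) (fun x => g (σ.symm x)) (fun x => hf _)
      (fun x => hg _)
    rw [← sum_comp_perm₂ σ] at this
    simpa [hκs] using this

end Refinement

section BoundedLimits

variable {X : Type*} [MeasurableSpace X] {ν : Measure X} [IsProbabilityMeasure ν]

lemma tendsto_integral_of_abs_le_one {F : ℕ → X → ℝ} {f : X → ℝ} (hF : ∀ n, Measurable (F n))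
    (hb : ∀ n x, |F n x| ≤ 1) (h : ∀ᵐ x ∂ν, Tendsto (fun n => F n x) atTop (nhds (f x))) :
    Tendsto (fun n => ∫ x, F n x ∂ν) atTop (nhds (∫ x, f x ∂ν)) :=
  tendsto_integral_of_dominated_convergence (fun _ => 1)
    (fun n => (hF n).aestronglyMeasurable) (integrable_const 1)
    (fun n => Eventually.of_forall fun x => hb n x) h

lemma sq_integral_abs_le {D : X → ℝ} (hD : Measurable D) (hb : ∀ x, |D x| ≤ 1) :
    (∫ x, |D x| ∂ν) ^ 2 ≤ ∫ x, D x ^ 2 ∂ν := by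
  set c := ∫ x, |D x| ∂ν with hc
  have h1 : Integrable (fun x => D x ^ 2) ν := integrable_of_Icc (hD.pow_const 2) 1 fun x => by
    rw [abs_of_nonneg (sq_nonneg _)]; exact (sq_le_one_iff_abs_le_one _).2 (hb x)
  have h2 : Integrable (fun x => 2 * c * |D x|) ν :=
    (integrable_of_Icc hD.abs 1 fun x => by rw [abs_abs]; exact hb x).const_mul _
  have h3 : 0 ≤ ∫ x, (|D x| - c) ^ 2 ∂ν := integral_nonneg fun x => sq_nonneg _
  have h4 : ∫ x, (|D x| - c) ^ 2 ∂ν = ∫ x, D x ^ 2 ∂ν - 2 * c * c + c ^ 2 := by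
    have : ∀ x, (|D x| - c) ^ 2 = D x ^ 2 - 2 * c * |D x| + c ^ 2 := fun x => by
      rw [← sq_abs (D x)]; ring
    simp only [this]
    have h5 : Integrable (fun x => D x ^ 2 - 2 * c * |D x|) ν := h1.sub h2
    rw [integral_add h5 (integrable_const _), integral_sub h1 h2, integral_const_mul, ← hc]
    simp
  nlinarith

end BoundedLimits

section LimitKernel

lemma abs_sub_le_one_of_mem {u v : ℝ} (hu : u ∈ Set.Icc (0 : ℝ) 1) (hv : v ∈ Set.Icc (0 : ℝ) 1) :
    |u - v| ≤ 1 :=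
  abs_le.2 ⟨by linarith [hu.1, hv.2], by linarith [hu.2, hv.1]⟩

lemma IsKer.measurable_sub {W U : ℝ → ℝ → ℝ} (h : IsKer W) (hU : IsKer U) :
    Measurable fun z : ℝ × ℝ => W z.1 z.2 - U z.1 z.2 := h.1.sub hU.1

/-- Kernels with orthogonal increments converge in `L¹` to a graphon. -/
lemma exists_graphon_limit {U : ℕ → ℝ → ℝ → ℝ} (hU : ∀ j, IsKer (U j))
    (hs : ∀ j x y, U j x y = U j y x) {E : ℕ → ℝ} (hE : CauchySeq E)
    (hUE : ∀ k l, k ≤ l → ∫ z, (U l z.1 z.2 - U k z.1 z.2) ^ 2 ∂(unitMeasure.prod unitMeasure)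
      = E l - E k) :
    ∃ W, IsGraphon W ∧ Tendsto (fun j => ∫ z, |U j z.1 z.2 - W z.1 z.2|
      ∂(unitMeasure.prod unitMeasure)) atTop (nhds 0) := by
  set ν := unitMeasure.prod unitMeasure with hν
  have hI : ∀ j, Integrable (fun z : ℝ × ℝ => U j z.1 z.2) ν := fun j =>
    integrable_of_Icc (hU j).1 1 fun z => by
      have := (hU j).2 z.1 z.2
      exact abs_le.2 ⟨by linarith [this.1], this.2⟩
  have hdist : ∀ {f g : ℝ × ℝ → ℝ} (hf : Integrable f ν) (hg : Integrable g ν),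
      dist (hf.toL1 f) (hg.toL1 g) = ∫ z, |f z - g z| ∂ν := by
    intro f g hf hg
    rw [dist_eq_norm, ← Integrable.toL1_sub, L1.norm_of_fun_eq_integral_norm]
    rfl
  have hc : CauchySeq fun j => (hI j).toL1 _ := by
    rw [Metric.cauchySeq_iff']
    intro ε hε
    obtain ⟨n₀, hn₀⟩ := Metric.cauchySeq_iff'.1 hE (ε ^ 2) (by positivity)
    refine ⟨n₀, fun n hn => ?_⟩
    rw [hdist]
    have h1 := sq_integral_abs_le (ν := ν) ((hU n).measurable_sub (hU n₀))
      (fun z => abs_sub_le_one_of_mem ((hU n).2 _ _) ((hU n₀).2 _ _))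
    rw [hUE n₀ n hn] at h1
    have h2 := hn₀ n hn
    rw [Real.dist_eq] at h2
    exact lt_of_pow_lt_pow_left₀ 2 hε.le (h1.trans_lt ((le_abs_self _).trans_lt h2))
  obtain ⟨w, hwm, hwI, hlim⟩ : ∃ w : ℝ × ℝ → ℝ, Measurable w ∧ Integrable w ν ∧
      Tendsto (fun j => ∫ z, |U j z.1 z.2 - w z| ∂ν) atTop (nhds 0) := by
    obtain ⟨w, hw⟩ := cauchySeq_tendsto_of_complete hc
    have hwI := L1.integrable_coeFn w
    refine ⟨w, (Lp.stronglyMeasurable w).measurable, hwI, ?_⟩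
    rw [tendsto_iff_dist_tendsto_zero] at hw
    refine hw.congr fun j => ?_
    conv_lhs => rw [← Integrable.toL1_coeFn w hwI]
    exact hdist _ _
  have hwI' : Integrable (fun z : ℝ × ℝ => w z.swap) ν := by
    rw [hν]; exact Integrable.swap hwI
  have hswap : ∀ j, ∫ z, |U j z.1 z.2 - w z.swap| ∂ν = ∫ z, |U j z.1 z.2 - w z| ∂ν := by
    intro j
    rw [hν, ← integral_prod_swap]
    refine integral_congr_ae (Eventually.of_forall fun z => ?_)
    simp only [Prod.fst_swap, Prod.snd_swap, Prod.swap_swap]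
    rw [hs j]
  refine ⟨fun x y => max 0 (min 1 ((w (x, y) + w (y, x)) / 2)), ⟨?_, fun x y => ?_, fun x y => ?_⟩,
    ?_⟩
  · have h1 : Measurable fun z : ℝ × ℝ => w (z.1, z.2) := hwm
    have h2 : Measurable fun z : ℝ × ℝ => w (z.2, z.1) := hwm.comp measurable_swap
    exact measurable_const.max (measurable_const.min ((h1.add h2).div_const 2))
  · simp only [add_comm]
  · exact ⟨le_max_left _ _, max_le zero_le_one (min_le_left _ _)⟩
  · refine squeeze_zero (fun j => integral_nonneg fun z => abs_nonneg _) (fun j => ?_) hlim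
    have h1 : ∫ z, |U j z.1 z.2 - w z| ∂ν
        = ∫ z, (|U j z.1 z.2 - w z| + |U j z.1 z.2 - w z.swap|) / 2 ∂ν := by
      have i1 : Integrable (fun z : ℝ × ℝ => |U j z.1 z.2 - w z|) ν := ((hI j).sub hwI).abs
      have i2 : Integrable (fun z : ℝ × ℝ => |U j z.1 z.2 - w z.swap|) ν := ((hI j).sub hwI').abs
      rw [integral_div, integral_add i1 i2, hswap]
      ring
    rw [h1]
    refine integral_mono_of_nonneg (Eventually.of_forall fun z => abs_nonneg _)
      ((((hI j).sub hwI).abs.add ((hI j).sub hwI').abs).div_const 2)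
      (Eventually.of_forall fun z => ?_)
    obtain ⟨x, y⟩ := z
    have hu := (hU j).2 x y
    simp only [Prod.swap_prod_mk]
    set u := U j x y
    set s := (w (x, y) + w (y, x)) / 2 with hsdef
    have h2 : |u - max 0 (min 1 s)| ≤ |u - s| := by
      rcases le_total s 0 with h | h
      · rw [min_eq_right (h.trans zero_le_one), max_eq_left h, abs_of_nonneg (by linarith [hu.1]),
          abs_of_nonneg (by linarith [hu.1])]
        linarith
      · rcases le_total 1 s with h' | h'
        · rw [min_eq_left h', max_eq_right zero_le_one, abs_of_nonpos (by linarith [hu.2]),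
            abs_of_nonpos (by linarith [hu.2])]
          linarith
        · rw [min_eq_right h', max_eq_right h]
    have h3 : u - s = ((u - w (x, y)) + (u - w (y, x))) / 2 := by rw [hsdef]; ring
    refine h2.trans ?_
    rw [h3, abs_div, abs_two]
    gcongr
    exact abs_add_le _ _

/-- A sequence of kernels which is approximated in cut norm by martingales converging at every
level has a limit graphon. -/
lemma exists_graphon_cut_limit {Y : ℕ → ℝ → ℝ → ℝ} (hY : ∀ n, IsKer (Y n))
    {T : ℕ → ℕ → ℝ → ℝ → ℝ} (hT : ∀ n j, IsKer (T n j))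
    {U : ℕ → ℝ → ℝ → ℝ} (hU : ∀ j, IsKer (U j)) (hs : ∀ j x y, U j x y = U j y x)
    (hTU : ∀ j, ∀ᵐ z ∂(unitMeasure.prod unitMeasure),
      Tendsto (fun n => T n j z.1 z.2) atTop (nhds (U j z.1 z.2)))
    {e : ℕ → ℕ → ℝ} (he : ∀ n j, ∫ z, T n j z.1 z.2 ^ 2 ∂(unitMeasure.prod unitMeasure) = e n j)
    (hpyth : ∀ n k l, k ≤ l → ∫ z, (T n l z.1 z.2 - T n k z.1 z.2) ^ 2
      ∂(unitMeasure.prod unitMeasure) = e n l - e n k)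
    (hcut : ∀ n j, CutLe unitMeasure (fun x y => Y n x y - T n j x y)
      (Real.sqrt (e n (j + 1) - e n j))) :
    ∃ W, IsGraphon W ∧ ∀ c : ℝ, 0 < c →
      ∀ᶠ n in atTop, CutLe unitMeasure (fun x y => Y n x y - W x y) c := by
  set ν := unitMeasure.prod unitMeasure with hν
  set E : ℕ → ℝ := fun j => ∫ z, U j z.1 z.2 ^ 2 ∂ν with hEdef
  have hsq : ∀ {u : ℝ}, |u| ≤ 1 → |u ^ 2| ≤ 1 := fun h => by
    rw [abs_of_nonneg (sq_nonneg _)]; exact (sq_le_one_iff_abs_le_one _).2 h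
  have hab : ∀ {u : ℝ}, u ∈ Set.Icc (0 : ℝ) 1 → |u| ≤ 1 := fun h =>
    abs_le.2 ⟨by linarith [h.1], h.2⟩
  have hm : ∀ {W : ℝ → ℝ → ℝ}, IsKer W → Measurable fun z : ℝ × ℝ => W z.1 z.2 := fun h => h.1
  have heE : ∀ j, Tendsto (fun n => e n j) atTop (nhds (E j)) := fun j => by
    have := tendsto_integral_of_abs_le_one (ν := ν) (F := fun n z => T n j z.1 z.2 ^ 2)
      (f := fun z => U j z.1 z.2 ^ 2) (fun n => (hm (hT n j)).pow_const 2)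
      (fun n z => hsq (hab ((hT n j).2 _ _)))
      ((hTU j).mono fun z hz => hz.pow 2)
    simpa only [he] using this
  have hUE : ∀ k l, k ≤ l → ∫ z, (U l z.1 z.2 - U k z.1 z.2) ^ 2 ∂ν = E l - E k := by
    intro k l hkl
    have := tendsto_integral_of_abs_le_one (ν := ν)
      (F := fun n z => (T n l z.1 z.2 - T n k z.1 z.2) ^ 2)
      (f := fun z => (U l z.1 z.2 - U k z.1 z.2) ^ 2)
      (fun n => ((hT n l).measurable_sub (hT n k)).pow_const 2)
      (fun n z => hsq (abs_sub_le_one_of_mem ((hT n l).2 _ _) ((hT n k).2 _ _)))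
      (by filter_upwards [hTU l, hTU k] with z h1 h2 using (h1.sub h2).pow 2)
    simp only [hpyth _ k l hkl] at this
    exact tendsto_nhds_unique this ((heE l).sub (heE k))
  have hmono : Monotone E := fun k l hkl => by
    rw [← sub_nonneg, ← hUE k l hkl]
    exact integral_nonneg fun z => sq_nonneg _
  have hbdd : BddAbove (Set.range E) := by
    refine ⟨1, ?_⟩
    rintro _ ⟨j, rfl⟩
    have : E j ≤ ∫ _z, (1 : ℝ) ∂ν := integral_mono_of_nonneg
      (Eventually.of_forall fun z => sq_nonneg _) (integrable_const 1)
      (Eventually.of_forall fun z => (abs_le.1 (hsq (hab ((hU j).2 z.1 z.2)))).2)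
    simpa using this
  have hElim := tendsto_atTop_ciSup hmono hbdd
  obtain ⟨W, hW, hUW⟩ := exists_graphon_limit hU hs hElim.cauchySeq hUE
  have hWk : IsKer W := ⟨hW.1, hW.2.2⟩
  refine ⟨W, hW, fun c hc => ?_⟩
  have hgap : Tendsto (fun j => Real.sqrt (E (j + 1) - E j)) atTop (nhds 0) := by
    have := ((hElim.comp (tendsto_add_atTop_nat 1)).sub hElim).sqrt
    simpa using this
  obtain ⟨j, hj1, hj2⟩ := ((hgap.eventually_lt_const (by positivity : 0 < c / 3)).and
    (hUW.eventually_le_const (by positivity : 0 < c / 3))).exists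
  have h1 : Tendsto (fun n => Real.sqrt (e n (j + 1) - e n j)) atTop
      (nhds (Real.sqrt (E (j + 1) - E j))) := ((heE (j + 1)).sub (heE j)).sqrt
  have h2 : Tendsto (fun n => ∫ z, |T n j z.1 z.2 - U j z.1 z.2| ∂ν) atTop (nhds 0) := by
    have := tendsto_integral_of_abs_le_one (ν := ν)
      (F := fun n z => |T n j z.1 z.2 - U j z.1 z.2|) (f := fun _ => 0)
      (fun n => ((hT n j).measurable_sub (hU j)).abs)
      (fun n z => by
        rw [abs_abs]; exact abs_sub_le_one_of_mem ((hT n j).2 _ _) ((hU j).2 _ _))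
      ((hTU j).mono fun z hz => by
        have := (hz.sub_const (U j z.1 z.2)).abs
        rwa [sub_self, abs_zero] at this)
    simpa using this
  filter_upwards [h1.eventually_lt_const hj1,
    h2.eventually_le_const (by positivity : 0 < c / 3)] with n hn1 hn2
  have c1 := (hcut n j).mono hn1.le
  have c2 := (cutLe_integral_abs (D := fun x y => T n j x y - W x y)
    ((hT n j).measurable_sub hWk)
    fun x y => abs_sub_le_one_of_mem ((hT n j).2 _ _) (hWk.2 _ _)).mono
    (show _ ≤ c / 3 + c / 3 by
      refine le_trans ?_ (add_le_add hn2 hj2)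
      rw [← integral_add]
      · refine integral_mono ?_ ?_ fun z => abs_sub_le _ _ _
        · exact integrable_of_Icc ((hT n j).measurable_sub hWk).abs 1 fun z => by
            rw [abs_abs]; exact abs_sub_le_one_of_mem ((hT n j).2 _ _) (hWk.2 _ _)
        · refine Integrable.add ?_ ?_
          · exact integrable_of_Icc ((hT n j).measurable_sub (hU j)).abs 1 fun z => by
              rw [abs_abs]; exact abs_sub_le_one_of_mem ((hT n j).2 _ _) ((hU j).2 _ _)
          · exact integrable_of_Icc ((hU j).measurable_sub hWk).abs 1 fun z => by
              rw [abs_abs]; exact abs_sub_le_one_of_mem ((hU j).2 _ _) (hWk.2 _ _)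
      · exact integrable_of_Icc ((hT n j).measurable_sub (hU j)).abs 1 fun z => by
          rw [abs_abs]; exact abs_sub_le_one_of_mem ((hT n j).2 _ _) ((hU j).2 _ _)
      · exact integrable_of_Icc ((hU j).measurable_sub hWk).abs 1 fun z => by
          rw [abs_abs]; exact abs_sub_le_one_of_mem ((hU j).2 _ _) (hWk.2 _ _))
  have c3 := c1.add c2 ((hY n).measurable_sub (hT n j)) ((hT n j).measurable_sub hWk)
    (fun x y => abs_sub_le_one_of_mem ((hY n).2 _ _) ((hT n j).2 _ _))
    (fun x y => abs_sub_le_one_of_mem ((hT n j).2 _ _) (hWk.2 _ _))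
  simp only [sub_add_sub_cancel] at c3
  exact c3.mono (by linarith)

end LimitKernel

section Compactness

lemma lt_iff_val_lt_card {N : ℕ} {κ : Fin N → ℕ} (hκ : Monotone κ) (i : Fin N) (a : ℕ) :
    κ i < a ↔ (i : ℕ) < (Finset.univ.filter fun x => κ x < a).card := by
  constructor
  · intro h
    have : Finset.Iic i ⊆ Finset.univ.filter fun x => κ x < a := fun x hx =>
      Finset.mem_filter.2 ⟨Finset.mem_univ _, (hκ (Finset.mem_Iic.1 hx)).trans_lt h⟩
    have := Finset.card_le_card this
    rw [Fin.card_Iic] at this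
    omega
  · intro h
    by_contra hcon
    have : (Finset.univ.filter fun x => κ x < a) ⊆ Finset.Iio i := fun x hx => by
      rw [Finset.mem_Iio]
      by_contra hx'
      exact hcon ((hκ (not_lt.1 hx')).trans_lt (Finset.mem_filter.1 hx).2)
    have := Finset.card_le_card this
    rw [Fin.card_Iio] at this
    omega

/-- A monotone labelling is determined by its breakpoints. -/
lemma label_cell_eq {N : ℕ} [NeZero N] {κ : Fin N → ℕ} (hκ : Monotone κ) {K : ℕ}
    (hK : ∀ i, κ i ≤ K) {x : ℝ} (hx : x ∈ Set.Ico (0 : ℝ) 1) :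
    κ (cell N x) = ((Finset.Icc 1 K).filter fun a =>
      ((Finset.univ.filter fun i => κ i < a).card : ℝ) / N ≤ x).card := by
  have h : ((Finset.Icc 1 K).filter fun a =>
      ((Finset.univ.filter fun i => κ i < a).card : ℝ) / N ≤ x)
      = Finset.Icc 1 (κ (cell N x)) := by
    ext a
    have e : ((Finset.univ.filter fun i => κ i < a).card : ℝ) / N ≤ x ↔ a ≤ κ (cell N x) := by
      rw [← not_lt, ← cell_val_lt_iff hx, ← lt_iff_val_lt_card hκ, not_lt]
    rw [Finset.mem_filter, Finset.mem_Icc, Finset.mem_Icc, e]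
    have := hK (cell N x)
    omega
  rw [h, Nat.card_Icc, Nat.add_sub_cancel]

lemma eventually_filter_le_eq {t : ℕ → ℕ → ℝ} {s : ℕ → ℝ}
    (h : ∀ a, Tendsto (fun n => t n a) atTop (nhds (s a))) {x : ℝ} (hx : ∀ a, x ≠ s a)
    (I : Finset ℕ) :
    ∀ᶠ n in atTop, (I.filter fun a => t n a ≤ x) = I.filter fun a => s a ≤ x := by
  have : ∀ a ∈ I, ∀ᶠ n in atTop, (t n a ≤ x ↔ s a ≤ x) := fun a _ => by
    rcases lt_or_gt_of_ne (hx a) with h' | h'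
    · filter_upwards [(h a).eventually_const_lt h'] with n hn
      exact iff_of_false (not_le.2 hn) (not_le.2 h')
    · filter_upwards [(h a).eventually_lt_const h'] with n hn
      exact iff_of_true hn.le h'.le
  filter_upwards [(Filter.eventually_all_finset I).2 this] with n hn
  exact Finset.filter_congr hn

/-- Compactness of the space of graphons: symmetric matrices have, after permutations of the
indices, a subsequence which converges in cut norm to a graphon. -/
theorem exists_subseq_cut_limit {V : ℕ → ℕ} [∀ n, NeZero (V n)]
    {A : ∀ n, Fin (V n) → Fin (V n) → ℝ} (hA : ∀ n a b, A n a b ∈ Set.Icc (0 : ℝ) 1)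
    (hs : ∀ n a b, A n a b = A n b a) :
    ∃ (σ : ∀ n, Equiv.Perm (Fin (V n))) (φ : ℕ → ℕ) (W : ℝ → ℝ → ℝ), StrictMono φ ∧
      IsGraphon W ∧ ∀ c : ℝ, 0 < c → ∀ᶠ n in atTop, CutLe unitMeasure (fun x y =>
        stepKer (fun a b => A (φ n) (σ (φ n) a) (σ (φ n) b)) x y - W x y) c := by
  choose σ κ hlt hdiv hmono hcut using fun n => exists_sorted_refinements (A n) n
  set A' : ∀ n, Fin (V n) → Fin (V n) → ℝ := fun n a b => A n (σ n a) (σ n b) with hA'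
  have hA'm : ∀ n a b, A' n a b ∈ Set.Icc (0 : ℝ) 1 := fun n a b => hA _ _ _
  have hA's : ∀ n a b, A' n a b = A' n b a := fun n a b => hs _ _ _
  let z : ℕ → ℕ × ℕ × ℕ → ℝ × ℝ := fun n q =>
    (((Finset.univ.filter fun i => κ n q.1 i < q.2.1).card : ℝ) / V n,
      blockAvg (κ n q.1) (A' n) q.2.1 q.2.2)
  have hz : ∀ n, z n ∈ Set.univ.pi fun _ : ℕ × ℕ × ℕ =>
      (Set.Icc (0 : ℝ) 1 ×ˢ Set.Icc (0 : ℝ) 1 : Set (ℝ × ℝ)) := fun n q _ => by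
    refine ⟨⟨by positivity, div_le_one_of_le₀ ?_ (Nat.cast_nonneg _)⟩, blockAvg_mem _ (hA'm n) _ _⟩
    exact_mod_cast (Finset.card_le_univ _).trans (Fintype.card_fin _).le
  obtain ⟨L, hL, φ, hφ, hlim⟩ := (isCompact_univ_pi fun _ : ℕ × ℕ × ℕ =>
    (isCompact_Icc (a := (0 : ℝ)) (b := 1)).prod (isCompact_Icc (a := (0 : ℝ)) (b := 1))).tendsto_subseq hz
  rw [tendsto_pi_nhds] at hlim
  have ht : ∀ j a, Tendsto (fun n =>
      ((Finset.univ.filter fun i => κ (φ n) j i < a).card : ℝ) / V (φ n)) atTop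
      (nhds (L (j, a, 0)).1) := fun j a => (continuous_fst.tendsto _).comp (hlim (j, a, 0))
  have hd : ∀ j a b, Tendsto (fun n => blockAvg (κ (φ n) j) (A' (φ n)) a b) atTop
      (nhds (L (j, a, b)).2) := fun j a b => (continuous_snd.tendsto _).comp (hlim (j, a, b))
  let h : ℕ → ℝ → ℕ := fun j x => ((Finset.Icc 1 (4 ^ j)).filter fun a => (L (j, a, 0)).1 ≤ x).card
  have hh : ∀ j, Measurable (h j) := fun j => by
    simp only [h, Finset.card_filter]
    exact Finset.measurable_fun_sum _ fun a _ =>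
      Measurable.ite measurableSet_Ici measurable_const measurable_const
  have hev : ∀ j, ∀ᵐ x ∂unitMeasure, ∀ᶠ n in atTop, κ (φ n) j (cell (V (φ n)) x) = h j x := by
    intro j
    filter_upwards [ae_mem_Ico,
      (Set.countable_range fun a => (L (j, a, 0)).1).ae_notMem unitMeasure] with x hx hx'
    have hne : ∀ a, x ≠ (L (j, a, 0)).1 := fun a hxa => hx' ⟨a, hxa.symm⟩
    filter_upwards [eventually_filter_le_eq (ht j) hne (Finset.Icc 1 (4 ^ j)),
      eventually_ge_atTop j] with n hn hjn
    rw [label_cell_eq (hmono (φ n) j (hjn.trans (hφ.id_le n))) (fun i => (hlt (φ n) j i).le) hx, hn]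
  have hdisp : ∃ W, IsGraphon W ∧ ∀ c : ℝ, 0 < c →
      ∀ᶠ n in atTop, CutLe unitMeasure (fun x y => stepKer (A' (φ n)) x y - W x y) c := by
    refine exists_graphon_cut_limit (fun n => isKer_stepKer (hA'm (φ n)))
      (T := fun n j => stepKer fun a b =>
        blockAvg (κ (φ n) j) (A' (φ n)) (κ (φ n) j a) (κ (φ n) j b))
      (fun n j => isKer_stepKer fun a b => blockAvg_mem _ (hA'm _) _ _)
      (U := fun j x y => (L (j, h j x, h j y)).2)
      (fun j => ⟨?_, fun x y => (hL (j, h j x, h j y) (Set.mem_univ _)).2⟩)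
      (fun j x y => ?_) (fun j => ?_)
      (e := fun n j => blockEnergy (κ (φ n) j) (A' (φ n))) (fun n j => ?_) (fun n k l hkl => ?_)
      (fun n j => ?_)
    · have h1 : Measurable fun q : ℕ × ℕ => (L (j, q.1, q.2)).2 := measurable_of_countable _
      exact h1.comp (((hh j).comp measurable_fst).prodMk ((hh j).comp measurable_snd))
    · refine tendsto_nhds_unique (hd j (h j x) (h j y)) ((hd j (h j y) (h j x)).congr fun n => ?_)
      exact blockAvg_comm _ (hA's _) _ _
    · have e1 : ∀ᵐ z ∂(unitMeasure.prod unitMeasure), ∀ᶠ n in atTop,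
          κ (φ n) j (cell (V (φ n)) z.1) = h j z.1 :=
        Measure.quasiMeasurePreserving_fst.ae (hev j)
      have e2 : ∀ᵐ z ∂(unitMeasure.prod unitMeasure), ∀ᶠ n in atTop,
          κ (φ n) j (cell (V (φ n)) z.2) = h j z.2 :=
        Measure.quasiMeasurePreserving_snd.ae (hev j)
      filter_upwards [e1, e2] with z hz1 hz2
      refine (hd j (h j z.1) (h j z.2)).congr' ?_
      filter_upwards [hz1, hz2] with n hn1 hn2
      rw [stepKer, hn1, hn2]
    · exact integral_cell_prod fun a b =>
        blockAvg (κ (φ n) j) (A' (φ n)) (κ (φ n) j a) (κ (φ n) j b) ^ 2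
    · rw [← sum_sq_blockAvg_sub (π := (· / 4 ^ (l - k))) (hdiv (φ n) k l hkl)]
      exact integral_cell_prod fun a b =>
        (blockAvg (κ (φ n) l) (A' (φ n)) (κ (φ n) l a) (κ (φ n) l b)
          - blockAvg (κ (φ n) k) (A' (φ n)) (κ (φ n) k a) (κ (φ n) k b)) ^ 2
    · exact cutLe_stepKer (B := fun a b => A' (φ n) a b
        - blockAvg (κ (φ n) j) (A' (φ n)) (κ (φ n) j a) (κ (φ n) j b)) (hcut (φ n) j)
  obtain ⟨W, hW, hWcut⟩ := hdisp
  exact ⟨σ, φ, W, hφ, hW, hWcut⟩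

end Compactness

section Assembly

variable {m : ℕ}

lemma CutLe.neg {Ω : Type*} [MeasurableSpace Ω] {μ : Measure Ω} {D E : Ω → Ω → ℝ} {c : ℝ}
    (h : CutLe μ (fun x y => D x y - E x y) c) : CutLe μ (fun x y => E x y - D x y) c := by
  intro f g hf hg hf' hg'
  rw [← abs_neg, ← integral_neg]
  refine le_of_eq_of_le (congrArg abs (integral_congr_ae (ae_of_all _ fun z => ?_)))
    (h f g hf hg hf' hg')
  simp only
  ring

lemma ae_eq_zero_of_forall_prod {μ : Measure ℝ} [IsFiniteMeasure μ] {D : ℝ × ℝ → ℝ}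
    (hD : Integrable D (μ.prod μ))
    (h : ∀ s t, MeasurableSet s → MeasurableSet t → ∫ z in s ×ˢ t, D z ∂(μ.prod μ) = 0) :
    D =ᵐ[μ.prod μ] 0 := by
  refine hD.ae_eq_zero_of_forall_setIntegral_eq_zero fun S hS _ => ?_
  have huniv : ∫ z, D z ∂(μ.prod μ) = 0 := by
    have := h Set.univ Set.univ MeasurableSet.univ MeasurableSet.univ
    rwa [Set.univ_prod_univ, setIntegral_univ] at this
  induction S, hS using MeasurableSpace.induction_on_inter generateFrom_prod.symm
    isPiSystem_prod with
  | empty => simp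
  | basic t ht =>
    obtain ⟨a, ha, b, hb, rfl⟩ := ht
    exact h a b ha hb
  | compl t ht ih =>
    have := integral_add_compl ht hD
    rw [ih (measure_lt_top _ _)] at this
    linarith
  | iUnion f hd hf ih =>
    rw [integral_iUnion hf hd hD.integrableOn]
    simp [ih _ (measure_lt_top _ _)]

lemma IsKer.ae_eq_const {W : ℝ → ℝ → ℝ} (hW : IsKer W) {p : ℝ} (hp : p ∈ Set.Icc (0 : ℝ) 1)
    (h : ∀ c : ℝ, 0 < c → CutLe unitMeasure (fun x y => W x y - p) c) :
    (fun z : ℝ × ℝ => W z.1 z.2) =ᵐ[volume.restrict unitSquare] fun _ => p := by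
  have e : volume.restrict unitSquare = unitMeasure.prod unitMeasure := by
    rw [unitMeasure, Measure.prod_restrict]; rfl
  rw [e]
  have hWm : Measurable fun z : ℝ × ℝ => W z.1 z.2 := hW.1
  have hi : Integrable (fun z : ℝ × ℝ => W z.1 z.2 - p) (unitMeasure.prod unitMeasure) :=
    integrable_of_Icc (hWm.sub_const p) 1 fun z =>
      abs_sub_le_one_of_mem (hW.2 _ _) hp
  have := ae_eq_zero_of_forall_prod hi fun s t hs ht => by
    refine abs_eq_zero.1 (le_antisymm (le_of_forall_pos_le_add fun c hc => ?_) (abs_nonneg _))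
    have h1 := h c hc (s.indicator fun _ => 1) (t.indicator fun _ => 1)
      (measurable_const.indicator hs) (measurable_const.indicator ht)
      (fun x => by by_cases hx : x ∈ s <;> simp [hx]) (fun x => by by_cases hx : x ∈ t <;> simp [hx])
    rw [zero_add, ← integral_indicator (hs.prod ht)]
    refine le_of_eq_of_le (congrArg abs (integral_congr_ae (ae_of_all _ fun z => ?_))) h1
    by_cases h1 : z.1 ∈ s <;> by_cases h2 : z.2 ∈ t <;> simp [Set.indicator, h1, h2]
  filter_upwards [this] with z hz
  exact sub_eq_zero.1 hz

lemma homDens_comap {N : ℕ} (F : SimpleGraph (Fin m)) (G : SimpleGraph (Fin N))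
    (σ : Equiv.Perm (Fin N)) : homDens F (G.comap σ) = homDens F G := by
  rw [homDens, homDens]
  congr 1
  exact Equiv.sum_comp (Equiv.arrowCongr (Equiv.refl (Fin m)) σ)
    fun v => ∏ e ∈ orderedEdges F, adjR G (v e.1) (v e.2)

lemma partDens_comap {N : ℕ} (F : SimpleGraph (Fin m)) (G : SimpleGraph (Fin N))
    (σ : Equiv.Perm (Fin N)) (U : Fin m → Finset (Fin N)) :
    partDens F (G.comap σ) U = partDens F G fun i => (U i).map σ.toEmbedding := by
  classical
  rw [partDens, partDens]
  congr 1
  refine Eq.trans (Finset.sum_congr rfl fun v _ => ?_)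
    (Equiv.sum_comp (Equiv.arrowCongr (Equiv.refl (Fin m)) σ) _)
  refine congrArg₂ (· * ·) rfl ?_
  refine Finset.prod_congr rfl fun i _ => if_congr ?_ rfl rfl
  simp [Equiv.arrowCongr]

variable {F : SimpleGraph (Fin m)} {w : Equiv.Perm (Fin m) → ℝ} {p : ℝ} {α : Fin m → ℝ}
  {V : ℕ → ℕ} {G : ∀ n, SimpleGraph (Fin (V n))}

lemma WSeq.comap (h : WSeq F w p α V G) (σ : ∀ n, Equiv.Perm (Fin (V n))) :
    WSeq F w p α V fun n => (G n).comap (σ n) := by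
  intro δ hδ
  filter_upwards [h δ hδ] with n hn U hd hU
  have := hn (fun i => (U i).map (σ n).toEmbedding)
    (fun i j hij => (Finset.disjoint_map _).2 (hd hij)) (fun i => by rw [Finset.card_map, hU])
  simpa only [partDens_comap, Finset.card_map] using this

lemma WSeq.comp (h : WSeq F w p α V G) {φ : ℕ → ℕ} (hφ : Tendsto φ atTop atTop) :
    WSeq F w p α (fun n => V (φ n)) fun n => G (φ n) :=
  fun δ hδ => hφ.eventually (h δ hδ)

lemma IsQuasirandom.wSeq (hw : ∀ σ, 0 ≤ w σ) (hw1 : ∑ σ, w σ = 1)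
    (hp : p ∈ Set.Icc (0 : ℝ) 1) (hα : ∀ i, α i ∈ Set.Icc (0 : ℝ) 1) (hsum : ∑ i, α i ≤ 1)
    (hV : Tendsto V atTop atTop) (h : IsQuasirandom p V G) : WSeq F w p α V G := by
  rw [isQuasirandom_iff hV] at h
  obtain ⟨k, hk⟩ := eventually_atTop.1 (hV.eventually_ge_atTop 1)
  have hk' : Tendsto (fun n => n + k) atTop atTop := tendsto_add_atTop_nat k
  have : ∀ n, NeZero (V (n + k)) := fun n => ⟨Nat.pos_iff_ne_zero.1 (hk _ (Nat.le_add_left _ _))⟩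
  have h' : WSeq F w p α (fun n => V (n + k)) fun n => G (n + k) :=
    (wGraphon_const F hw1 p α).wSeq (V := fun n => V (n + k)) hw hw1 hp hα hsum
      ⟨measurable_const, fun _ _ => hp⟩
      (hV.comp hk') fun c hc =>
        eventually_cutLe_const (fun l H => (h l H).comp hk') hc
  intro δ hδ
  rw [← map_add_atTop_eq_nat k]
  exact h' δ hδ

lemma WSeq.isQuasirandom (hw : ∀ σ, 0 ≤ w σ) (hw1 : ∑ σ, w σ = 1)
    (hp : p ∈ Set.Icc (0 : ℝ) 1) (hα : ∀ i, α i ∈ Set.Icc (0 : ℝ) 1) (hsum : ∑ i, α i ≤ 1)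
    (hV : Tendsto V atTop atTop)
    (hgr : ∀ W : ℝ → ℝ → ℝ, IsGraphon W → WGraphon F w p α W →
      (fun z : ℝ × ℝ => W z.1 z.2) =ᵐ[volume.restrict unitSquare] fun _ => p)
    (h : WSeq F w p α V G) : IsQuasirandom p V G := by
  rw [isQuasirandom_iff hV]
  intro l H
  by_contra hcon
  rw [Metric.tendsto_nhds] at hcon
  push Not at hcon
  obtain ⟨ε, hε, hfreq⟩ := hcon
  obtain ⟨φ, hφ, hφ'⟩ := extraction_of_frequently_atTop
    (hfreq.and_eventually (hV.eventually_ge_atTop 1))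
  have : ∀ n, NeZero (V (φ n)) := fun n => ⟨(Nat.pos_iff_ne_zero.1 (hφ' n).2)⟩
  obtain ⟨σ, ψ, W, hψ, hW, hcut⟩ := exists_subseq_cut_limit (V := fun n => V (φ n))
    (A := fun n => adjR (G (φ n))) (fun n => adjR_mem _) (fun n => adjR_comm _)
  have hVψ : Tendsto (fun n => V (φ (ψ n))) atTop atTop :=
    hV.comp (hφ.tendsto_atTop.comp hψ.tendsto_atTop)
  have hcut' : ∀ c : ℝ, 0 < c → ∀ᶠ n in atTop, CutLe unitMeasure (fun x y =>
      stepKer (adjR ((G (φ (ψ n))).comap (σ (ψ n)))) x y - W x y) c := hcut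
  have hker : IsKer W := ⟨hW.1, hW.2.2⟩
  have hae := hgr W hW (((h.comp (hφ.tendsto_atTop.comp hψ.tendsto_atTop)).comap
    fun n => σ (ψ n)).wGraphon hw hw1 hp hα hsum hker hVψ hcut')
  have e : volume.restrict unitSquare = unitMeasure.prod unitMeasure := by
    rw [unitMeasure, Measure.prod_restrict]; rfl
  rw [e] at hae
  have hlim := tendsto_homDens_of_cutLe (V := fun n => V (φ (ψ n)))
    (G := fun n => (G (φ (ψ n))).comap (σ (ψ n))) hp (fun c hc => by
      filter_upwards [hcut' c hc] with n hn f g hf hg hf' hg'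
      refine le_of_eq_of_le (congrArg abs (integral_congr_ae ?_)) (hn f g hf hg hf' hg')
      filter_upwards [hae] with z hz
      have hz' : W z.1 z.2 = p := hz
      simp only [hz']) H
  simp only [homDens_comap] at hlim
  obtain ⟨n, hn⟩ := (Metric.tendsto_nhds.1 hlim ε hε).exists
  exact absurd hn (not_lt.2 (hφ' (ψ n)).1)

lemma WGraphon.ae_eq_const (hw : ∀ σ, 0 ≤ w σ) (hw1 : ∑ σ, w σ = 1)
    (hp : p ∈ Set.Icc (0 : ℝ) 1) (hα : ∀ i, α i ∈ Set.Icc (0 : ℝ) 1) (hsum : ∑ i, α i ≤ 1)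
    (hseq : ∀ (V : ℕ → ℕ) (G : ∀ n, SimpleGraph (Fin (V n))), Tendsto V atTop atTop →
      WSeq F w p α V G → IsQuasirandom p V G)
    {W : ℝ → ℝ → ℝ} (hW : IsGraphon W) (h : WGraphon F w p α W) :
    (fun z : ℝ × ℝ => W z.1 z.2) =ᵐ[volume.restrict unitSquare] fun _ => p := by
  have hV : Tendsto (fun n => n + 1) atTop atTop := tendsto_add_atTop_nat 1
  have hker : IsKer W := ⟨hW.1, hW.2.2⟩
  obtain ⟨G, hG⟩ := exists_graph_tendsto hW hV
  have hq := hseq _ G hV (h.wSeq hw hw1 hp hα hsum hker hV hG)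
  rw [isQuasirandom_iff hV] at hq
  refine hker.ae_eq_const hp fun c hc => ?_
  obtain ⟨n, hn, hn'⟩ := ((eventually_cutLe_const hq (half_pos hc)).and
    (hG _ (half_pos hc))).exists
  have hs : IsKer fun x y => stepKer (adjR (G n)) x y := isKer_stepKer (adjR_mem (G n))
  have := hn'.neg.add hn (hker.measurable_sub hs) (hs.measurable_sub ⟨measurable_const, fun _ _ => hp⟩)
    (fun x y => abs_sub_le_one_of_mem (hker.2 _ _) (hs.2 _ _))
    (fun x y => abs_sub_le_one_of_mem (hs.2 _ _) hp)
  simpa only [sub_add_sub_cancel, add_halves] using this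

/-- The equivalence between sequences of graphs and graphons, for the weighted properties. -/
theorem forall_wSeq_iff_forall_wGraphon (hw : ∀ σ, 0 ≤ w σ) (hw1 : ∑ σ, w σ = 1)
    (hp : p ∈ Set.Icc (0 : ℝ) 1) (hα : ∀ i, α i ∈ Set.Icc (0 : ℝ) 1) (hsum : ∑ i, α i ≤ 1) :
    (∀ (V : ℕ → ℕ) (G : ∀ n, SimpleGraph (Fin (V n))), Tendsto V atTop atTop →
        (WSeq F w p α V G ↔ IsQuasirandom p V G))
      ↔ ∀ W : ℝ → ℝ → ℝ, IsGraphon W → WGraphon F w p α W →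
          (fun z : ℝ × ℝ => W z.1 z.2) =ᵐ[volume.restrict unitSquare] fun _ => p :=
  ⟨fun h _ hW hW' => hW'.ae_eq_const hw hw1 hp hα hsum (fun V G hV => (h V G hV).1) hW,
    fun h _ _ hV => ⟨fun hG => hG.isQuasirandom hw hw1 hp hα hsum hV h,
      fun hG => hG.wSeq hw hw1 hp hα hsum hV⟩⟩

end Assembly

/-- **Lemma (Lequiv).** The graph-sequence property `P(F;α)` is `p`-quasi-random iff
every graphon satisfying `P^W(F;α)` is a.e. equal to `p`; similarly for `P̃` and `P̃^W`. -/
theorem stmt6 {m : ℕ} (F : SimpleGraph (Fin m)) (p : ℝ) (hp0 : 0 ≤ p) (hp1 : p ≤ 1)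
    (α : Fin m → ℝ) (hα : ∀ i, α i ∈ Set.Ioo (0 : ℝ) 1) (hsum : ∑ i, α i ≤ 1) :
    ((∀ (V : ℕ → ℕ) (G : ∀ n, SimpleGraph (Fin (V n))), Tendsto V atTop atTop →
        (SatisfiesP F p α V G ↔ IsQuasirandom p V G))
      ↔ (∀ W : ℝ → ℝ → ℝ, IsGraphon W → GraphonP F W p α →
          (fun z : ℝ × ℝ => W z.1 z.2)
            =ᵐ[volume.restrict unitSquare] fun _ => p))
    ∧ ((∀ (V : ℕ → ℕ) (G : ∀ n, SimpleGraph (Fin (V n))), Tendsto V atTop atTop →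
        (SatisfiesPt F p α V G ↔ IsQuasirandom p V G))
      ↔ (∀ W : ℝ → ℝ → ℝ, IsGraphon W → GraphonPt F W p α →
          (fun z : ℝ × ℝ => W z.1 z.2)
            =ᵐ[volume.restrict unitSquare] fun _ => p)) := by
  have hp : p ∈ Set.Icc (0 : ℝ) 1 := ⟨hp0, hp1⟩
  have hα' : ∀ i, α i ∈ Set.Icc (0 : ℝ) 1 := fun i => Set.Ioo_subset_Icc_self (hα i)
  have hα0 : ∀ i, 0 ≤ α i := fun i => (hα' i).1
  constructor
  · have h1 : ∀ σ : Equiv.Perm (Fin m), 0 ≤ (Pi.single 1 1 : Equiv.Perm (Fin m) → ℝ) σ :=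
      fun σ => (Pi.single_nonneg.2 zero_le_one : (0 : Equiv.Perm (Fin m) → ℝ) ≤ _) σ
    have h2 : ∑ σ, (Pi.single 1 1 : Equiv.Perm (Fin m) → ℝ) σ = 1 := by simp
    refine Iff.trans ?_ ((forall_wSeq_iff_forall_wGraphon (F := F) h1 h2 hp hα' hsum).trans ?_)
    · exact forall_congr' fun V => forall_congr' fun G => imp_congr_right fun hV => by
        rw [satisfiesP_iff hV]
    · exact forall_congr' fun W => imp_congr_right fun _ => by rw [graphonP_iff hα0]
  · have h1 : ∀ _ : Equiv.Perm (Fin m), 0 ≤ (m.factorial : ℝ)⁻¹ := fun _ => by positivity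
    have h2 : ∑ _σ : Equiv.Perm (Fin m), (m.factorial : ℝ)⁻¹ = 1 := by
      rw [Finset.sum_const, Finset.card_univ, Fintype.card_perm, Fintype.card_fin, nsmul_eq_mul]
      exact mul_inv_cancel₀ (Nat.cast_ne_zero.2 m.factorial_ne_zero)
    refine Iff.trans ?_ ((forall_wSeq_iff_forall_wGraphon (F := F) h1 h2 hp hα' hsum).trans ?_)
    · exact forall_congr' fun V => forall_congr' fun G => imp_congr_right fun hV => by
        rw [satisfiesPt_iff hV]
    · exact forall_congr' fun W => imp_congr_right fun hW => by
        rw [graphonPt_iff hα0 ⟨hW.1, hW.2.2⟩]
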